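/- arXiv:1905.01423 — 3 statements merged into one kernel-verified Lean document; each statement's English description precedes it below -/
import Mathlib

section
/- For every integer n ≥ 3, n/φ(n) ≤ (9/5)·log(log n) + 2.51/log(log n). -/
namespace RS

/-- Run a state machine over `[lo, lo + 2^k)` by binary splitting; `0` means failure. -/
noncomputable def runT (f : ℕ → ℕ → ℕ) (k : ℕ) : ℕ → ℕ → ℕ :=
  Nat.rec (motive := fun _ => ℕ → ℕ → ℕ) (fun lo s => f lo s)
    (fun k ih lo s => Nat.rec (motive := fun _ => ℕ) 0
      (fun s' _ => ih (Nat.add lo (Nat.pow 2 k)) s') (ih lo s)) k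

/-- Check a predicate over `[lo, lo + 2^k)` by binary splitting. -/
noncomputable def allT (f : ℕ → Bool) (k : ℕ) : ℕ → Bool :=
  Nat.rec (motive := fun _ => ℕ → Bool) (fun lo => f lo)
    (fun k ih lo => cond (ih lo) (ih (Nat.add lo (Nat.pow 2 k))) false) k

theorem allT_spec (f : ℕ → Bool) (k : ℕ) : ∀ lo, allT f k lo = true →
    ∀ m, lo ≤ m → m < lo + 2 ^ k → f m = true := by
  induction k with
  | zero =>
    intro lo h m h1 h2
    have : m = lo := by simp at h2; omega
    subst this; exact h
  | succ k ih =>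
    intro lo h m h1 h2
    have h' : (cond (allT f k lo) (allT f k (Nat.add lo (Nat.pow 2 k))) false) = true := h

    rw [Bool.cond_false_right, Bool.and_eq_true] at h'
    obtain ⟨ha, hb⟩ := h'
    by_cases hm : m < lo + 2 ^ k
    · exact ih lo ha m h1 hm
    · refine ih _ hb m ?_ ?_
      · change lo + 2 ^ k ≤ m
        omega
      · change m < lo + 2 ^ k + 2 ^ k
        rw [pow_succ] at h2; omega

/-- Invariant principle for `runT`. -/
theorem runT_spec (f : ℕ → ℕ → ℕ) (I : ℕ → ℕ → Prop)
    (hf : ∀ m s s', I m s → f m s = s' + 1 → I (m + 1) s') (k : ℕ) :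
    ∀ lo s s', I lo s → runT f k lo s = s' + 1 →
      (∀ m, lo ≤ m → m < lo + 2 ^ k → ∃ s, I (m + 1) s) ∧ I (lo + 2 ^ k) s' := by
  induction k with
  | zero =>
    intro lo s s' h0 h
    have h1 := hf lo s s' h0 h
    refine ⟨?_, by simpa using h1⟩
    intro m h2 h3
    have : m = lo := by simp at h3; omega
    subst this; exact ⟨s', h1⟩
  | succ k ih =>
    intro lo s s' h0 h
    have h' : (Nat.rec (motive := fun _ => ℕ) 0
      (fun s' _ => runT f k (Nat.add lo (Nat.pow 2 k)) s') (runT f k lo s) : ℕ) = s' + 1 := h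
    cases hr : runT f k lo s with
    | zero => rw [hr] at h'; simp at h'
    | succ t =>
      rw [hr] at h'
      have h'' : runT f k (lo + 2 ^ k) t = s' + 1 := h'
      obtain ⟨a1, a2⟩ := ih lo s t h0 hr
      obtain ⟨b1, b2⟩ := ih _ t s' a2 h''
      refine ⟨?_, ?_⟩
      · intro m h1 h2
        by_cases hm : m < lo + 2 ^ k
        · exact a1 m h1 hm
        · refine b1 m (by omega) ?_
          rw [pow_succ] at h2; omega
      · rw [pow_succ, mul_two, ← add_assoc]; exact b2

/-- Coefficients `(d, a)` of the Chebyshev-type combination. -/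
def cs : List (ℕ × ℤ) := [
  (70, 600), (72, 7101), (77, 300), (80, 400), (84, 400), (88, 200), (90, 900), (99, 600),
   (105, 300), (108, 200), (110, 200), (112, 800), (120, 600), (126, 600), (132, 300),
   (135, 500), (140, (-200)), (144, (-6101)), (154, 400), (165, 300), (168, 400), (176, 200),
   (189, 900), (198, 600), (210, (-300)), (216, (-6901)), (220, 200), (231, 500), (240, 200),
   (252, 200), (264, 100), (270, (-400)), (280, 400), (297, 400), (315, 600), (330, 100),
   (336, (-200)), (360, (-6801)), (378, 100), (385, (-100)), (420, 400), (432, 6882),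
   (440, (-181)), (462, 300), (495, (-300)), (504, (-6601)), (528, 332), (540, 368),
   (560, (-900)), (616, 1600), (630, (-1600)), (660, 300), (693, 500), (720, 7001),
   (756, (-591)), (770, (-409)), (792, (-5801)), (840, (-81)), (880, (-519)), (924, (-1000)),
   (945, (-4238)), (990, (-1095)), (1008, 6701), (1080, 6833), (1155, (-400)), (1188, (-1000)),
   (1232, (-3293)), (1260, (-2089)), (1320, (-1219)), (1386, (-4187)), (1485, (-2014)),
   (1512, 5692), (1540, 1209), (1584, 4601), (1680, (-4401)), (1848, 214), (1890, 5524),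
   (1980, 95), (2079, (-2386)), (2160, (-10675)), (2310, 364), (2376, 2756), (2520, 8990),
   (2640, (-913)), (2772, 3956), (2970, (-535)), (3024, (-7581)), (3080, (-3877)),
   (3465, (-2237)), (3696, 350), (3780, 127), (3960, 5805), (4158, 2896), (4620, 329),
   (4752, (-3170)), (5040, (-4119)), (5544, (-4446)), (5940, 10688), (6160, 2136),
   (6930, 6266), (7560, (-6629)), (7920, (-4214)), (8316, (-3768)), (9240, (-3717)),
   (10395, 6686), (11088, 20), (11880, (-14968)), (13860, (-5937)), (15120, 13270),
   (16632, (-2861)), (18480, (-993)), (20790, (-5372)), (23760, 7733), (27720, 4604),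
   (33264, (-805)), (41580, (-8847)), (55440, (-4646)), (83160, 4986), (166320, (-21846))]

/-- Shifted jumps of the step function attached to `cs`, as a function of the gcd with `166320`,
packed into one number. -/
def wt (g : ℕ) : ℕ :=
  Nat.mod (Nat.div
    1812719635312667027820887510403259759621764866520433604324888720560414842287543702192713471380256233133827972709855107731648664428371080156667987695068702290593027582604386753572491922750608225511807653141318733427115273266985339706312137882465847228927533964753692130389579073269845750147799799594948483677491462038655907699698624279837658576535348781792055031487569210159025819115887998912257591985043610651022909870948042452030020377453681725764596640444458908957588687238909191162424605585658372440581944914999660068020455553319320705290205138527002005214661497816374240929118173233886424155449229461397940688292213061036674990847630045791536467765134615454118043487027605246013360062202505836896204211002895488594976379246541609892354964847485231680452358086698452124611653240858616913124018598297188183932369136040983682402971386592176976813393110507925471929171589687457016744593973599507439051739571608490083014938899514386177795714156985800307488220338807679274307715723425954726987527791556732849381912477909561208191961040149564046629568001177061503789937674412619688591377074384146040018036049596271854574625275633666911231986072837650128403443217006317643337309217701685228469918249369778269045464644534571404311521460668663813954184894031940434381860416989953267241743618311382567137451404654038602949853324089976002824625686046413014323054120036135884306192540956860644368224801990826435731588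41030183351778672251115326864676840922475208442704199591921418133233666991718949177399057409019689379989349451589727921390895131926142439554631384286933776380156098139820554472746189497515636286955361632971761448917318766132733728909387439440607682563791344080917617078101961052939510523614297177868516048433976385606052522391203788215373522778772077018430870266609106661132807277558568751432644250696978347706753933452684993065206240037604651830760457231860939986419039605386513822735058193766240695151037219440254621632705515829725300253667821085251015336793807487363639459418192640264622368253315456350502257141770354969707317334822361202836779318123129212012176405387769306473469115891712
    (Nat.pow 2 (Nat.mul 22 (Nat.mod g 317)))) 4194304

/-- The step function attached to a coefficient list. -/
def Fs (l : List (ℕ × ℤ)) (m : ℕ) : ℤ := (l.map fun p => p.2 * ((m / p.1 : ℕ) : ℤ)).sum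

/-- The jump of the step function at `g`. -/
def Js (l : List (ℕ × ℤ)) (g : ℕ) : ℤ :=
  (l.map fun p => cond (Nat.beq (g % p.1) 0) p.2 0).sum

theorem Fs_succ (l : List (ℕ × ℤ)) (m : ℕ) : Fs l (m + 1) = Fs l m + Js l (m + 1) := by
  induction l with
  | nil => simp [Fs, Js]
  | cons p l ih =>
    simp only [Fs, Js, List.map_cons, List.sum_cons] at ih ⊢
    rw [ih, Nat.succ_div]
    by_cases h : p.1 ∣ m + 1
    · have : Nat.beq ((m + 1) % p.1) 0 = true := by
        rw [Nat.beq_eq]; exact Nat.mod_eq_zero_of_dvd h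
      rw [this]; simp [h]; ring
    · have : Nat.beq ((m + 1) % p.1) 0 = false := by
        rw [Bool.eq_false_iff, Ne, Nat.beq_eq]
        exact fun hh => h (Nat.dvd_of_mod_eq_zero hh)
      rw [this]; simp [h]; ring

theorem Js_gcd (l : List (ℕ × ℤ)) (N m : ℕ) (hl : ∀ p ∈ l, p.1 ∣ N) :
    Js l m = Js l (Nat.gcd m N) := by
  unfold Js
  congr 1
  apply List.map_congr_left
  intro p hp
  congr 1
  rw [Bool.eq_iff_iff, Nat.beq_eq, Nat.beq_eq, ← Nat.dvd_iff_mod_eq_zero,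
    ← Nat.dvd_iff_mod_eq_zero, Nat.dvd_gcd_iff]
  exact ⟨fun h => ⟨h, hl p hp⟩, fun h => h.1⟩

theorem Fs_period (l : List (ℕ × ℤ)) (N : ℕ) (hl : ∀ p ∈ l, p.1 ∣ N ∧ 0 < p.1) (r k : ℕ) :
    Fs l (N * k + r) = k * Fs l N + Fs l r := by
  induction l with
  | nil => simp [Fs]
  | cons p l ih =>
    have ih' := ih (fun p hp => hl p (List.mem_cons_of_mem _ hp))
    simp only [Fs, List.map_cons, List.sum_cons] at ih' ⊢
    rw [ih']
    obtain ⟨⟨c, hc⟩, hp⟩ := hl p List.mem_cons_self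
    have h1 : (N * k + r) / p.1 = c * k + r / p.1 := by
      rw [hc, mul_assoc, Nat.mul_add_div hp]
    have h2 : N / p.1 = c := by rw [hc]; exact Nat.mul_div_cancel_left _ hp
    rw [h1, h2]; push_cast; ring

noncomputable def stepG (N C : ℕ) (w : ℕ → ℕ) (m s : ℕ) : ℕ :=
  cond (Nat.ble N m) (Nat.succ s)
    (Nat.sub (Nat.succ (Nat.add s (w (Nat.gcd m N)))) C)

theorem stepG_spec (N C : ℕ) (w : ℕ → ℕ) (m s s' : ℕ) (h : stepG N C w m s = s' + 1)
    (hm : m < N) : s + w (Nat.gcd m N) = C + s' := by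
  have hb : Nat.ble N m = false := by
    rw [Bool.eq_false_iff, Ne, Nat.ble_eq]; omega
  unfold stepG at h
  rw [hb] at h
  have h2 : s + w (Nat.gcd m N) + 1 - C = s' + 1 := h
  omega

noncomputable def stepW : ℕ → ℕ → ℕ := stepG 166320 3000000 wt

def chkV (g : ℕ) : Bool := decide ((wt g : ℤ) = 3000000 + (72 * Js cs g - 7200))

noncomputable def chkW (j : ℕ) : Bool :=
  cond (Nat.beq (Nat.mod 166320 j) 0) (cond (chkV j) (chkV (166320 / j)) false) true

theorem cs_dvd : ∀ p ∈ cs, p.1 ∣ 166320 ∧ 0 < p.1 := by decide +kernel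

theorem wt_all : allT chkW 9 1 = true := by decide +kernel

theorem run_ok : Nat.ble 1 (runT stepW 18 73 (Int.toNat (72 * Fs cs 72 - 7200 * 73))) = true := by
  decide +kernel

theorem Fs72 : 0 ≤ 72 * Fs cs 72 - 7200 * 73 := by decide +kernel
theorem FsN : 72 * Fs cs 166320 = 7200 * 166320 := by decide +kernel
theorem Fs_small : ∀ m < 72, 0 ≤ Fs cs m := by decide +kernel

theorem wt_spec (g : ℕ) (hg : g ∣ 166320) : (wt g : ℤ) = 3000000 + (72 * Js cs g - 7200) := by
  have hpos : 0 < g := Nat.pos_of_dvd_of_pos hg (by norm_num)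
  obtain ⟨j, hj⟩ := hg
  have hjpos : 0 < j := by
    rcases Nat.eq_zero_or_pos j with h | h
    · subst h; simp at hj
    · exact h
  have key : ∀ a b : ℕ, 0 < a → 0 < b → a ≤ b → 166320 = a * b →
      chkV a = true ∧ chkV b = true := by
    intro a b ha hb hab h
    have ha2 : a ≤ 512 := by
      by_contra hc
      have : 513 * 513 ≤ a * b := Nat.mul_le_mul (by omega) (by omega)
      omega
    have h1 := allT_spec chkW 9 1 wt_all a (by omega) (by norm_num; omega)
    have hmod : Nat.beq (Nat.mod 166320 a) 0 = true := by
      rw [Nat.beq_eq]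
      exact Nat.mod_eq_zero_of_dvd ⟨b, h⟩
    have hdiv : 166320 / a = b := by rw [h]; exact Nat.mul_div_cancel_left _ ha
    unfold chkW at h1
    rw [hmod, hdiv] at h1
    simpa [Bool.cond_false_right, Bool.and_eq_true] using h1
  have : chkV g = true := by
    rcases le_total g j with h | h
    · exact (key g j hpos hjpos h hj).1
    · exact (key j g hjpos hpos h (by rw [hj, mul_comm])).2
  unfold chkV at this
  exact of_decide_eq_true this

theorem stepW_inv (m s s' : ℕ) (hI : m ≤ 166320 → 72 * Fs cs (m - 1) - 7200 * m = s)
    (hm : 1 ≤ m)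
    (h : stepW m s = s' + 1) :
    m + 1 ≤ 166320 → 72 * Fs cs (m + 1 - 1) - 7200 * ((m + 1 : ℕ) : ℤ) = s' := by
  intro hm1
  have h0 := hI (by omega)
  have h := stepG_spec 166320 3000000 wt m s s' h (by omega)
  have h3 := wt_spec (Nat.gcd m 166320) (Nat.gcd_dvd_right _ _)
  have h4 := Fs_succ cs (m - 1)
  rw [Nat.sub_add_cancel hm, Js_gcd cs 166320 m (fun p hp => (cs_dvd p hp).1)] at h4
  rw [Nat.add_sub_cancel, h4]
  have h5 : (s : ℤ) + (wt (Nat.gcd m 166320) : ℤ) = 3000000 + s' := by exact_mod_cast h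
  rw [h3] at h5
  push_cast
  linarith

theorem Fs_mid (m : ℕ) (h1 : 72 ≤ m) (h2 : m < 166320) : 7200 * ((m : ℤ) + 1) ≤ 72 * Fs cs m := by
  rcases Nat.eq_or_lt_of_le h1 with h | h
  · subst h
    have := Fs72
    push_cast; omega
  · have hr := run_ok
    rw [Nat.ble_eq] at hr
    obtain ⟨s', hs'⟩ : ∃ s', runT stepW 18 73 (Int.toNat (72 * Fs cs 72 - 7200 * 73)) = s' + 1 :=
      ⟨_, (Nat.sub_add_cancel hr).symm⟩
    have := (runT_spec stepW
      (fun m s => 1 ≤ m ∧ (m ≤ 166320 → 72 * Fs cs (m - 1) - 7200 * m = s))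
      (fun m s s' hI h => ⟨by omega, stepW_inv m s s' hI.2 hI.1 h⟩) 18 73 _ s'
      ⟨by norm_num, fun _ => by
        rw [Int.toNat_of_nonneg Fs72]; norm_num⟩ hs').1 m (by omega) (by norm_num; omega)
    obtain ⟨s, -, hs⟩ := this
    have := hs (by omega)
    simp only [Nat.add_sub_cancel] at this
    push_cast at this
    omega

theorem Fs_nonneg (m : ℕ) (h : m < 72) : 0 ≤ Fs cs m := Fs_small m h

theorem Fs_ge (m : ℕ) : 7200 * ((m : ℤ) + 1) - 72 * 7200 ≤ 72 * Fs cs m := by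
  have h := Fs_period cs 166320 cs_dvd (m % 166320) (m / 166320)
  rw [Nat.div_add_mod] at h
  have hN := FsN
  have hr : m % 166320 < 166320 := Nat.mod_lt _ (by norm_num)
  have hdm := Nat.div_add_mod m 166320
  have h3 : 7200 * (((m % 166320 : ℕ) : ℤ) + 1) - 72 * 7200 ≤ 72 * Fs cs (m % 166320) := by
    by_cases h72 : m % 166320 < 72
    · have := Fs_nonneg _ h72
      omega
    · have := Fs_mid _ (by omega) hr
      omega
  rw [h]
  have h5 : (166320 : ℤ) * ((m / 166320 : ℕ) : ℤ) + ((m % 166320 : ℕ) : ℤ) = m := by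
    exact_mod_cast hdm
  have h6 : 72 * (((m / 166320 : ℕ) : ℤ) * Fs cs 166320) =
    ((m / 166320 : ℕ) : ℤ) * (7200 * 166320) := by rw [← hN]; ring
  linarith

open ArithmeticFunction in
theorem log_fact (M : ℕ) :
    Real.log (M.factorial : ℝ) = ∑ n ∈ Finset.Ioc 0 M, vonMangoldt n * ((M / n : ℕ) : ℝ) := by
  rw [← ArithmeticFunction.sum_Ioc_mul_zeta_eq_sum, vonMangoldt_mul_zeta]
  induction M with
  | zero => simp
  | succ k ih =>
    rw [Finset.sum_Ioc_succ_top (Nat.zero_le k), ← ih, Nat.factorial_succ, Nat.cast_mul,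
      Real.log_mul (by positivity) (by positivity), add_comm]
    simp [ArithmeticFunction.log_apply]

open ArithmeticFunction in
theorem log_fact_div (Y d : ℕ) :
    Real.log ((Y / d).factorial : ℝ)
      = ∑ n ∈ Finset.Ioc 0 Y, vonMangoldt n * ((Y / n / d : ℕ) : ℝ) := by
  rw [log_fact]
  have hsub : Finset.Ioc 0 (Y / d) ⊆ Finset.Ioc 0 Y :=
    Finset.Ioc_subset_Ioc_right (Nat.div_le_self _ _)
  rw [Finset.sum_subset hsub]
  · refine Finset.sum_congr rfl fun n _ => ?_
    rw [Nat.div_div_eq_div_mul, Nat.div_div_eq_div_mul, mul_comm d n]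
  · intro n hn hn'
    simp only [Finset.mem_Ioc, not_and, not_le] at hn hn'
    rw [Nat.div_eq_of_lt (hn' hn.1)]; simp

/-- The combination of log-factorials attached to a coefficient list. -/
noncomputable def Gs (l : List (ℕ × ℤ)) (Y : ℕ) : ℝ :=
  (l.map fun p => (p.2 : ℝ) * Real.log ((Y / p.1).factorial : ℝ)).sum

open ArithmeticFunction in
theorem Gs_eq (l : List (ℕ × ℤ)) (Y : ℕ) :
    Gs l Y = ∑ n ∈ Finset.Ioc 0 Y, vonMangoldt n * (Fs l (Y / n) : ℝ) := by
  induction l with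
  | nil => simp [Gs, Fs]
  | cons p l ih =>
    simp only [Gs, Fs, List.map_cons, List.sum_cons] at ih ⊢
    rw [ih, log_fact_div, Finset.mul_sum, ← Finset.sum_add_distrib]
    refine Finset.sum_congr rfl fun n _ => ?_
    rw [Int.cast_add, Int.cast_mul, Int.cast_natCast]; ring

theorem stir_low (u : ℝ) (hu : 1 ≤ u) :
    u * Real.log u - u - (Real.log u + 1) ≤ Real.log (⌊u⌋₊.factorial : ℝ) := by
  have hm : 1 ≤ ⌊u⌋₊ := Nat.one_le_floor_iff u |>.2 hu
  have hle : (⌊u⌋₊ : ℝ) ≤ u := Nat.floor_le (by linarith)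
  have hlt : u < ⌊u⌋₊ + 1 := Nat.lt_floor_add_one u
  have hs := Stirling.le_log_factorial_stirling (n := ⌊u⌋₊) (by omega)
  generalize ⌊u⌋₊ = m at *
  have hm' : (1 : ℝ) ≤ m := by exact_mod_cast hm
  have h1 : 0 ≤ Real.log m := Real.log_nonneg hm'
  have h2 : 0 ≤ Real.log (2 * Real.pi) := Real.log_nonneg (by linarith [Real.pi_gt_three])
  have h3 : Real.log u - Real.log m ≤ u / m - 1 := by
    rw [← Real.log_div (by linarith) (by linarith)]
    exact Real.log_le_sub_one_of_pos (by positivity)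
  have h4 : m * (Real.log u - Real.log m) ≤ u - m := by
    have := mul_le_mul_of_nonneg_left h3 (by linarith : (0 : ℝ) ≤ m)
    have e : (m : ℝ) * (u / m - 1) = u - m := by field_simp
    linarith
  have h5 : 0 ≤ Real.log u := Real.log_nonneg hu
  have h6 : (u - m) * Real.log u ≤ 1 * Real.log u :=
    mul_le_mul_of_nonneg_right (by linarith) h5
  nlinarith

theorem stir_up_nat (m : ℕ) (hm : 1 ≤ m) :
    Real.log (m.factorial : ℝ) ≤ m * Real.log m - m + Real.log m + 1 := by
  induction m, hm using Nat.le_induction with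
  | base => simp
  | succ m hm ih =>
    have hm' : (1 : ℝ) ≤ m := by exact_mod_cast hm
    rw [Nat.factorial_succ, Nat.cast_mul, Real.log_mul (by positivity) (by positivity)]
    push_cast
    have h3 : Real.log m - Real.log (m + 1) ≤ m / (m + 1) - 1 := by
      rw [← Real.log_div (by linarith) (by linarith)]
      exact Real.log_le_sub_one_of_pos (by positivity)
    have h4 : (m + 1) * (Real.log m - Real.log (m + 1)) ≤ -1 := by
      have := mul_le_mul_of_nonneg_left h3 (by linarith : (0 : ℝ) ≤ (m : ℝ) + 1)
      have e : ((m : ℝ) + 1) * (m / (m + 1) - 1) = -1 := by field_simp; ring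
      linarith
    nlinarith

theorem stir_up (u : ℝ) (hu : 1 ≤ u) :
    Real.log (⌊u⌋₊.factorial : ℝ) ≤ u * Real.log u - u + (Real.log u + 1) := by
  have hm : 1 ≤ ⌊u⌋₊ := Nat.one_le_floor_iff u |>.2 hu
  have hle : (⌊u⌋₊ : ℝ) ≤ u := Nat.floor_le (by linarith)
  have hs := stir_up_nat ⌊u⌋₊ hm
  generalize ⌊u⌋₊ = m at *
  have hm' : (1 : ℝ) ≤ m := by exact_mod_cast hm
  have h1 : 0 ≤ Real.log m := Real.log_nonneg hm'
  have h2 : Real.log m ≤ Real.log u := Real.log_le_log (by linarith) hle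
  have h3 : Real.log m - Real.log u ≤ m / u - 1 := by
    rw [← Real.log_div (by linarith) (by linarith)]
    exact Real.log_le_sub_one_of_pos (by positivity)
  have h4 : u * (Real.log m - Real.log u) ≤ m - u := by
    have := mul_le_mul_of_nonneg_left h3 (by linarith : (0 : ℝ) ≤ u)
    have e : u * (m / u - 1) = m - u := by field_simp
    linarith
  nlinarith [mul_nonneg (sub_nonneg.2 hle) h1]

theorem stir_div (Y d : ℕ) (hd : 1 ≤ d) (hY : d ≤ Y) :
    |Real.log ((Y / d).factorial : ℝ) - ((Y : ℝ) / d * (Real.log Y - Real.log d) - (Y : ℝ) / d)|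
      ≤ Real.log Y + 1 := by
  have hd' : (1 : ℝ) ≤ d := by exact_mod_cast hd
  have hY' : (d : ℝ) ≤ Y := by exact_mod_cast hY
  have hu : (1 : ℝ) ≤ (Y : ℝ) / d := by rw [le_div_iff₀ (by linarith)]; linarith
  have h1 := stir_low _ hu
  have h2 := stir_up _ hu
  rw [Nat.floor_div_eq_div, Real.log_div (by linarith) (by linarith)] at h1 h2
  have := Real.log_nonneg hd'
  rw [abs_le]; constructor <;> linarith

/-- Main-term bound for the log-factorial combination. -/
theorem Gs_approx (l : List (ℕ × ℤ)) (Y : ℕ) (hl : ∀ p ∈ l, 1 ≤ p.1 ∧ p.1 ≤ Y) :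
    |Gs l Y - ((Y : ℝ) * (Real.log Y - 1) * (l.map fun p => (p.2 : ℝ) / p.1).sum
      - Y * (l.map fun p => (p.2 : ℝ) / p.1 * Real.log p.1).sum)|
      ≤ (l.map fun p => |(p.2 : ℝ)|).sum * (Real.log Y + 1) := by
  induction l with
  | nil => simp [Gs]
  | cons p l ih =>
    have ih' := ih (fun p hp => hl p (List.mem_cons_of_mem _ hp))
    obtain ⟨h1, h2⟩ := hl p List.mem_cons_self
    have h3 := stir_div Y p.1 h1 h2
    simp only [Gs, List.map_cons, List.sum_cons] at ih' ⊢
    have h4 := mul_le_mul_of_nonneg_left h3 (abs_nonneg (p.2 : ℝ))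
    rw [← abs_mul] at h4
    refine le_trans (le_of_eq_of_le ?_ (abs_add_le _ _)) (le_of_le_of_eq (add_le_add h4 ih') ?_)
    · congr 1; ring
    · ring

/-- The Mertens-type sum of `Λ n / n`. -/
noncomputable def SL (x : ℕ) : ℝ := ∑ n ∈ Finset.Ioc 0 x, ArithmeticFunction.vonMangoldt n / n

theorem Fs_geR (m : ℕ) : 7200 * ((m : ℝ) + 1) - 72 * 7200 ≤ 72 * (Fs cs m : ℝ) := by
  have h : ((7200 * ((m : ℤ) + 1) - 72 * 7200 : ℤ) : ℝ) ≤ ((72 * Fs cs m : ℤ) : ℝ) :=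
    Int.cast_le.2 (Fs_ge m)
  generalize Fs cs m = t at *
  push_cast at h
  linarith

theorem Fs_midR (m : ℕ) (h1 : 72 ≤ m) (h2 : m < 166320) :
    7200 * ((m : ℝ) + 1) ≤ 72 * (Fs cs m : ℝ) := by
  exact_mod_cast Fs_mid m h1 h2

theorem div_aux (a k n x : ℕ) (hn : 0 < n) (ha : 0 < a) (hk : 0 < k) (h : ¬ n ≤ x / k) :
    a * x / n < a * k := by
  rw [Nat.div_lt_iff_lt_mul hn, mul_assoc]
  rw [Nat.le_div_iff_mul_le hk, not_le] at h
  rw [mul_comm k n]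
  exact Nat.mul_lt_mul_of_pos_left h ha

open ArithmeticFunction in
theorem Gs_lower (x : ℕ) :
    7200 * (x * SL x) ≤ Gs cs (72 * x) + 7200 * Chebyshev.psi ((x / 2310 : ℕ) : ℝ) := by
  rw [Gs_eq, SL, Chebyshev.psi, Nat.floor_natCast]
  have hsub : Finset.Ioc 0 x ⊆ Finset.Ioc 0 (72 * x) :=
    Finset.Ioc_subset_Ioc_right (by omega)
  have hsub2 : Finset.Ioc 0 (x / 2310) ⊆ Finset.Ioc 0 x :=
    Finset.Ioc_subset_Ioc_right (Nat.div_le_self _ _)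
  have h1 : ∑ n ∈ Finset.Ioc 0 x, vonMangoldt n * (Fs cs (72 * x / n) : ℝ)
      ≤ ∑ n ∈ Finset.Ioc 0 (72 * x), vonMangoldt n * (Fs cs (72 * x / n) : ℝ) := by
    refine Finset.sum_le_sum_of_subset_of_nonneg hsub ?_
    intro n hn hn'
    simp only [Finset.mem_Ioc, not_and, not_le] at hn hn'
    have h2 : 72 * x / n < 72 := by
      rw [Nat.div_lt_iff_lt_mul hn.1]; have := hn' hn.1; omega
    have h3 : (0 : ℝ) ≤ (Fs cs (72 * x / n) : ℝ) := by exact_mod_cast Fs_nonneg _ h2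
    exact mul_nonneg vonMangoldt_nonneg h3
  have h2 : ∑ n ∈ Finset.Ioc 0 (x / 2310), vonMangoldt n
      = ∑ n ∈ Finset.Ioc 0 x, if n ≤ x / 2310 then vonMangoldt n else 0 := by
    rw [← Finset.sum_filter]
    refine Finset.sum_congr ?_ fun _ _ => rfl
    ext n
    simp only [Finset.mem_Ioc, Finset.mem_filter]
    constructor
    · rintro ⟨a, b⟩; exact ⟨⟨a, b.trans (Nat.div_le_self _ _)⟩, b⟩
    · rintro ⟨⟨a, _⟩, b⟩; exact ⟨a, b⟩
  rw [h2]
  refine le_trans ?_ (add_le_add_left h1 _)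
  rw [Finset.mul_sum, Finset.mul_sum, Finset.mul_sum, ← Finset.sum_add_distrib]
  refine Finset.sum_le_sum fun n hn => ?_
  simp only [Finset.mem_Ioc] at hn
  have hn0 : (0 : ℝ) < n := by exact_mod_cast hn.1
  set m := 72 * x / n with hm
  have hlt : (72 * x : ℝ) / n < m + 1 := by
    have := Nat.lt_floor_add_one ((72 * x : ℝ) / n)
    have e : ⌊(72 * x : ℝ) / n⌋₊ = m := by
      rw [hm, ← Nat.floor_div_eq_div (K := ℝ)]; push_cast; rfl
    rwa [e] at this
  have hL : 0 ≤ vonMangoldt n := vonMangoldt_nonneg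
  have e1 : 7200 * (x * (vonMangoldt n / n)) = vonMangoldt n * (100 * ((72 * x : ℝ) / n)) := by
    field_simp; ring
  rw [e1]
  have h72 : 72 ≤ m := by
    rw [hm, Nat.le_div_iff_mul_le hn.1]; omega
  split_ifs with hc
  · have h5 : 7200 * ((m : ℝ) + 1) - 72 * 7200 ≤ 72 * (Fs cs m : ℝ) := by
      exact Fs_geR m
    have : 100 * ((72 * x : ℝ) / n) ≤ Fs cs m + 7200 := by linarith
    nlinarith
  · have hN : m < 166320 := by
      exact div_aux 72 2310 n x hn.1 (by norm_num) (by norm_num) hc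
    have h5 : 7200 * ((m : ℝ) + 1) ≤ 72 * (Fs cs m : ℝ) := Fs_midR m h72 hN
    have : 100 * ((72 * x : ℝ) / n) ≤ Fs cs m := by linarith
    nlinarith

/-- Truncated multiplicity of `q` in `d`. -/
def ex (q d : ℕ) : ℕ :=
  (if d % q = 0 then 1 else 0) + (if d % q ^ 2 = 0 then 1 else 0)
    + (if d % q ^ 3 = 0 then 1 else 0) + (if d % q ^ 4 = 0 then 1 else 0)

def Cq (q : ℕ) (l : List (ℕ × ℤ)) : ℤ :=
  (l.map fun p => p.2 * (ex q p.1 : ℤ) * ((166320 / p.1 : ℕ) : ℤ)).sum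

theorem cs_fac : ∀ p ∈ cs, p.1 = 2 ^ ex 2 p.1 * 3 ^ ex 3 p.1 * 5 ^ ex 5 p.1 * 7 ^ ex 7 p.1
    * 11 ^ ex 11 p.1 := by decide +kernel

theorem Cq2 : Cq 2 cs = 27563196 := by decide +kernel
theorem Cq3 : Cq 3 cs = 19282623 := by decide +kernel
theorem Cq5 : Cq 5 cs = 3603360 := by decide +kernel
theorem Cq7 : Cq 7 cs = 4651451 := by decide +kernel
theorem Cq11 : Cq 11 cs = 3010073 := by decide +kernel

def Ca (l : List (ℕ × ℤ)) : ℕ := (l.map fun p => p.2.natAbs).sum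
theorem Ca_cs : Ca cs = 337579 := by decide +kernel

def Cz (l : List (ℕ × ℤ)) : ℤ := (l.map fun p => p.2 * ((166320 / p.1 : ℕ) : ℤ)).sum
theorem Cz_cs : Cz cs = 16632000 := by decide +kernel

theorem Ca_cast (l : List (ℕ × ℤ)) : (l.map fun p => |(p.2 : ℝ)|).sum = Ca l := by
  induction l with
  | nil => simp [Ca]
  | cons p l ih =>
    simp only [Ca, List.map_cons, List.sum_cons] at ih ⊢
    rw [ih, Nat.cast_add, Nat.cast_natAbs, Int.cast_abs]

theorem div_cast (d : ℕ) (h : d ∣ 166320) (h0 : 0 < d) :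
    ((166320 / d : ℕ) : ℝ) = 166320 / d := by
  rw [Nat.cast_div h (by positivity)]; norm_num

theorem Cz_cast (l : List (ℕ × ℤ)) (hl : ∀ p ∈ l, p.1 ∣ 166320 ∧ 0 < p.1) :
    166320 * (l.map fun p => (p.2 : ℝ) / p.1).sum = Cz l := by
  induction l with
  | nil => simp [Cz]
  | cons p l ih =>
    have ih' := ih (fun p hp => hl p (List.mem_cons_of_mem _ hp))
    obtain ⟨h1, h2⟩ := hl p List.mem_cons_self
    simp only [Cz, List.map_cons, List.sum_cons] at ih' ⊢
    rw [mul_add, ih', Int.cast_add, Int.cast_mul, Int.cast_natCast, div_cast _ h1 h2]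
    ring

theorem Cq_cast (l : List (ℕ × ℤ)) (hl : ∀ p ∈ l, p.1 ∣ 166320 ∧ 0 < p.1)
    (hf : ∀ p ∈ l, p.1 = 2 ^ ex 2 p.1 * 3 ^ ex 3 p.1 * 5 ^ ex 5 p.1 * 7 ^ ex 7 p.1
      * 11 ^ ex 11 p.1) :
    166320 * (l.map fun p => (p.2 : ℝ) / p.1 * Real.log p.1).sum
      = Cq 2 l * Real.log 2 + Cq 3 l * Real.log 3 + Cq 5 l * Real.log 5 + Cq 7 l * Real.log 7
        + Cq 11 l * Real.log 11 := by
  induction l with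
  | nil => simp [Cq]
  | cons p l ih =>
    have ih' := ih (fun p hp => hl p (List.mem_cons_of_mem _ hp))
      (fun p hp => hf p (List.mem_cons_of_mem _ hp))
    obtain ⟨h1, h2⟩ := hl p List.mem_cons_self
    have h3 := hf p List.mem_cons_self
    have h4 : Real.log (p.1 : ℝ) = ex 2 p.1 * Real.log 2 + ex 3 p.1 * Real.log 3
        + ex 5 p.1 * Real.log 5 + ex 7 p.1 * Real.log 7 + ex 11 p.1 * Real.log 11 := by
      have : (p.1 : ℝ) = 2 ^ ex 2 p.1 * 3 ^ ex 3 p.1 * 5 ^ ex 5 p.1 * 7 ^ ex 7 p.1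
          * 11 ^ ex 11 p.1 := by exact_mod_cast h3
      conv_lhs => rw [this]
      rw [Real.log_mul (by positivity) (by positivity), Real.log_mul (by positivity) (by positivity),
        Real.log_mul (by positivity) (by positivity), Real.log_mul (by positivity) (by positivity),
        Real.log_pow, Real.log_pow, Real.log_pow, Real.log_pow, Real.log_pow]
    simp only [Cq, List.map_cons, List.sum_cons] at ih' ⊢
    rw [mul_add, ih']
    simp only [Int.cast_add, Int.cast_mul, Int.cast_natCast]
    rw [div_cast _ h1 h2, h4]
    ring

theorem log7_lb : 1.9458 ≤ Real.log 7 := by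
  have h : Real.log (2 ^ 5 * 3 * 5 ^ 2) ≤ Real.log (7 ^ 4) := Real.log_le_log (by norm_num) (by norm_num)
  rw [Real.log_mul (by norm_num) (by norm_num), Real.log_mul (by norm_num) (by norm_num),
    Real.log_pow, Real.log_pow, Real.log_pow] at h
  have := Real.log_two_gt_d9
  have := Real.log_three_gt_d9
  have := Real.log_five_gt_d9
  push_cast at h
  linarith

theorem log11_lb : 2.3968 ≤ Real.log 11 := by
  have h : Real.log (2 ^ 2 * 3 ^ 6 * 5) ≤ Real.log (11 ^ 4) :=
    Real.log_le_log (by norm_num) (by norm_num)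
  rw [Real.log_mul (by norm_num) (by norm_num), Real.log_mul (by norm_num) (by norm_num),
    Real.log_pow, Real.log_pow, Real.log_pow] at h
  have := Real.log_two_gt_d9
  have := Real.log_three_gt_d9
  have := Real.log_five_gt_d9
  push_cast at h
  linarith

/-- Decay of `log x / x`. -/
theorem log_div_small (x : ℝ) (hx : 524288 ≤ x) : Real.log x ≤ x * (19 * Real.log 2 / 524288) := by
  have h := Real.log_div_self_antitoneOn (a := 524288) (b := x)
    (by change Real.exp 1 ≤ _; linarith [Real.exp_one_lt_d9])
    (by change Real.exp 1 ≤ _; linarith [Real.exp_one_lt_d9]) hx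
  have e : Real.log 524288 = 19 * Real.log 2 := by
    rw [show (524288 : ℝ) = 2 ^ 19 by norm_num, Real.log_pow]; norm_num
  simp only [e] at h
  rw [div_le_iff₀ (by linarith)] at h
  linarith

theorem SL_upper (x : ℕ) (hx : 524288 ≤ x) : SL x ≤ Real.log x - 0.467 := by
  have hx' : (524288 : ℝ) ≤ x := by exact_mod_cast hx
  have h1 := Gs_lower x
  have h2 := (abs_le.1 (Gs_approx cs (72 * x) (fun p hp => by
    obtain ⟨a, b⟩ := cs_dvd p hp
    have := Nat.le_of_dvd (by norm_num) a
    constructor <;> omega))).2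
  rw [Ca_cast, Ca_cs] at h2
  have hz := Cz_cast cs cs_dvd
  rw [Cz_cs] at hz
  have hz' : (cs.map fun p => (p.2 : ℝ) / p.1).sum = 100 := by push_cast at hz; linarith
  have hw := Cq_cast cs cs_dvd cs_fac
  rw [Cq2, Cq3, Cq5, Cq7, Cq11] at hw
  push_cast at hw
  have hpsi := Chebyshev.psi_le_const_mul_self (x := ((x / 2310 : ℕ) : ℝ)) (by positivity)
  have hfl : ((x / 2310 : ℕ) : ℝ) ≤ x / 2310 := by
    have := Nat.cast_div_le (α := ℝ) (m := x) (n := 2310)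
    exact_mod_cast this
  have l4 : Real.log 4 = 2 * Real.log 2 := by
    rw [show (4 : ℝ) = 2 ^ 2 by norm_num, Real.log_pow]; norm_num
  have a1 := Real.log_two_gt_d9
  have a1' := Real.log_two_lt_d9
  have a2 := Real.log_three_gt_d9
  have a2' := Real.log_three_lt_d9
  have a3 := Real.log_five_gt_d9
  have a4 := log7_lb
  have a5 := log11_lb
  have l72 : Real.log (72 * (x : ℝ)) = 3 * Real.log 2 + 2 * Real.log 3 + Real.log x := by
    rw [Real.log_mul (by norm_num) (by linarith), show (72 : ℝ) = 2 ^ 3 * 3 ^ 2 by norm_num,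
      Real.log_mul (by norm_num) (by norm_num), Real.log_pow, Real.log_pow]; norm_num
  have hd := log_div_small x hx'
  rw [hz'] at h2
  push_cast at h2
  rw [l72] at h2
  set W := (cs.map fun p => (p.2 : ℝ) / p.1 * Real.log p.1).sum with hW
  have hWl : 374.9 ≤ W := by linarith
  have hpsi2 : Chebyshev.psi ((x / 2310 : ℕ) : ℝ) ≤ 5.3863 * (x / 2310) := by
    refine hpsi.trans ?_
    rw [l4]
    exact mul_le_mul (by linarith) hfl (by positivity) (by norm_num)
  have hd' : Real.log x ≤ x * 0.0000252 := by
    refine hd.trans (mul_le_mul_of_nonneg_left (by linarith) (by linarith))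
  have hX : (x : ℝ) * 374.9 ≤ x * W := mul_le_mul_of_nonneg_left hWl (by linarith)
  have hA : (x : ℝ) * (3 * Real.log 2 + 2 * Real.log 3) ≤ x * 4.27668 :=
    mul_le_mul_of_nonneg_left (by linarith) (by linarith)
  have key : (x : ℝ) * SL x ≤ x * (Real.log x - 0.467) := by
    linarith
  exact le_of_mul_le_mul_left key (by linarith)

def cb : List (ℕ × ℤ) := [(1, 1), (2, -1), (3, -1), (5, -1), (30, 1)]

theorem cb_dvd : ∀ p ∈ cb, p.1 ∣ 30 ∧ 0 < p.1 := by decide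
theorem Fs_cb30 : ∀ m < 30, Fs cb m ≤ 1 := by decide
theorem Fs_cb_N : Fs cb 30 = 0 := by decide

theorem Fs_cb (m : ℕ) : Fs cb m ≤ 1 := by
  have h := Fs_period cb 30 cb_dvd (m % 30) (m / 30)
  rw [Nat.div_add_mod, Fs_cb_N] at h
  rw [h, mul_zero, zero_add]
  exact Fs_cb30 _ (Nat.mod_lt _ (by norm_num))

open ArithmeticFunction in
theorem Gs_cb_le (x : ℕ) : Gs cb x ≤ Chebyshev.psi x := by
  rw [Gs_eq, Chebyshev.psi, Nat.floor_natCast]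
  refine Finset.sum_le_sum fun n _ => ?_
  have h : ((Fs cb (x / n) : ℤ) : ℝ) ≤ 1 := by exact_mod_cast Fs_cb (x / n)
  have hL : 0 ≤ vonMangoldt n := vonMangoldt_nonneg
  nlinarith

theorem psi_lower (x : ℕ) (hx : 524288 ≤ x) : 0.921 * (x : ℝ) ≤ Chebyshev.psi x := by
  have hx' : (524288 : ℝ) ≤ x := by exact_mod_cast hx
  have h2 := (abs_le.1 (Gs_approx cb x (fun p hp => by
    obtain ⟨a, b⟩ := cb_dvd p hp
    have := Nat.le_of_dvd (by norm_num) a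
    constructor <;> omega))).1
  have h3 := Gs_cb_le x
  generalize Gs cb x = G at *
  simp only [cb, List.map_cons, List.map_nil, List.sum_cons, List.sum_nil] at h2
  push_cast at h2
  norm_num at h2
  have l30 : Real.log 30 = Real.log 2 + Real.log 3 + Real.log 5 := by
    rw [show (30 : ℝ) = 2 * 3 * 5 by norm_num, Real.log_mul (by norm_num) (by norm_num),
      Real.log_mul (by norm_num) (by norm_num)]
  rw [l30] at h2
  have a1 := Real.log_two_gt_d9
  have a1' := Real.log_two_lt_d9
  have a2 := Real.log_three_gt_d9
  have a3 := Real.log_five_gt_d9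
  have hd := log_div_small x hx'
  have hd' : Real.log x ≤ x * 0.0000252 := by
    refine hd.trans (mul_le_mul_of_nonneg_left (by linarith) (by linarith))
  have hA : (x : ℝ) * 0.9212 ≤ x * (Real.log 2 * (14 / 30) + Real.log 3 * (9 / 30) + Real.log 5 * (5 / 30)) :=
    mul_le_mul_of_nonneg_left (by linarith) (by linarith)
  linarith

theorem theta_lower (x : ℕ) (hx : 524288 ≤ x) : 0.91 * (x : ℝ) ≤ Chebyshev.theta x := by
  have hx' : (524288 : ℝ) ≤ x := by exact_mod_cast hx
  have hx0 : (0 : ℝ) < x := by linarith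
  have h1 := psi_lower x hx
  have h2 := Chebyshev.psi_sub_theta_le_psi_add_psi_add_psi (x : ℝ)
  have l4 : Real.log 4 = 2 * Real.log 2 := by
    rw [show (4 : ℝ) = 2 ^ 2 by norm_num, Real.log_pow]; norm_num
  have a1' := Real.log_two_lt_d9
  have key : ∀ (k : ℕ) (c : ℝ), 1 ≤ k → 0 < c → (1 / c) ^ k ≤ (524288 : ℝ) ^ (k - 1) →
      Chebyshev.psi ((x : ℝ) ^ ((1 : ℝ) / k)) ≤ 5.3863 * (c * x) := by
    intro k c hk hc hck
    have h3 := Chebyshev.psi_le_const_mul_self (x := (x : ℝ) ^ ((1 : ℝ) / k)) (by positivity)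
    have h4 : (x : ℝ) ^ ((1 : ℝ) / k) ≤ c * x := by
      rw [one_div, Real.rpow_inv_le_iff_of_pos (by positivity) (by positivity)
        (by exact_mod_cast hk), Real.rpow_natCast, mul_pow]
      have h5 : (1 / c) ^ k ≤ (x : ℝ) ^ (k - 1) :=
        hck.trans (pow_le_pow_left₀ (by norm_num) hx' _)
      rw [one_div, inv_pow, inv_le_iff_one_le_mul₀ (by positivity)] at h5
      have h6 : (x : ℝ) ^ k = x ^ (k - 1) * x := by
        rw [← pow_succ, Nat.sub_add_cancel hk]
      rw [h6]
      nlinarith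
    refine h3.trans ?_
    rw [l4]
    exact mul_le_mul (by linarith) h4 (by positivity) (by norm_num)
  have k2 := key 2 (1 / 724) (by norm_num) (by norm_num) (by norm_num)
  have k3 := key 3 (1 / 6000) (by norm_num) (by norm_num) (by norm_num)
  have k5 := key 5 (1 / 30000) (by norm_num) (by norm_num) (by norm_num)
  push_cast at k2 k3 k5
  rw [one_div] at k2 k3 k5
  linarith

/-- The Mertens product. -/
noncomputable def PP (x : ℕ) : ℝ :=
  ∏ p ∈ (Finset.Ioc 0 x).filter Nat.Prime, (p : ℝ) / ((p : ℝ) - 1)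

theorem PP_pos (x : ℕ) : 0 < PP x := by
  refine Finset.prod_pos fun p hp => ?_
  have : (2 : ℝ) ≤ p := by exact_mod_cast (Finset.mem_filter.1 hp).2.two_le
  exact div_pos (by linarith) (by linarith)

theorem PP_succ (x : ℕ) : PP (x + 1) = PP x *
    (if (x + 1).Prime then ((x + 1 : ℕ) : ℝ) / (((x + 1 : ℕ) : ℝ) - 1) else 1) := by
  unfold PP
  rw [← Finset.insert_Ioc_right_eq_Ioc_add_one (Nat.zero_le x), Finset.filter_insert]
  split_ifs with h
  · rw [Finset.prod_insert (by simp), mul_comm]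
  · rw [mul_one]

theorem SL_succ (x : ℕ) : SL (x + 1) = SL x
    + ArithmeticFunction.vonMangoldt (x + 1) / ((x + 1 : ℕ) : ℝ) := by
  unfold SL
  rw [Finset.sum_Ioc_succ_top (Nat.zero_le x)]

theorem PP_step (x : ℕ) (hx : 2 ≤ x) : Real.log (PP (x + 1)) ≤ Real.log (PP x)
    + (SL (x + 1) - SL x) / Real.log (x + 1 : ℕ) + (1 / (x : ℝ) - 1 / ((x + 1 : ℕ) : ℝ)) := by
  have hx' : (2 : ℝ) ≤ x := by exact_mod_cast hx
  rw [PP_succ, SL_succ, add_sub_cancel_left]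
  have hlog : 0 < Real.log (x + 1 : ℕ) := Real.log_pos (by push_cast; linarith)
  have h0 : 1 / ((x + 1 : ℕ) : ℝ) ≤ 1 / (x : ℝ) := by
    apply one_div_le_one_div_of_le (by linarith); push_cast; linarith
  split_ifs with h
  · rw [Real.log_mul (PP_pos x).ne' (by push_cast; rw [add_sub_cancel_right]; positivity),
      ArithmeticFunction.vonMangoldt_apply_prime h, div_right_comm, div_self hlog.ne']
    have h1 := Real.log_le_sub_one_of_pos (x := ((x + 1 : ℕ) : ℝ) / (((x + 1 : ℕ) : ℝ) - 1))
      (by push_cast; rw [add_sub_cancel_right]; positivity)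
    have h2 : ((x + 1 : ℕ) : ℝ) / (((x + 1 : ℕ) : ℝ) - 1) - 1 = 1 / x := by
      push_cast; rw [add_sub_cancel_right]; field_simp; ring
    linarith
  · rw [mul_one]
    have : 0 ≤ ArithmeticFunction.vonMangoldt (x + 1) / ((x + 1 : ℕ) : ℝ)
        / Real.log (x + 1 : ℕ) :=
      div_nonneg (div_nonneg ArithmeticFunction.vonMangoldt_nonneg (by positivity)) hlog.le
    linarith

theorem PP_abel (X : ℕ) (hX : 2 ≤ X) (a : ℝ) (ha : ∀ x, X ≤ x → SL x ≤ Real.log x - a)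
    (x : ℕ) (hx : X ≤ x) :
    Real.log (PP x) ≤ Real.log (PP X) + (1 / (X : ℝ) - 1 / (x : ℝ))
      + (SL x / Real.log x - SL X / Real.log X)
      + (Real.log (Real.log x) - Real.log (Real.log X))
      - a * (1 / Real.log X - 1 / Real.log x) := by
  induction x, hx using Nat.le_induction with
  | base => simp
  | succ x hx ih =>
    have hx2 : 2 ≤ x := hX.trans hx
    have h1 := PP_step x hx2
    have h2 := ha x hx
    have hx' : (2 : ℝ) ≤ x := by exact_mod_cast hx2
    have hl : 0 < Real.log x := Real.log_pos (by linarith)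
    have hl' : Real.log x ≤ Real.log (x + 1 : ℕ) :=
      Real.log_le_log (by linarith) (by push_cast; linarith)
    generalize Real.log (x : ℝ) = l at *
    generalize Real.log ((x + 1 : ℕ) : ℝ) = l' at *
    have hl'0 : 0 < l' := by linarith
    have h3 : Real.log l - Real.log l' ≤ l / l' - 1 := by
      rw [← Real.log_div (by linarith) (by linarith)]
      exact Real.log_le_sub_one_of_pos (by positivity)
    have h4 : 0 ≤ 1 / l - 1 / l' := by
      rw [sub_nonneg]; exact one_div_le_one_div_of_le hl hl'
    have h5 : (SL x + a) * (1 / l - 1 / l') ≤ l * (1 / l - 1 / l') :=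
      mul_le_mul_of_nonneg_right (by linarith) h4
    have h6 : l * (1 / l - 1 / l') = 1 - l / l' := by field_simp
    have h7 : (SL (x + 1) - SL x) / l' = SL (x + 1) / l' - SL x * (1 / l') := by ring
    have h8 : SL x / l = SL x * (1 / l) := by ring
    rw [h7] at h1
    rw [h8] at ih
    linarith

theorem f_mono (a b : ℝ) (ha : 1.2 ≤ a) (hab : a ≤ b) :
    9 / 5 * a + 2.51 / a ≤ 9 / 5 * b + 2.51 / b := by
  have h : 9 / 5 * b + 2.51 / b - (9 / 5 * a + 2.51 / a) = (b - a) * (9 / 5 - 2.51 / (a * b)) := by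
    have : a ≠ 0 := by linarith
    have : b ≠ 0 := by linarith
    field_simp; ring
  have h2 : 2.51 / (a * b) ≤ 9 / 5 := by
    rw [div_le_iff₀ (by nlinarith)]; nlinarith
  have := mul_nonneg (sub_nonneg.2 hab) (sub_nonneg.2 h2)
  linarith

theorem main_large (hS : 19 * Real.log 2 - 0.5785 ≤ SL 524288)
    (hP : PP 524288 ≤ 1.7814 * (19 * Real.log 2)) (x : ℕ) (hx : 524288 ≤ x) :
    PP x ≤ 9 / 5 * Real.log (Chebyshev.theta x) + 2.51 / Real.log (Chebyshev.theta x) := by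
  have hx' : (524288 : ℝ) ≤ x := by exact_mod_cast hx
  have e : Real.log ((524288 : ℕ) : ℝ) = 19 * Real.log 2 := by
    rw [show ((524288 : ℕ) : ℝ) = 2 ^ 19 by norm_num, Real.log_pow]; norm_num
  have h1 := PP_abel 524288 (by norm_num) 0.467 SL_upper x hx
  have h2 := SL_upper x hx
  have a1 := Real.log_two_gt_d9
  have a1' := Real.log_two_lt_d9
  have hL : 19 * Real.log 2 ≤ Real.log x := by
    rw [← e]; exact Real.log_le_log (by norm_num) (by exact_mod_cast hx)
  rw [e] at h1
  set L := Real.log (x : ℝ) with hLdef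
  set L0 := 19 * Real.log 2 with hL0
  have hL0b : 13.169 < L0 := by linarith
  have hx1 : 0 ≤ (x : ℝ)⁻¹ := by positivity
  have h3 : SL x / L ≤ 1 - 0.467 * (1 / L) := by
    rw [div_le_iff₀ (by linarith)]
    have : (1 - 0.467 * (1 / L)) * L = L - 0.467 := by
      have : L ≠ 0 := by linarith
      field_simp
    linarith
  have h4 : 1 - 0.5785 * (1 / L0) ≤ SL 524288 / L0 := by
    rw [le_div_iff₀ (by linarith)]
    have : (1 - 0.5785 * (1 / L0)) * L0 = L0 - 0.5785 := by
      have : L0 ≠ 0 := by linarith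
      field_simp
    linarith
  have h5 : 1 / L0 ≤ 1 / 13.169 := one_div_le_one_div_of_le (by norm_num) hL0b.le
  have h6 : Real.log (PP x) ≤ Real.log (PP 524288) + (Real.log L - Real.log L0) + 0.0085 := by
    push_cast at h1
    norm_num at h1 h3 h4 h5 ⊢
    linarith
  have h7 : PP x ≤ PP 524288 * (L / L0) * Real.exp 0.0085 := by
    have hpos : 0 < PP 524288 * (L / L0) * Real.exp 0.0085 :=
      mul_pos (mul_pos (PP_pos _) (div_pos (by linarith) (by linarith))) (Real.exp_pos _)
    rw [← Real.log_le_log_iff (PP_pos x) hpos, Real.log_mul (mul_pos (PP_pos _)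
      (div_pos (by linarith) (by linarith))).ne' (Real.exp_pos _).ne', Real.log_exp,
      Real.log_mul (PP_pos _).ne' (div_pos (by linarith) (by linarith)).ne',
      Real.log_div (by linarith) (by linarith)]
    exact h6
  have h8 : Real.exp 0.0085 ≤ 1.0086 := by
    have h9 := Real.one_sub_le_exp_neg 0.0085
    rw [Real.exp_neg] at h9
    have h10 := Real.exp_pos 0.0085
    rw [← one_div, le_div_iff₀ h10] at h9
    linarith
  have h9 : PP x ≤ 1.797 * L := by
    have hq : PP 524288 * (L / L0) ≤ 1.7814 * L := by
      rw [mul_div_assoc', div_le_iff₀ (by linarith)]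
      nlinarith
    have := mul_le_mul hq h8 (Real.exp_pos _).le (by linarith)
    linarith
  have hth := theta_lower x hx
  have h10 : L - 0.0955 ≤ Real.log (Chebyshev.theta x) := by
    have : Real.log (0.91 * x) ≤ Real.log (Chebyshev.theta x) :=
      Real.log_le_log (by linarith) hth
    rw [Real.log_mul (by norm_num) (by linarith)] at this
    have h11 : -0.0955 ≤ Real.log 0.91 := by
      rw [Real.le_log_iff_exp_le (by norm_num), Real.exp_neg]
      have := Real.quadratic_le_exp_of_nonneg (x := 0.0955) (by norm_num)
      rw [inv_le_comm₀ (Real.exp_pos _) (by norm_num)]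
      norm_num at this ⊢
      linarith
    linarith
  have h12 := f_mono _ _ (by linarith) h10
  refine le_trans (h9.trans ?_) h12
  have h13 : 2.51 / L ≤ 2.51 / (L - 0.0955) :=
    div_le_div_of_nonneg_left (by norm_num) (by linarith) (by linarith)
  have h14 : 0.1719 - 0.003 * L ≤ 2.51 / L := by
    rw [le_div_iff₀ (by linarith)]
    nlinarith [sq_nonneg (L - 28.65)]
  linarith

/-- The product of the primes up to `724`. -/
def Qb : ℕ := 9924106145725786023631372170109887991715323868829308786539119122200536936867758105993993158248693643601604928609447280859006275202556580844819910546254193525787110200140425852184294378209762748922036200375381502397619094168173925680272852113977043974462787326018446956329904251794928088824298784530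

noncomputable def Qf (n : ℕ) : ℕ :=
  cond (Nat.ble n 48) 30 (cond (Nat.ble n 724) 223092870 Qb)

noncomputable def isP (n : ℕ) : Bool := Nat.beq (Nat.gcd n (Qf n)) 1

/-- Updated lower bound for the scaled logarithm of `n`, from the one for `m`. -/
noncomputable def newL (A n L m : ℕ) : ℕ :=
  Nat.add (Nat.add L (Nat.div (Nat.mul A (Nat.sub n m)) (Nat.add n m)))
    (Nat.div (Nat.mul A (Nat.pow (Nat.sub n m) 3)) (Nat.mul 3 (Nat.pow (Nat.add n m) 3)))

noncomputable def newV (A n V L : ℕ) : ℕ :=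
  Nat.add (Nat.add V (Nat.div (Nat.mul L A) n))
    (cond (Nat.ble n 724) (Nat.add (Nat.div (Nat.mul L A) (Nat.pow n 2))
      (cond (Nat.ble n 80) (Nat.div (Nat.mul L A) (Nat.pow n 3)) 0)) 0)

noncomputable def guard4 (M a b c d r : ℕ) : ℕ :=
  cond (Nat.ble (Nat.add a 1) M) (cond (Nat.ble (Nat.add b 1) M) (cond (Nat.ble (Nat.add c 1) M)
    (cond (Nat.ble (Nat.add d 1) M) r 0) 0) 0) 0

noncomputable def enc (M a b c d e : ℕ) : ℕ :=
  Nat.add a (Nat.mul M (Nat.add b (Nat.mul M (Nat.add c (Nat.mul M (Nat.add d (Nat.mul M e)))))))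

noncomputable def pack (M a b c d e : ℕ) : ℕ := guard4 M a b c d (Nat.add (enc M a b c d e) 1)

noncomputable def dU (M s : ℕ) : ℕ := Nat.mod s M
noncomputable def dT (M s : ℕ) : ℕ := Nat.mod (Nat.div s M) M
noncomputable def dV (M s : ℕ) : ℕ := Nat.mod (Nat.div (Nat.div s M) M) M
noncomputable def dL (M s : ℕ) : ℕ := Nat.mod (Nat.div (Nat.div (Nat.div s M) M) M) M
noncomputable def dP (M s : ℕ) : ℕ := Nat.div (Nat.div (Nat.div (Nat.div s M) M) M) M

noncomputable def upd (M A B e s : ℕ) : ℕ :=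
  Nat.rec (motive := fun _ => ℕ) 0
    (fun L _ => pack M (Nat.add (Nat.add (dU M s) (Nat.div (dU M s) e)) 1) (Nat.add (dT M s) L)
      (newV B (Nat.add e 1) (dV M s) L) L (Nat.add e 1))
    (Nat.add (newL A (Nat.add e 1) (dL M s) (dP M s)) 1)

/-- One step of the sieve machine: process the odd number `2 * m + 1`. -/
noncomputable def stepM (M A B m s : ℕ) : ℕ :=
  Nat.rec (motive := fun _ => ℕ) 0
    (fun e _ => cond (isP (Nat.add e 1)) (upd M A B e s) (Nat.add s 1))
    (Nat.add (Nat.mul 2 m) 1)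

noncomputable def chk (M K R s s1 a : ℕ) : Bool :=
  cond (Nat.ble (Nat.mul (Nat.mul 6400 a) (dU M s1))
      (Nat.mul K (Nat.add (Nat.mul 180 (Nat.mul a a)) 1028096)))
    (cond (Nat.ble 77 a)
      (Nat.ble (Nat.mul (Nat.pow 27182818286 a) (Nat.pow R 64))
        (Nat.mul (Nat.pow (dT M s) 64) (Nat.pow 10000000000 a)))
      false) false

noncomputable def cnt (c : ℕ) : ℕ := Nat.rec (motive := fun _ => ℕ) 0 (fun k _ => Nat.pow 2 k) c

noncomputable def runC (f : ℕ → ℕ → ℕ) (c m s : ℕ) : ℕ :=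
  Nat.rec (motive := fun _ => ℕ) (Nat.add s 1) (fun k _ => runT f k m s) c

/-- Run the machine over a list of segments, checking the inequality on each segment. -/
noncomputable def runL (M A B K R : ℕ) (l : List (ℕ × ℕ)) : ℕ → ℕ → ℕ :=
  List.rec (motive := fun _ => ℕ → ℕ → ℕ) (fun _ s => Nat.add s 1)
    (fun p _ ih m s => Nat.rec (motive := fun _ => ℕ) 0
      (fun s1 _ => cond (chk M K R s s1 p.2)
        (Nat.rec (motive := fun _ => ℕ) 0 (fun s2 _ => ih (Nat.add (Nat.add m (cnt p.1)) 1) s2)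
          (stepM M A B (Nat.add m (cnt p.1)) s1)) 0)
      (runC (stepM M A B) p.1 m s)) l

def segs : List (ℕ × ℕ) := [
  (1, 107), (0, 131), (1, 149), (0, 164), (1, 177), (2, 189), (0, 199), (2, 208), (1, 216),
  (0, 224), (1, 231), (2, 237), (2, 243), (2, 249), (2, 254), (2, 263), (3, 268), (3, 276),
  (3, 283), (4, 293), (3, 299), (3, 304), (4, 309), (4, 319), (5, 327), (5, 337), (5, 347),
  (6, 358), (6, 369), (6, 380), (6, 391), (6, 399), (7, 407), (7, 420), (7, 430), (7, 439),
  (8, 448), (8, 460), (8, 472), (8, 481), (9, 490), (9, 503), (9, 514), (9, 524), (10, 533),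
  (10, 546), (10, 558), (10, 568), (10, 576), (11, 584), (11, 597), (11, 607), (11, 617),
  (12, 624), (12, 638), (12, 649), (12, 658), (13, 667), (13, 681), (13, 692), (13, 702),
  (14, 710), (14, 724), (14, 736), (14, 746), (15, 754), (15, 768), (15, 780), (15, 790),
  (16, 798), (16, 812), (16, 824), (15, 834), (14, 838), (13, 840), (12, 841), (11, 842),
  (9, 842), (8, 842), (5, 842), (4, 842), (3, 842)]

noncomputable def finChk (M c1 c2 r : ℕ) : Bool :=
  Nat.rec (motive := fun _ => Bool) false
    (fun s _ => cond (Nat.ble (dU M s) c1) (Nat.ble c2 (dV M s)) false) r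

noncomputable def sInit (M : ℕ) : ℕ := enc M 80704505322479288320 22965178882 554253668451313 8357147363 7

noncomputable def lenL (l : List (ℕ × ℕ)) : ℕ := (l.map fun p => cnt p.1 + 1).sum

theorem segs_len : lenL segs = 262141 := by decide +kernel

theorem run_main : finChk 79228162514264337593543950336 432760000000000000000 3544300000000000
    (runL 79228162514264337593543950336 8589934592 65536 18446744073709551616 4294967296
      segs 4 (sInit 79228162514264337593543950336)) = true := by decide +kernel

theorem gcd_prime (b Q : ℕ) (hQ : ∀ m, 2 ≤ m → m < b + 1 → Nat.gcd m Q ≠ 1)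
    (hd : Q ∣ Nat.factorial b) (n : ℕ) (h1 : b < n) (h2 : n < (b + 1) ^ 2) (h0 : 2 ≤ n) :
    Nat.gcd n Q = 1 ↔ n.Prime := by
  constructor
  · intro h
    by_contra hp
    have h3 := Nat.minFac_sq_le_self (by omega) hp
    have h4 : n.minFac < b + 1 := by
      by_contra hc
      have := Nat.pow_le_pow_left (not_lt.1 hc) 2
      omega
    have h5 := (Nat.minFac_prime (n := n) (by omega)).two_le
    apply hQ _ h5 h4
    exact Nat.Coprime.coprime_dvd_left (Nat.minFac_dvd n) h
  · intro hp
    rw [← Nat.Coprime]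
    exact Nat.Coprime.coprime_dvd_right hd ((Nat.coprime_factorial_iff hp.ne_one).2
      (by rw [hp.minFac_eq]; exact h1))

theorem Qs1 : ∀ m < 7, 2 ≤ m → Nat.gcd m 30 ≠ 1 := by decide +kernel
theorem Qs2 : ∀ m < 27, 2 ≤ m → Nat.gcd m 223092870 ≠ 1 := by decide +kernel

theorem Qs3a : allT (fun m => ! Nat.beq (Nat.gcd m Qb) 1) 9 2 = true := by decide +kernel
theorem Qs3b : allT (fun m => ! Nat.beq (Nat.gcd m Qb) 1) 9 213 = true := by decide +kernel

theorem Qd1 : 30 ∣ Nat.factorial 6 := by decide +kernel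
theorem Qd2 : 223092870 ∣ Nat.factorial 26 := by decide +kernel
theorem Qd3 : Qb ∣ Nat.factorial 724 := by decide +kernel

theorem Qs3 (m : ℕ) (h1 : 2 ≤ m) (h2 : m < 725) : Nat.gcd m Qb ≠ 1 := by
  have : (! Nat.beq (Nat.gcd m Qb) 1) = true := by
    by_cases h : m < 514
    · exact allT_spec _ _ _ Qs3a m h1 h
    · exact allT_spec _ _ _ Qs3b m (by omega) h2
  intro h
  rw [h] at this
  exact absurd this (by decide)

theorem isP_spec (n : ℕ) (h1 : 7 ≤ n) (h2 : n < 525625) : isP n = true ↔ n.Prime := by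
  have h0 : isP n = true ↔ Nat.gcd n (Qf n) = 1 := by
    unfold isP
    rw [Nat.beq_eq]
  rw [h0]
  unfold Qf
  rcases le_or_gt n 48 with h | h
  · rw [show Nat.ble n 48 = true by rw [Nat.ble_eq]; exact h]
    exact gcd_prime 6 30 (fun m a b => Qs1 m b a) Qd1 n (by omega) (by omega) (by omega)
  · have e1 : Nat.ble n 48 = false := by
      rw [← Bool.not_eq_true, Nat.ble_eq]; omega
    rw [e1]
    rcases le_or_gt n 724 with h' | h'
    · rw [show Nat.ble n 724 = true by rw [Nat.ble_eq]; exact h']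
      exact gcd_prime 26 223092870 (fun m a b => Qs2 m b a) Qd2 n (by omega) (by omega) (by omega)
    · have e2 : Nat.ble n 724 = false := by
        rw [← Bool.not_eq_true, Nat.ble_eq]; omega
      rw [e2]
      exact gcd_prime 724 Qb (fun m a b => Qs3 m a b) Qd3 n (by omega) (by omega) (by omega)

theorem pack_spec (M a b c d e s : ℕ) (h : pack M a b c d e = s + 1) :
    dU M s = a ∧ dT M s = b ∧ dV M s = c ∧ dL M s = d ∧ dP M s = e := by
  unfold pack guard4 at h
  by_cases ha : a + 1 ≤ M
  swap
  · rw [show Nat.ble (Nat.add a 1) M = false by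
      rw [← Bool.not_eq_true, Nat.ble_eq]; exact ha] at h
    exact absurd h (by simp)
  rw [show Nat.ble (Nat.add a 1) M = true by rw [Nat.ble_eq]; exact ha] at h
  by_cases hb : b + 1 ≤ M
  swap
  · rw [show Nat.ble (Nat.add b 1) M = false by
      rw [← Bool.not_eq_true, Nat.ble_eq]; exact hb] at h
    exact absurd h (by simp)
  rw [show Nat.ble (Nat.add b 1) M = true by rw [Nat.ble_eq]; exact hb] at h
  by_cases hc : c + 1 ≤ M
  swap
  · rw [show Nat.ble (Nat.add c 1) M = false by
      rw [← Bool.not_eq_true, Nat.ble_eq]; exact hc] at h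
    exact absurd h (by simp)
  rw [show Nat.ble (Nat.add c 1) M = true by rw [Nat.ble_eq]; exact hc] at h
  by_cases hd : d + 1 ≤ M
  swap
  · rw [show Nat.ble (Nat.add d 1) M = false by
      rw [← Bool.not_eq_true, Nat.ble_eq]; exact hd] at h
    exact absurd h (by simp)
  rw [show Nat.ble (Nat.add d 1) M = true by rw [Nat.ble_eq]; exact hd] at h
  have h' : s = a + M * (b + M * (c + M * (d + M * e))) := by
    have : enc M a b c d e + 1 = s + 1 := h
    have h2 := Nat.succ.inj this
    rw [← h2]; rfl
  have hM : 0 < M := by omega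
  have q1 : s / M = b + M * (c + M * (d + M * e)) := by
    rw [h', Nat.add_mul_div_left _ _ hM, Nat.div_eq_of_lt (by omega), zero_add]
  have q2 : s / M / M = c + M * (d + M * e) := by
    rw [q1, Nat.add_mul_div_left _ _ hM, Nat.div_eq_of_lt (by omega), zero_add]
  have q3 : s / M / M / M = d + M * e := by
    rw [q2, Nat.add_mul_div_left _ _ hM, Nat.div_eq_of_lt (by omega), zero_add]
  have q4 : s / M / M / M / M = e := by
    rw [q3, Nat.add_mul_div_left _ _ hM, Nat.div_eq_of_lt (by omega), zero_add]
  refine ⟨?_, ?_, ?_, ?_, ?_⟩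
  · change s % M = a
    rw [h', Nat.add_mul_mod_self_left, Nat.mod_eq_of_lt (by omega)]
  · change s / M % M = b
    rw [q1, Nat.add_mul_mod_self_left, Nat.mod_eq_of_lt (by omega)]
  · change s / M / M % M = c
    rw [q2, Nat.add_mul_mod_self_left, Nat.mod_eq_of_lt (by omega)]
  · change s / M / M / M % M = d
    rw [q3, Nat.add_mul_mod_self_left, Nat.mod_eq_of_lt (by omega)]
  · exact q4

theorem log_step (n m : ℕ) (hm : 1 ≤ m) (hn : m < n) :
    2 * (((n : ℝ) - m) / (n + m)) + 2 / 3 * (((n : ℝ) - m) / (n + m)) ^ 3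
      ≤ Real.log n - Real.log m := by
  have hm' : (1 : ℝ) ≤ m := by exact_mod_cast hm
  have hn' : (m : ℝ) < n := by exact_mod_cast hn
  set z : ℝ := ((n : ℝ) - m) / (n + m) with hz
  have hz0 : 0 ≤ z := div_nonneg (by linarith) (by linarith)
  have hz1 : z < 1 := by rw [hz, div_lt_one (by linarith)]; linarith
  have h := Real.hasSum_log_sub_log_of_abs_lt_one (x := z) (by rw [abs_of_nonneg hz0]; exact hz1)
  have hm0 : (0 : ℝ) < m := by linarith
  have hn0 : (0 : ℝ) < n := by linarith
  have h1 : 1 + z = 2 * n / (n + m) := by rw [hz]; field_simp; ring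
  have h2 : 1 - z = 2 * m / (n + m) := by rw [hz]; field_simp; ring
  have h3 : Real.log (1 + z) - Real.log (1 - z) = Real.log n - Real.log m := by
    rw [h1, h2, Real.log_div (by positivity) (by positivity),
      Real.log_div (by positivity) (by positivity), Real.log_mul (by norm_num) (by positivity),
      Real.log_mul (by norm_num) (by positivity)]
    ring
  rw [h3] at h
  have h4 := sum_le_hasSum (Finset.range 2) (fun i _ => by positivity) h
  rw [Finset.sum_range_succ, Finset.sum_range_one] at h4
  norm_num at h4
  linarith

theorem newL_spec (A n L m : ℕ) (hm : 1 ≤ m) (hn : m < n)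
    (h : (L : ℝ) ≤ (A : ℝ) / 2 * Real.log m) :
    (newL A n L m : ℝ) ≤ (A : ℝ) / 2 * Real.log n := by
  have hm' : (1 : ℝ) ≤ m := by exact_mod_cast hm
  have hn' : (m : ℝ) < n := by exact_mod_cast hn
  have e : newL A n L m = L + A * (n - m) / (n + m) + A * (n - m) ^ 3 / (3 * (n + m) ^ 3) := rfl
  have h1 : ((A * (n - m) / (n + m) : ℕ) : ℝ) ≤ A * (((n : ℝ) - m) / (n + m)) := by
    refine (Nat.cast_div_le).trans (le_of_eq ?_)
    rw [Nat.cast_mul, Nat.cast_sub hn.le, Nat.cast_add, mul_div_assoc]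
  have h2 : ((A * (n - m) ^ 3 / (3 * (n + m) ^ 3) : ℕ) : ℝ)
      ≤ A / 3 * (((n : ℝ) - m) / (n + m)) ^ 3 := by
    refine (Nat.cast_div_le).trans (le_of_eq ?_)
    rw [Nat.cast_mul, Nat.cast_pow, Nat.cast_sub hn.le, Nat.cast_mul, Nat.cast_pow, Nat.cast_add]
    push_cast
    rw [div_pow]
    field_simp
  have h3 := log_step n m hm hn
  have hA : (0 : ℝ) ≤ A := Nat.cast_nonneg _
  rw [e, Nat.cast_add, Nat.cast_add]
  have h4 := mul_le_mul_of_nonneg_left h3 hA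
  nlinarith

noncomputable def WW (p : ℕ) : ℝ :=
  ∑ k ∈ Finset.range 19, if p ^ (k + 1) ≤ 524288 then Real.log p / (p : ℝ) ^ (k + 1) else 0

noncomputable def SW (x : ℕ) : ℝ := ∑ p ∈ (Finset.Ioc 0 x).filter Nat.Prime, WW p

theorem SW_succ (x : ℕ) : SW (x + 1) = SW x + (if (x + 1).Prime then WW (x + 1) else 0) := by
  unfold SW
  rw [← Finset.insert_Ioc_right_eq_Ioc_add_one (Nat.zero_le x), Finset.filter_insert]
  split_ifs with h
  · rw [Finset.sum_insert (by simp), add_comm]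
  · rw [add_zero]

theorem TH_succ (x : ℕ) : Chebyshev.theta ((x + 1 : ℕ) : ℝ) = Chebyshev.theta (x : ℝ)
    + (if (x + 1).Prime then Real.log ((x + 1 : ℕ) : ℝ) else 0) := by
  unfold Chebyshev.theta
  rw [Nat.floor_natCast, Nat.floor_natCast,
    ← Finset.insert_Ioc_right_eq_Ioc_add_one (Nat.zero_le x), Finset.filter_insert]
  split_ifs with h
  · rw [Finset.sum_insert (by simp), add_comm]
  · rw [add_zero]

theorem WW_term_nonneg (p k : ℕ) :
    0 ≤ (if p ^ (k + 1) ≤ 524288 then Real.log p / (p : ℝ) ^ (k + 1) else 0) := by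
  split_ifs
  · exact div_nonneg (Real.log_natCast_nonneg p) (by positivity)
  · exact le_rfl

theorem WW_ge (p : ℕ) (h : p ≤ 524288) : Real.log p / p
    + ((if p ≤ 724 then Real.log p / (p : ℝ) ^ 2 else 0)
      + (if p ≤ 80 then Real.log p / (p : ℝ) ^ 3 else 0)) ≤ WW p := by
  have h1 : ∑ k ∈ Finset.range 3, (if p ^ (k + 1) ≤ 524288 then
      Real.log p / (p : ℝ) ^ (k + 1) else 0) ≤ WW p :=
    Finset.sum_le_sum_of_subset_of_nonneg (Finset.range_subset_range.2 (by norm_num))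
      (fun k _ _ => WW_term_nonneg p k)
  rw [Finset.sum_range_succ, Finset.sum_range_succ, Finset.sum_range_one] at h1
  have hl : 0 ≤ Real.log p := Real.log_natCast_nonneg p
  have h2 : (if p ≤ 724 then Real.log p / (p : ℝ) ^ 2 else 0)
      ≤ (if p ^ (1 + 1) ≤ 524288 then Real.log p / (p : ℝ) ^ (1 + 1) else 0) := by
    by_cases hp : p ≤ 724
    · have : p ^ (1 + 1) ≤ 524288 := (Nat.pow_le_pow_left hp 2).trans (by norm_num)
      rw [if_pos hp, if_pos this]
    · rw [if_neg hp]; exact WW_term_nonneg p 1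
  have h3 : (if p ≤ 80 then Real.log p / (p : ℝ) ^ 3 else 0)
      ≤ (if p ^ (2 + 1) ≤ 524288 then Real.log p / (p : ℝ) ^ (2 + 1) else 0) := by
    by_cases hp : p ≤ 80
    · have : p ^ (2 + 1) ≤ 524288 := (Nat.pow_le_pow_left hp 3).trans (by norm_num)
      rw [if_pos hp, if_pos this]
    · rw [if_neg hp]; exact WW_term_nonneg p 2
  rw [zero_add, pow_one, if_pos h, pow_one] at h1
  linarith

theorem newV_spec (C B n V L : ℕ) (D : ℝ) (hn : n ≤ 524288)
    (hL : (L : ℝ) ≤ (C : ℝ) * Real.log n) (hV : (V : ℝ) ≤ (C : ℝ) * B * D) :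
    (newV B n V L : ℝ) ≤ (C : ℝ) * B * (D + WW n) := by
  have hC : (0 : ℝ) ≤ (C : ℝ) * B := by positivity
  have h0 := mul_le_mul_of_nonneg_left (WW_ge n hn) hC
  have key : ∀ j, ((L * B / n ^ j : ℕ) : ℝ) ≤ (C : ℝ) * B * (Real.log n / (n : ℝ) ^ j) := by
    intro j
    refine (Nat.cast_div_le).trans ?_
    rw [Nat.cast_mul, Nat.cast_pow, ← mul_div_assoc]
    apply div_le_div_of_nonneg_right _ (by positivity)
    nlinarith [mul_le_mul_of_nonneg_right hL (Nat.cast_nonneg (α := ℝ) B)]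
  have k1 := key 1
  have k2 := key 2
  have k3 := key 3
  rw [pow_one, pow_one] at k1
  have e : newV B n V L = V + L * B / n + cond (Nat.ble n 724) (L * B / n ^ 2
    + cond (Nat.ble n 80) (L * B / n ^ 3) 0) 0 := rfl
  rw [e]
  by_cases a1 : n ≤ 724
  · rw [show Nat.ble n 724 = true by rw [Nat.ble_eq]; exact a1]
    rw [if_pos a1] at h0
    by_cases a2 : n ≤ 80
    · rw [show Nat.ble n 80 = true by rw [Nat.ble_eq]; exact a2]
      rw [if_pos a2] at h0
      simp only [cond_true]
      rw [Nat.cast_add, Nat.cast_add, Nat.cast_add]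
      linarith
    · rw [show Nat.ble n 80 = false by rw [← Bool.not_eq_true, Nat.ble_eq]; exact a2]
      rw [if_neg a2] at h0
      simp only [cond_true, cond_false]
      rw [Nat.cast_add, Nat.cast_add, add_zero]
      linarith
  · rw [show Nat.ble n 724 = false by rw [← Bool.not_eq_true, Nat.ble_eq]; exact a1]
    have a2 : ¬ n ≤ 80 := by omega
    rw [if_neg a1, if_neg a2] at h0
    simp only [cond_false]
    rw [Nat.cast_add, Nat.cast_add, Nat.cast_zero]
    linarith

/-- The invariant of the sieve machine. -/
structure Inv (M C B K m s : ℕ) : Prop where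
  hm : 4 ≤ m
  hU : m ≤ 262145 → (K : ℝ) * PP (2 * m) ≤ dU M s
  hT : m ≤ 262145 → (dT M s : ℝ) ≤ (C : ℝ) * Chebyshev.theta ((2 * m : ℕ) : ℝ)
  hV : m ≤ 262145 → (dV M s : ℝ) ≤ (C : ℝ) * B * SW (2 * m)
  hL : m ≤ 262145 → (dL M s : ℝ) ≤ (C : ℝ) * Real.log (dP M s)
  hP1 : 1 ≤ dP M s
  hP2 : dP M s < 2 * m

theorem even_step (m : ℕ) (hm : 4 ≤ m) : ¬ (2 * m + 1 + 1).Prime := by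
  intro h
  have := (Nat.prime_dvd_prime_iff_eq Nat.prime_two h).1 ⟨m + 1, by ring⟩
  omega

theorem upd_spec (M C B K m s s' : ℕ) (hI : Inv M C B K m s) (hp : m ≤ 262144 → (2 * m + 1).Prime)
    (h : upd M (2 * C) B (2 * m) s = s' + 1) : Inv M C B K (m + 1) s' := by
  have hm := hI.hm
  set L := newL (2 * C) (2 * m + 1) (dL M s) (dP M s) with hLdef
  have h' : pack M (dU M s + dU M s / (2 * m) + 1) (dT M s + L)
      (newV B (2 * m + 1) (dV M s) L) L (2 * m + 1) = s' + 1 := h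
  obtain ⟨e1, e2, e3, e4, e5⟩ := pack_spec _ _ _ _ _ _ _ h'
  have e2m : 2 * (m + 1) = 2 * m + 1 + 1 := by ring
  have hLn : m ≤ 262145 → (L : ℝ) ≤ (C : ℝ) * Real.log ((2 * m + 1 : ℕ) : ℝ) := by
    intro hm1
    have h1 := hI.hL hm1
    have h2 := newL_spec (2 * C) (2 * m + 1) (dL M s) (dP M s) hI.hP1
      (by have := hI.hP2; omega) (by push_cast; linarith)
    refine h2.trans (le_of_eq ?_)
    rw [Nat.cast_mul, Nat.cast_two]; ring
  refine ⟨by omega, ?_, ?_, ?_, ?_, by omega, by omega⟩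
  · intro hm1
    have hpr := hp (by omega)
    rw [e2m, PP_succ, if_neg (even_step m hm), mul_one, PP_succ, if_pos hpr, e1]
    have hU := hI.hU (by omega)
    have hm0 : (0 : ℝ) < ((2 * m : ℕ) : ℝ) := by exact_mod_cast (by omega : 0 < 2 * m)
    have h3 : (dU M s : ℝ) / ((2 * m : ℕ) : ℝ) ≤ ((dU M s / (2 * m) : ℕ) : ℝ) + 1 := by
      rw [div_le_iff₀ hm0]
      have h4 := Nat.div_add_mod (dU M s) (2 * m)
      have h5 := Nat.mod_lt (dU M s) (show 0 < 2 * m by omega)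
      have h6 : dU M s ≤ (dU M s / (2 * m) + 1) * (2 * m) := by nlinarith
      exact_mod_cast h6
    have h4 : (((2 * m + 1 : ℕ) : ℝ) / (((2 * m + 1 : ℕ) : ℝ) - 1))
        = 1 + 1 / ((2 * m : ℕ) : ℝ) := by
      rw [Nat.cast_add, Nat.cast_one, add_sub_cancel_right, add_div, div_self hm0.ne']
    rw [h4, Nat.cast_add, Nat.cast_add, Nat.cast_one]
    have h5 : (K : ℝ) * PP (2 * m) / ((2 * m : ℕ) : ℝ) ≤ (dU M s : ℝ) / ((2 * m : ℕ) : ℝ) :=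
      div_le_div_of_nonneg_right hU hm0.le
    have h6 : (K : ℝ) * (PP (2 * m) * (1 + 1 / ((2 * m : ℕ) : ℝ)))
        = (K : ℝ) * PP (2 * m) + (K : ℝ) * PP (2 * m) / ((2 * m : ℕ) : ℝ) := by ring
    rw [h6]
    linarith
  · intro hm1
    have hpr := hp (by omega)
    rw [e2m, TH_succ, if_neg (even_step m hm), add_zero, TH_succ, if_pos hpr, e2, Nat.cast_add]
    have := hI.hT (by omega)
    have := hLn (by omega)
    rw [mul_add]
    linarith
  · intro hm1
    have hpr := hp (by omega)
    rw [e2m, SW_succ, if_neg (even_step m hm), add_zero, SW_succ, if_pos hpr, e3]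
    apply newV_spec
    · have : 2 * m + 1 ≠ 524289 := by
        intro h0
        rw [h0] at hpr
        revert hpr
        norm_num
      omega
    · exact hLn (by omega)
    · exact hI.hV (by omega)
  · intro hm1
    rw [e4, e5]
    exact hLn (by omega)

theorem stepM_spec (M C B K m s s' : ℕ) (hI : Inv M C B K m s)
    (h : stepM M (2 * C) B m s = s' + 1) : Inv M C B K (m + 1) s' := by
  have h' : cond (isP (2 * m + 1)) (upd M (2 * C) B (2 * m) s) (s + 1) = s' + 1 := h
  have hm := hI.hm
  have hs : m ≤ 262144 → (isP (2 * m + 1) = true ↔ (2 * m + 1).Prime) := fun hm1 =>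
    isP_spec _ (by omega) (by omega)
  cases hc : isP (2 * m + 1) with
  | true =>
    rw [hc] at h'
    exact upd_spec M C B K m s s' hI (fun hm1 => (hs hm1).1 hc) h'
  | false =>
    rw [hc] at h'
    have hss : s = s' := Nat.succ.inj h'
    subst hss
    have hn : m ≤ 262144 → ¬ (2 * m + 1).Prime := fun hm1 hp => by
      rw [(hs hm1).2 hp] at hc; exact absurd hc (by simp)
    have e2m : 2 * (m + 1) = 2 * m + 1 + 1 := by ring
    refine ⟨by omega, ?_, ?_, ?_, ?_, hI.hP1, by have := hI.hP2; omega⟩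
    · intro hm1
      rw [e2m, PP_succ, if_neg (even_step m hm), mul_one, PP_succ, if_neg (hn (by omega)), mul_one]
      exact hI.hU (by omega)
    · intro hm1
      rw [e2m, TH_succ, if_neg (even_step m hm), add_zero, TH_succ, if_neg (hn (by omega)),
        add_zero]
      exact hI.hT (by omega)
    · intro hm1
      rw [e2m, SW_succ, if_neg (even_step m hm), add_zero, SW_succ, if_neg (hn (by omega)),
        add_zero]
      exact hI.hV (by omega)
    · intro hm1; exact hI.hL (by omega)

theorem PP_mono {x y : ℕ} (h : x ≤ y) : PP x ≤ PP y := by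
  refine monotone_nat_of_le_succ (f := PP) (fun n => ?_) h
  rw [PP_succ]
  have h0 := PP_pos n
  split_ifs with hp
  · have h2 : (2 : ℝ) ≤ ((n + 1 : ℕ) : ℝ) := by exact_mod_cast hp.two_le
    have h1 : 1 ≤ ((n + 1 : ℕ) : ℝ) / (((n + 1 : ℕ) : ℝ) - 1) := by
      rw [le_div_iff₀ (by linarith)]; linarith
    nlinarith
  · rw [mul_one]

def Good (x : ℕ) : Prop := PP x ≤ 9 / 5 * Real.log (Chebyshev.theta (x : ℝ))
  + 2.51 / Real.log (Chebyshev.theta (x : ℝ))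

theorem chk_spec (M K R s s1 a : ℕ) (h : chk M K R s s1 a = true) :
    6400 * a * dU M s1 ≤ K * (180 * (a * a) + 1028096) ∧ 77 ≤ a ∧
    27182818286 ^ a * R ^ 64 ≤ (dT M s) ^ 64 * 10000000000 ^ a := by
  unfold chk at h
  rw [Bool.cond_false_right, Bool.cond_false_right, Bool.and_eq_true, Bool.and_eq_true,
    Nat.ble_eq, Nat.ble_eq, Nat.ble_eq] at h
  exact h

theorem theta_lb (R T a : ℕ) (th : ℝ) (hR : 0 < R) (h0 : 0 < th) (hT : (T : ℝ) ≤ (R : ℝ) * th)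
    (h : 27182818286 ^ a * R ^ 64 ≤ T ^ 64 * 10000000000 ^ a) : (a : ℝ) / 64 ≤ Real.log th := by
  have h1 := (Nat.cast_le (α := ℝ)).2 h
  rw [Nat.cast_mul, Nat.cast_mul, Nat.cast_pow, Nat.cast_pow, Nat.cast_pow, Nat.cast_pow,
    Nat.cast_ofNat, Nat.cast_ofNat] at h1
  have hR' : (0 : ℝ) < R := by exact_mod_cast hR
  have h2 : (T : ℝ) ^ 64 ≤ (R : ℝ) ^ 64 * th ^ 64 := by
    rw [← mul_pow]; exact pow_le_pow_left₀ (Nat.cast_nonneg _) hT 64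
  have h3 : Real.exp a ≤ (27182818286 / 10000000000 : ℝ) ^ a := by
    have : Real.exp (a : ℝ) = Real.exp 1 ^ a := by rw [← Real.exp_nat_mul, mul_one]
    rw [this]
    apply pow_le_pow_left₀ (Real.exp_pos _).le
    have := Real.exp_one_lt_d9
    norm_num at this ⊢
    linarith
  have h4 : (27182818286 / 10000000000 : ℝ) ^ a ≤ th ^ 64 := by
    rw [div_pow, div_le_iff₀ (by positivity)]
    have hp : (0 : ℝ) < (R : ℝ) ^ 64 := by positivity
    have hq : (0 : ℝ) < (10000000000 : ℝ) ^ a := by positivity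
    have h5 := mul_le_mul_of_nonneg_right h2 hq.le
    refine le_of_mul_le_mul_right (h1.trans (h5.trans (le_of_eq ?_))) hp
    ring
  have h6 := Real.log_le_log (Real.exp_pos _) (h3.trans h4)
  rw [Real.log_exp, Real.log_pow] at h6
  push_cast at h6
  linarith

theorem seg_good (M C B K m j s s1 a : ℕ) (hC : 0 < C) (hK : 0 < K) (hI : Inv M C B K m s)
    (hI1 : Inv M C B K (m + j) s1) (hj : m + j ≤ 262145) (h : chk M K C s s1 a = true)
    (x : ℕ) (h1 : 2 * m ≤ x + 1) (h2 : x ≤ 2 * (m + j)) : Good x := by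
  obtain ⟨c1, c2, c3⟩ := chk_spec _ _ _ _ _ _ h
  have hm := hI.hm
  have hth : Chebyshev.theta ((2 * m : ℕ) : ℝ) ≤ Chebyshev.theta (x : ℝ) := by
    rcases Nat.lt_or_ge x (2 * m) with hx | hx
    · have e : 2 * m = x + 1 := by omega
      rw [e, TH_succ, if_neg, add_zero]
      rw [← e]
      obtain ⟨k, rfl⟩ : ∃ k, m = k + 1 := ⟨m - 1, by omega⟩
      intro hp
      have := (Nat.prime_dvd_prime_iff_eq Nat.prime_two hp).1 ⟨k + 1, rfl⟩
      omega
    · exact Chebyshev.theta_mono (by exact_mod_cast hx)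
  have hpos : 0 < Chebyshev.theta ((2 * m : ℕ) : ℝ) :=
    Chebyshev.theta_pos (by exact_mod_cast (by omega : 2 ≤ 2 * m))
  have hl := theta_lb C (dT M s) a _ hC hpos (hI.hT (by omega)) c3
  have hl2 := hl.trans (Real.log_le_log hpos hth)
  have ha : (77 : ℝ) ≤ a := by exact_mod_cast c2
  have hf := f_mono ((a : ℝ) / 64) _ (by norm_num; linarith) hl2
  have hU := hI1.hU hj
  have hK' : (0 : ℝ) < K := by exact_mod_cast hK
  have hPx : PP x ≤ PP (2 * (m + j)) := PP_mono h2
  have c1' := (Nat.cast_le (α := ℝ)).2 c1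
  push_cast at c1'
  unfold Good
  refine hPx.trans (le_trans ?_ hf)
  have e : 9 / 5 * ((a : ℝ) / 64) + 2.51 / ((a : ℝ) / 64)
      = (180 * (a * a) + 1028096) / (6400 * a) := by
    field_simp; ring
  rw [e, le_div_iff₀ (by positivity)]
  have h5 := mul_le_mul_of_nonneg_left hU (show (0 : ℝ) ≤ 6400 * a by positivity)
  refine le_of_mul_le_mul_left (le_trans (le_of_eq ?_) (h5.trans c1')) hK'
  ring

theorem runC_spec (M C B K c m s s1 : ℕ) (hI : Inv M C B K m s)
    (h : runC (stepM M (2 * C) B) c m s = s1 + 1) : Inv M C B K (m + cnt c) s1 := by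
  cases c with
  | zero =>
    have h' : s + 1 = s1 + 1 := h
    have : s = s1 := Nat.succ.inj h'
    subst this
    exact hI
  | succ k =>
    exact (runT_spec _ (Inv M C B K) (fun m s s' => stepM_spec M C B K m s s') k m s s1 hI h).2

theorem runL_spec (M C B K : ℕ) (hC : 0 < C) (hK : 0 < K) (l : List (ℕ × ℕ)) :
    ∀ m s r, Inv M C B K m s → runL M (2 * C) B K C l m s = r + 1 → m + lenL l ≤ 262145 →
      (∀ x, 2 * m ≤ x + 1 → x + 2 ≤ 2 * (m + lenL l) → Good x) ∧ Inv M C B K (m + lenL l) r := by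
  induction l with
  | nil =>
    intro m s r hI h hlen
    have h' : s + 1 = r + 1 := h
    have : s = r := Nat.succ.inj h'
    subst this
    have e : lenL [] = 0 := by simp [lenL]
    rw [e, add_zero]
    exact ⟨fun x h1 h2 => by omega, hI⟩
  | cons p l ih =>
    intro m s r hI h hlen
    have e : lenL (p :: l) = cnt p.1 + 1 + lenL l := by simp [lenL]
    rw [e] at hlen ⊢
    have h' : (Nat.rec (motive := fun _ => ℕ) 0
      (fun s1 _ => cond (chk M K C s s1 p.2)
        (Nat.rec (motive := fun _ => ℕ) 0
          (fun s2 _ => runL M (2 * C) B K C l (m + cnt p.1 + 1) s2)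
          (stepM M (2 * C) B (m + cnt p.1) s1)) 0)
      (runC (stepM M (2 * C) B) p.1 m s) : ℕ) = r + 1 := h
    cases hr : runC (stepM M (2 * C) B) p.1 m s with
    | zero => rw [hr] at h'; exact absurd h' (by simp)
    | succ s1 =>
      rw [hr] at h'
      have hI1 := runC_spec M C B K p.1 m s s1 hI hr
      have h2 : cond (chk M K C s s1 p.2)
        (Nat.rec (motive := fun _ => ℕ) 0
          (fun s2 _ => runL M (2 * C) B K C l (m + cnt p.1 + 1) s2)
          (stepM M (2 * C) B (m + cnt p.1) s1)) 0 = r + 1 := h'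
      cases hc : chk M K C s s1 p.2 with
      | false => rw [hc] at h2; exact absurd h2 (by simp)
      | true =>
        rw [hc] at h2
        cases hs : stepM M (2 * C) B (m + cnt p.1) s1 with
        | zero => rw [hs] at h2; exact absurd h2 (by simp)
        | succ s2 =>
          rw [hs] at h2
          have h3 : runL M (2 * C) B K C l (m + cnt p.1 + 1) s2 = r + 1 := h2
          have hI2 := stepM_spec M C B K _ s1 s2 hI1 hs
          obtain ⟨g1, g2⟩ := ih _ s2 r hI2 h3 (by omega)
          refine ⟨?_, ?_⟩
          · intro x hx1 hx2
            by_cases hx : x ≤ 2 * (m + cnt p.1)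
            · exact seg_good M C B K m (cnt p.1) s s1 p.2 hC hK hI hI1 (by omega) hc x hx1 hx
            · exact g1 x (by omega) (by omega)
          · rw [show m + (cnt p.1 + 1 + lenL l) = m + cnt p.1 + 1 + lenL l by omega]
            exact g2

theorem fin_spec (M C B K c1 c2 s0 : ℕ) (hC : 0 < C) (hK : 0 < K) (hI : Inv M C B K 4 s0)
    (h : finChk M c1 c2 (runL M (2 * C) B K C segs 4 s0) = true) :
    (∀ x, 7 ≤ x → x ≤ 524288 → Good x) ∧ (K : ℝ) * PP 524290 ≤ c1 ∧
      (c2 : ℝ) ≤ (C : ℝ) * B * SW 524290 := by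
  cases hr : runL M (2 * C) B K C segs 4 s0 with
  | zero => rw [hr] at h; exact absurd h (by simp [finChk])
  | succ r =>
    rw [hr] at h
    have h1 : cond (Nat.ble (dU M r) c1) (Nat.ble c2 (dV M r)) false = true := h
    rw [Bool.cond_false_right, Bool.and_eq_true, Nat.ble_eq, Nat.ble_eq] at h1
    obtain ⟨g1, g2⟩ := runL_spec M C B K hC hK segs 4 s0 r hI hr (by rw [segs_len])
    rw [segs_len] at g1 g2
    refine ⟨fun x a b => g1 x (by omega) (by omega), ?_, ?_⟩
    · exact (g2.hU (by norm_num)).trans (by exact_mod_cast h1.1)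
    · exact le_trans (by exact_mod_cast h1.2) (g2.hV (by norm_num))

theorem Inv_init (M C B K U T V L P : ℕ) (hU : U < M) (hT : T < M) (hV : V < M) (hL : L < M)
    (kU : (K : ℝ) * PP 8 ≤ U) (kT : (T : ℝ) ≤ (C : ℝ) * Chebyshev.theta ((8 : ℕ) : ℝ))
    (kV : (V : ℝ) ≤ (C : ℝ) * B * SW 8) (kL : (L : ℝ) ≤ (C : ℝ) * Real.log P)
    (hP : 1 ≤ P) (hP2 : P < 8) : Inv M C B K 4 (enc M U T V L P) := by
  have h : pack M U T V L P = enc M U T V L P + 1 := by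
    unfold pack guard4
    rw [show Nat.ble (Nat.add U 1) M = true by rw [Nat.ble_eq]; exact hU,
      show Nat.ble (Nat.add T 1) M = true by rw [Nat.ble_eq]; exact hT,
      show Nat.ble (Nat.add V 1) M = true by rw [Nat.ble_eq]; exact hV,
      show Nat.ble (Nat.add L 1) M = true by rw [Nat.ble_eq]; exact hL]
    rfl
  obtain ⟨e1, e2, e3, e4, e5⟩ := pack_spec _ _ _ _ _ _ _ h
  refine ⟨le_rfl, ?_, ?_, ?_, ?_, ?_, ?_⟩
  · intro _; rw [e1]; exact kU
  · intro _; rw [e2]; exact kT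
  · intro _; rw [e3]; exact kV
  · intro _; rw [e4, e5]; exact kL
  · rw [e5]; exact hP
  · rw [e5]; exact hP2

theorem primes8 : (Finset.Ioc 0 8).filter Nat.Prime = {2, 3, 5, 7} := by decide

theorem PP8 : PP 8 = 35 / 8 := by
  unfold PP
  rw [primes8]
  norm_num

theorem TH8 : Chebyshev.theta ((8 : ℕ) : ℝ)
    = Real.log 2 + Real.log 3 + Real.log 5 + Real.log 7 := by
  unfold Chebyshev.theta
  rw [Nat.floor_natCast, primes8]
  simp
  ring

theorem SW8 : SW 8 = WW 2 + WW 3 + WW 5 + WW 7 := by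
  unfold SW
  rw [primes8]
  simp
  ring

theorem WW2 : WW 2 = Real.log 2 * (524287 / 524288) := by
  unfold WW
  simp only [Finset.sum_range_succ, Finset.sum_range_zero]
  norm_num
  ring

theorem WW3 : WW 3 = Real.log 3 * (88573 / 177147) := by
  unfold WW
  simp only [Finset.sum_range_succ, Finset.sum_range_zero]
  norm_num
  ring

theorem WW5 : WW 5 = Real.log 5 * (97656 / 390625) := by
  unfold WW
  simp only [Finset.sum_range_succ, Finset.sum_range_zero]
  norm_num
  ring

theorem WW7 : WW 7 = Real.log 7 * (19608 / 117649) := by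
  unfold WW
  simp only [Finset.sum_range_succ, Finset.sum_range_zero]
  norm_num
  ring

theorem init_ok : Inv 79228162514264337593543950336 4294967296 65536 18446744073709551616 4
    (sInit 79228162514264337593543950336) := by
  unfold sInit
  have a1 := Real.log_two_gt_d9
  have a2 := Real.log_three_gt_d9
  have a3 := Real.log_five_gt_d9
  have a4 := log7_lb
  apply Inv_init
  · norm_num
  · norm_num
  · norm_num
  · norm_num
  · rw [PP8]; norm_num
  · rw [TH8]
    norm_num at a1 a2 a3 a4 ⊢
    linarith
  · rw [SW8, WW2, WW3, WW5, WW7]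
    norm_num at a1 a2 a3 a4 ⊢
    linarith
  · norm_num at a4 ⊢
    linarith
  · norm_num
  · norm_num

theorem SW_le_SL_aux (N : ℕ) : ∑ p ∈ (Finset.Ioc 0 N).filter Nat.Prime, ∑ k ∈ Finset.range 19,
    (if p ^ (k + 1) ≤ N then Real.log p / (p : ℝ) ^ (k + 1) else 0) ≤ SL N := by
  rw [← Finset.sum_product', ← Finset.sum_filter]
  set S := (((Finset.Ioc 0 N).filter Nat.Prime) ×ˢ Finset.range 19).filter
    (fun q : ℕ × ℕ => q.1 ^ (q.2 + 1) ≤ N) with hS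
  have hmem : ∀ q ∈ S, q.1.Prime ∧ q.1 ^ (q.2 + 1) ≤ N := by
    intro q hq
    rw [hS, Finset.mem_filter, Finset.mem_product, Finset.mem_filter] at hq
    exact ⟨hq.1.1.2, hq.2⟩
  have hinj : Set.InjOn (fun q : ℕ × ℕ => q.1 ^ (q.2 + 1)) S := by
    intro q hq r hr h
    have := Nat.Prime.pow_inj (hmem q hq).1 (hmem r hr).1 h
    exact Prod.ext this.1 this.2
  have h1 : ∑ q ∈ S, Real.log q.1 / (q.1 : ℝ) ^ (q.2 + 1)
      = ∑ n ∈ S.image (fun q : ℕ × ℕ => q.1 ^ (q.2 + 1)),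
        ArithmeticFunction.vonMangoldt n / (n : ℝ) := by
    rw [Finset.sum_image hinj]
    apply Finset.sum_congr rfl
    intro q hq
    rw [ArithmeticFunction.vonMangoldt_apply_pow (by omega),
      ArithmeticFunction.vonMangoldt_apply_prime (hmem q hq).1, Nat.cast_pow]
  rw [h1]
  apply Finset.sum_le_sum_of_subset_of_nonneg
  · intro n hn
    obtain ⟨q, hq, rfl⟩ := Finset.mem_image.1 hn
    exact Finset.mem_Ioc.2 ⟨pow_pos (hmem q hq).1.pos _, (hmem q hq).2⟩
  · intro n _ _
    exact div_nonneg ArithmeticFunction.vonMangoldt_nonneg (Nat.cast_nonneg _)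

theorem SW_le_SL : SW 524288 ≤ SL 524288 := SW_le_SL_aux 524288

theorem SW_end : SW 524290 = SW 524288 := by
  have h1 := SW_succ 524289
  have h2 := SW_succ 524288
  rw [if_neg (by norm_num)] at h1 h2
  rw [show (524290 : ℕ) = 524289 + 1 by norm_num, h1,
    show (524289 : ℕ) = 524288 + 1 by norm_num, h2, add_zero, add_zero]

theorem fin_all : (∀ x, 7 ≤ x → x ≤ 524288 → Good x) ∧
    ((18446744073709551616 : ℕ) : ℝ) * PP 524290 ≤ ((432760000000000000000 : ℕ) : ℝ) ∧
    ((3544300000000000 : ℕ) : ℝ) ≤ ((4294967296 : ℕ) : ℝ) * (65536 : ℕ) * SW 524290 :=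
  fin_spec 79228162514264337593543950336 4294967296 65536 18446744073709551616
    432760000000000000000 3544300000000000 (sInit 79228162514264337593543950336)
    (by norm_num) (by norm_num) init_ok run_main

theorem hS_fin : 19 * Real.log 2 - 0.5785 ≤ SL 524288 := by
  have h := fin_all.2.2
  rw [SW_end] at h
  have h1 := SW_le_SL
  have h2 := Real.log_two_lt_d9
  generalize SW 524288 = a at *
  generalize SL 524288 = b at *
  norm_num at h h2 ⊢
  linarith

theorem hP_fin : PP 524288 ≤ 1.7814 * (19 * Real.log 2) := by
  have h := fin_all.2.1
  have h1 : PP 524288 ≤ PP 524290 := PP_mono (by norm_num)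
  have h2 := Real.log_two_gt_d9
  generalize PP 524288 = a at *
  generalize PP 524290 = b at *
  norm_num at h h2 ⊢
  linarith

theorem all_good (x : ℕ) (hx : 7 ≤ x) : Good x := by
  rcases le_total x 524288 with h | h
  · exact fin_all.1 x hx h
  · exact main_large hS_fin hP_fin x h

/-- Exchange lemma: among sets of primes of a given size, an initial segment is extremal. -/
theorem exch (g : ℕ → ℝ) (hg : ∀ a b, 2 ≤ a → a ≤ b → g b ≤ g a) (x : ℕ) (hx : 2 ≤ x)
    (S : Finset ℕ) (hS : ∀ p ∈ S, p.Prime)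
    (hc : S.card = ((Finset.Ioc 0 x).filter Nat.Prime).card) :
    ∑ p ∈ S, g p ≤ ∑ p ∈ (Finset.Ioc 0 x).filter Nat.Prime, g p := by
  set P := (Finset.Ioc 0 x).filter Nat.Prime with hP
  have h1 : ∑ p ∈ S \ P, g p ≤ (S \ P).card • g x := by
    apply Finset.sum_le_card_nsmul
    intro p hp
    rw [Finset.mem_sdiff] at hp
    refine hg x p hx ?_
    by_contra hlt
    exact hp.2 (Finset.mem_filter.2 ⟨Finset.mem_Ioc.2 ⟨(hS p hp.1).pos, by omega⟩, hS p hp.1⟩)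
  have h2 : (P \ S).card • g x ≤ ∑ p ∈ P \ S, g p := by
    apply Finset.card_nsmul_le_sum
    intro p hp
    rw [Finset.mem_sdiff, hP, Finset.mem_filter, Finset.mem_Ioc] at hp
    exact hg p x hp.1.2.two_le hp.1.1.2
  have h3 : (S \ P).card = (P \ S).card := Finset.card_sdiff_comm hc
  rw [h3] at h1
  have h4 := Finset.sum_inter_add_sum_sdiff S P g
  have h5 := Finset.sum_inter_add_sum_sdiff P S g
  rw [Finset.inter_comm] at h5
  linarith

theorem exists_x (k : ℕ) (hk : 1 ≤ k) :
    ∃ x, 2 ≤ x ∧ ((Finset.Ioc 0 x).filter Nat.Prime).card = k := by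
  refine ⟨Nat.nth Nat.Prime (k - 1), (Nat.prime_nth_prime _).two_le, ?_⟩
  set x := Nat.nth Nat.Prime (k - 1) with hx
  have h1 : Nat.count Nat.Prime (x + 1) = k := by
    rw [Nat.count_succ, if_pos (Nat.prime_nth_prime _), hx,
      Nat.count_nth_of_infinite Nat.infinite_setOfPred_prime]
    omega
  rw [Nat.count_eq_card_filter_range] at h1
  rw [← h1]
  congr 1
  ext p
  simp only [Finset.mem_filter, Finset.mem_Ioc, Finset.mem_range]
  constructor
  · rintro ⟨⟨a, b⟩, c⟩; exact ⟨by omega, c⟩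
  · rintro ⟨a, c⟩; exact ⟨⟨c.pos, by omega⟩, c⟩

theorem totient_ratio (n : ℕ) (hn : 1 ≤ n) :
    (n : ℝ) / n.totient = ∏ p ∈ n.primeFactors, (p : ℝ) / ((p : ℝ) - 1) := by
  have h := Nat.totient_mul_prod_primeFactors n
  have h' := congrArg (Nat.cast (R := ℝ)) h
  rw [Nat.cast_mul, Nat.cast_mul, Nat.cast_prod, Nat.cast_prod] at h'
  have e : ∏ p ∈ n.primeFactors, ((p - 1 : ℕ) : ℝ) = ∏ p ∈ n.primeFactors, ((p : ℝ) - 1) := by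
    apply Finset.prod_congr rfl
    intro p hp
    rw [Nat.cast_sub (Nat.prime_of_mem_primeFactors hp).one_le, Nat.cast_one]
  rw [e] at h'
  have hpos : 0 < ∏ p ∈ n.primeFactors, ((p : ℝ) - 1) := by
    apply Finset.prod_pos
    intro p hp
    have : (2 : ℝ) ≤ p := by exact_mod_cast (Nat.prime_of_mem_primeFactors hp).two_le
    linarith
  have ht : (0 : ℝ) < n.totient := by exact_mod_cast Nat.totient_pos.2 hn
  rw [Finset.prod_div_distrib, div_eq_div_iff ht.ne' hpos.ne']
  linarith

theorem reduction (n : ℕ) (hn : 3 ≤ n) : ∃ x : ℕ, 2 ≤ x ∧ (n : ℝ) / n.totient ≤ PP x ∧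
    Chebyshev.theta (x : ℝ) ≤ Real.log n := by
  have hk : 1 ≤ n.primeFactors.card :=
    Finset.card_pos.2 (Nat.nonempty_primeFactors.2 (by omega))
  obtain ⟨x, hx, hc⟩ := exists_x _ hk
  have hS : ∀ p ∈ n.primeFactors, p.Prime := fun p hp => Nat.prime_of_mem_primeFactors hp
  have hg : ∀ p : ℕ, p.Prime → 0 < (p : ℝ) / ((p : ℝ) - 1) := by
    intro p hp
    have : (2 : ℝ) ≤ p := by exact_mod_cast hp.two_le
    exact div_pos (by linarith) (by linarith)
  refine ⟨x, hx, ?_, ?_⟩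
  · rw [totient_ratio n (by omega)]
    have h := exch (fun p => Real.log ((p : ℝ) / ((p : ℝ) - 1))) ?_ x hx n.primeFactors hS hc.symm
    · rw [← Real.log_prod (fun p hp => (hg p (hS p hp)).ne'),
        ← Real.log_prod (fun p hp => (hg p (Finset.mem_filter.1 hp).2).ne')] at h
      refine (Real.log_le_log_iff ?_ (PP_pos x)).1 h
      exact Finset.prod_pos fun p hp => hg p (hS p hp)
    · intro a b ha hab
      have ha' : (2 : ℝ) ≤ a := by exact_mod_cast ha
      have hab' : (a : ℝ) ≤ b := by exact_mod_cast hab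
      apply Real.log_le_log (div_pos (by linarith) (by linarith))
      rw [div_le_div_iff₀ (by linarith) (by linarith)]
      nlinarith
  · have h := exch (fun p => -Real.log (p : ℝ)) ?_ x hx n.primeFactors hS hc.symm
    · rw [Finset.sum_neg_distrib, Finset.sum_neg_distrib] at h
      have h1 : Chebyshev.theta (x : ℝ) = ∑ p ∈ (Finset.Ioc 0 x).filter Nat.Prime,
          Real.log (p : ℝ) := by
        unfold Chebyshev.theta; rw [Nat.floor_natCast]
      rw [h1]
      have h2 : ∑ p ∈ n.primeFactors, Real.log (p : ℝ) ≤ Real.log n := by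
        rw [← Real.log_prod (fun p hp => by exact_mod_cast (hS p hp).ne_zero), ← Nat.cast_prod]
        have h3 : 0 < ∏ p ∈ n.primeFactors, p := Finset.prod_pos fun p hp => (hS p hp).pos
        apply Real.log_le_log (by exact_mod_cast h3)
        exact_mod_cast Nat.le_of_dvd (by omega) (Nat.prod_primeFactors_dvd n)
      linarith
    · intro a b ha hab
      have ha' : (2 : ℝ) ≤ a := by exact_mod_cast ha
      exact neg_le_neg (Real.log_le_log (by linarith) (by exact_mod_cast hab))

theorem PP6 : PP 6 = 15 / 4 := by
  have e : (Finset.Ioc 0 6).filter Nat.Prime = {2, 3, 5} := by decide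
  unfold PP
  rw [e]
  norm_num

theorem theta7 : 5 ≤ Chebyshev.theta ((7 : ℕ) : ℝ) := by
  have h := TH_succ 7
  rw [if_neg (by norm_num), add_zero] at h
  rw [← h]
  have h8 := TH8
  rw [show (7 + 1 : ℕ) = 8 by norm_num, h8]
  have a1 := Real.log_two_gt_d9
  have a2 := Real.log_three_gt_d9
  have a3 := Real.log_five_gt_d9
  have a4 := log7_lb
  norm_num at a1 a2 a3 a4
  linarith

theorem final (n : ℕ) (hn : 3 ≤ n) : (n : ℝ) / n.totient
    ≤ 9 / 5 * Real.log (Real.log n) + 2.51 / Real.log (Real.log n) := by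
  obtain ⟨x, hx, h1, h2⟩ := reduction n hn
  refine h1.trans ?_
  rcases Nat.lt_or_ge x 7 with h7 | h7
  · have hP : PP x ≤ 15 / 4 := by rw [← PP6]; exact PP_mono (by omega)
    refine hP.trans ?_
    have hl : 1 < Real.log n := by
      have h3 : Real.log 3 ≤ Real.log n :=
        Real.log_le_log (by norm_num) (by exact_mod_cast hn)
      have := Real.log_three_gt_d9
      norm_num at this
      linarith
    have ht := Real.log_pos hl
    generalize Real.log (Real.log n) = t at *
    have e : 9 / 5 * t + 2.51 / t = (9 / 5 * t ^ 2 + 2.51) / t := by field_simp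
    rw [e, le_div_iff₀ ht]
    nlinarith [sq_nonneg (t - 25 / 24)]
  · have hg : PP x ≤ _ := all_good x h7
    refine hg.trans ?_
    have h5 : 5 ≤ Chebyshev.theta (x : ℝ) :=
      theta7.trans (Chebyshev.theta_mono (by exact_mod_cast h7))
    have h6 : Real.log 5 ≤ Real.log (Chebyshev.theta (x : ℝ)) :=
      Real.log_le_log (by norm_num) h5
    have a3 := Real.log_five_gt_d9
    refine f_mono _ _ ?_ (Real.log_le_log (by linarith) h2)
    norm_num at a3 ⊢
    linarith

end RS

/-- Rosser–Schoenfeld: for `n ≥ 3`, `n/φ(n) ≤ (9/5)·log log n + 2.51/log log n`. -/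
theorem rosser_schoenfeld_totient (n : ℕ) (hn : 3 ≤ n) :
    (n : ℝ) / n.totient ≤ 9 / 5 * Real.log (Real.log n) + 2.51 / Real.log (Real.log n) := by
  exact RS.final n hn
end

section
/- For every integer n ≥ 3, ω(n) ≤ log n / log(log n) + 1.45743 · log n / (log(log n))², where ω(n) is the number of distinct prime factors of n. -/
open Real

/-- theta at naturals -/
noncomputable def th (n : ℕ) : ℝ := Chebyshev.theta (n : ℝ)

theorem th_eq (n : ℕ) : th n = ∑ p ∈ Nat.primesLE n, log (p : ℝ) :=
  Chebyshev.theta_eq_sum_primesLE_log n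

theorem th_mono {a b : ℕ} (h : a ≤ b) : th a ≤ th b :=
  Chebyshev.theta_mono (by exact_mod_cast h)

theorem th_succ_prime {n : ℕ} (h : (n+1).Prime) : th (n+1) = th n + log ((n+1 : ℕ) : ℝ) := by
  rw [th_eq, th_eq, Nat.primesLE_succ, if_pos h, Finset.sum_insert (Nat.notMem_primesLE n), add_comm]

theorem th_succ_not {n : ℕ} (h : ¬ (n+1).Prime) : th (n+1) = th n := by
  rw [th_eq, th_eq, Nat.primesLE_succ, if_neg h]

theorem card_succ_prime {n : ℕ} (h : (n+1).Prime) :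
    (Nat.primesLE (n+1)).card = (Nat.primesLE n).card + 1 := by
  rw [Nat.primesLE_succ, if_pos h, Finset.card_insert_of_notMem (Nat.notMem_primesLE n)]

theorem card_succ_not {n : ℕ} (h : ¬ (n+1).Prime) :
    (Nat.primesLE (n+1)).card = (Nat.primesLE n).card := by
  rw [Nat.primesLE_succ, if_neg h]

theorem dvd_choose_carry {p N k : ℕ} (hp : p.Prime) (hk : k ≤ N) (h : p ≤ k % p + (N - k) % p) :
    p ∣ N.choose k := by
  have h1 := Nat.factorization_choose (b := Nat.log p N + 2) hp hk (by omega)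
  have h2 : 1 ∈ {i ∈ Finset.Ico 1 (Nat.log p N + 2) | p ^ i ≤ k % p ^ i + (N - k) % p ^ i} := by
    simp [h]
  have h3 := Finset.card_pos.2 ⟨1, h2⟩
  rw [← h1] at h3
  exact Nat.dvd_of_factorization_pos h3.ne'

theorem dvd_mult {p n : ℕ} (hp : p.Prime) (h1 : n < p) (h2 : p ≤ 6 * n) :
    p ∣ (6*n).choose (3*n) * (3*n).choose n := by
  have key : p ≤ (3*n) % p + (6*n-3*n) % p ∨ p ≤ n % p + (3*n - n) % p := by
    have e1 : 6*n-3*n = 3*n := by omega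
    have e2 : 3*n-n = 2*n := by omega
    rw [e1, e2, Nat.mod_eq_of_lt h1]
    rcases lt_or_ge (3*n) p with h | h
    · rw [Nat.mod_eq_of_lt h]; omega
    rcases lt_or_ge (2*n) p with h' | h'
    · rw [Nat.mod_eq_of_lt h']; omega
    rcases lt_or_ge (3*n) (2*p) with h'' | h''
    · left
      rw [Nat.mod_eq_sub_mod h, Nat.mod_eq_of_lt (by omega)]; omega
    · right
      rw [Nat.mod_eq_sub_mod h', Nat.mod_eq_of_lt (by omega)]; omega
  rcases key with h | h
  · exact Dvd.dvd.mul_right (dvd_choose_carry hp (by omega) h) _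
  · exact Dvd.dvd.mul_left (dvd_choose_carry hp (by omega) h) _

theorem mult_le (n : ℕ) : (6*n).choose (3*n) * (3*n).choose n ≤ 432 ^ n := by
  have h1 : (6*n).choose (3*n) ≤ 64^n := by
    have := Nat.choose_le_two_pow (6*n) (3*n)
    rwa [pow_mul] at this
  have h2 : (3*n).choose n * 4^n ≤ 27^n := by
    have h := add_pow (1:ℕ) 2 (3*n)
    simp only [Nat.cast_id] at h
    have h3 := Finset.single_le_sum (f := fun m => 1 ^ m * 2 ^ (3*n - m) * (3*n).choose m)
      (fun i _ => Nat.zero_le _) (Finset.mem_range.2 (show n < 3*n+1 by omega))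
    rw [← h, pow_mul] at h3
    have e : 3*n-n = 2*n := by omega
    simp only [e, one_pow, one_mul, pow_mul] at h3
    norm_num at h3
    linarith
  have h4 : (6*n).choose (3*n) * (3*n).choose n * 4^n ≤ 432^n * 4^n := by
    calc _ = (6*n).choose (3*n) * ((3*n).choose n * 4^n) := by ring
      _ ≤ 64^n * 27^n := Nat.mul_le_mul h1 h2
      _ = _ := by rw [← mul_pow, ← mul_pow]; norm_num
  exact Nat.le_of_mul_le_mul_right h4 (by positivity)

theorem th_six (n : ℕ) : th (6*n) ≤ th n + n * log 432 := by
  have hsub : Nat.primesLE n ⊆ Nat.primesLE (6*n) := Nat.primesLE_mono (by omega)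
  rw [th_eq, th_eq, ← Finset.sum_sdiff hsub, add_comm]
  gcongr
  have hmem : ∀ p ∈ Nat.primesLE (6*n) \ Nat.primesLE n, p.Prime ∧ n < p ∧ p ≤ 6*n := by
    intro p hp
    simp only [Finset.mem_sdiff, Nat.mem_primesLE] at hp
    refine ⟨hp.1.2, ?_, hp.1.1⟩
    by_contra hh
    exact hp.2 ⟨by omega, hp.1.2⟩
  have hd : ∏ p ∈ Nat.primesLE (6*n) \ Nat.primesLE n, p ∣ (6*n).choose (3*n) * (3*n).choose n :=
    Finset.prod_primes_dvd _ (fun p hp => (hmem p hp).1.prime)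
      (fun p hp => dvd_mult (hmem p hp).1 (hmem p hp).2.1 (hmem p hp).2.2)
  have hpos : 0 < (6*n).choose (3*n) * (3*n).choose n :=
    Nat.mul_pos (Nat.choose_pos (by omega)) (Nat.choose_pos (by omega))
  have hle := (Nat.le_of_dvd hpos hd).trans (mult_le n)
  rw [← Real.log_prod (fun p hp => by exact_mod_cast (hmem p hp).1.ne_zero), ← Real.log_pow]
  apply Real.log_le_log
  · apply Finset.prod_pos
    intro p hp
    exact_mod_cast (hmem p hp).1.pos
  · have h5 : ((∏ p ∈ Nat.primesLE (6*n) \ Nat.primesLE n, p : ℕ) : ℝ) ≤ ((432 ^ n : ℕ) : ℝ) :=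
      Nat.cast_le.2 hle
    push_cast at h5
    exact h5

theorem omega_aux {S : Finset ℕ} (hS : ∀ p ∈ S, p.Prime) (x : ℕ) (hx : (Nat.primesLE x).card = S.card) :
    th x ≤ ∑ p ∈ S, log (p:ℝ) := by
  rw [th_eq, ← Finset.sum_sdiff_le_sum_sdiff]
  have hc : (Nat.primesLE x \ S).card = (S \ Nat.primesLE x).card := Finset.card_sdiff_comm hx
  calc ∑ p ∈ Nat.primesLE x \ S, log (p:ℝ) ≤ (Nat.primesLE x \ S).card • log (x:ℝ) := by
        apply Finset.sum_le_card_nsmul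
        intro p hp
        simp only [Finset.mem_sdiff, Nat.mem_primesLE] at hp
        exact Real.log_le_log (by exact_mod_cast hp.1.2.pos) (by exact_mod_cast hp.1.1)
    _ = (S \ Nat.primesLE x).card • log (x:ℝ) := by rw [hc]
    _ ≤ _ := by
        apply Finset.card_nsmul_le_sum
        intro p hp
        simp only [Finset.mem_sdiff, Nat.mem_primesLE] at hp
        have : x < p := by
          by_contra hh
          exact hp.2 ⟨by omega, hS p hp.1⟩
        rcases Nat.eq_zero_or_pos x with rfl | h0
        · simpa using Real.log_natCast_nonneg p
        · exact Real.log_le_log (by exact_mod_cast h0) (by exact_mod_cast this.le)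

theorem exists_count (k : ℕ) (hk : 0 < k) : ∃ x, (Nat.primesLE x).card = k := by
  refine ⟨Nat.nth Nat.Prime (k-1), ?_⟩
  rw [Nat.primesLE_card_eq_primeCounting, Nat.primeCounting, Nat.primeCounting', Nat.count_succ]
  have := Nat.primeCounting'_nth_eq (k-1)
  rw [Nat.primeCounting'] at this
  rw [this, if_pos (Nat.prime_nth_prime _)]
  omega

noncomputable def ff (t : ℝ) : ℝ := t / log t + 1.45743 * t / (log t) ^ 2

theorem ff_hasDeriv {t : ℝ} (ht : 1 < t) :
    HasDerivAt ff (((log t)^2 + 0.45743 * log t - 2.91486) / (log t)^3) t := by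
  have hL : 0 < log t := Real.log_pos ht
  have h0 : t ≠ 0 := by positivity
  have h1 := Real.hasDerivAt_log h0
  have h2 := ((hasDerivAt_id t).div h1 hL.ne').add
    (((hasDerivAt_id t).const_mul (1.45743:ℝ)).div (h1.pow 2) (pow_ne_zero 2 hL.ne'))
  refine HasDerivAt.congr_deriv (f := ff) h2 ?_
  simp
  field_simp
  norm_num
  ring

theorem ff_step {a b D : ℝ} (ha : 1 < a) (hab : a ≤ b)
    (h : ∀ t, a ≤ t → t ≤ b → D * (log t)^3 ≤ (log t)^2 + 0.45743 * log t - 2.91486) :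
    D * (b - a) ≤ ff b - ff a := by
  have hd : ∀ t ∈ Set.Icc a b, HasDerivAt ff (((log t)^2 + 0.45743 * log t - 2.91486) / (log t)^3) t :=
    fun t ht => ff_hasDeriv (ha.trans_le ht.1)
  refine (convex_Icc a b).mul_sub_le_image_sub_of_le_deriv
    (fun t ht => (hd t ht).continuousAt.continuousWithinAt)
    (fun t ht => (hd t (interior_subset ht)).differentiableAt.differentiableWithinAt)
    ?_ a ⟨le_rfl, hab⟩ b ⟨hab, le_rfl⟩ hab
  intro t ht
  have ht' := interior_subset ht
  rw [(hd t ht').deriv, le_div_iff₀]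
  · exact h t ht'.1 ht'.2
  · exact pow_pos (Real.log_pos (ha.trans_le ht'.1)) 3

theorem ff_mono {a b : ℝ} (ha : 5 ≤ a) (hab : a ≤ b) : ff a ≤ ff b := by
  have := ff_step (a := a) (b := b) (D := 0) (by linarith) hab ?_
  · linarith
  intro t h1 h2
  have h3 : (1.5 : ℝ) ≤ log t := by
    rw [Real.le_log_iff_exp_le (by linarith)]
    have h4 : exp 1.5 ^ 2 ≤ 5 ^ 2 := by
      rw [← Real.exp_nat_mul]
      have : ((2:ℕ):ℝ) * 1.5 = (3:ℕ) * 1 := by norm_num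
      rw [this, Real.exp_nat_mul]
      have := Real.exp_one_lt_d9
      calc exp 1 ^ 3 ≤ 2.7182818286 ^ 3 := by gcongr
        _ ≤ _ := by norm_num
    have := abs_le_of_sq_le_sq h4 (by norm_num)
    linarith [le_abs_self (exp 1.5)]
  nlinarith

theorem ff_five {t : ℝ} (ht : 1 < t) : 5 ≤ ff t := by
  have hM := Real.log_pos ht
  have h := Real.exp_log (show 0 < t by linarith)
  unfold ff
  set M := log t
  have e : 1 + M + M^2/2 + M^3/6 ≤ t := by
    rw [← h]
    have := Real.sum_le_exp_of_nonneg hM.le 4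
    simp [Finset.sum_range_succ, Nat.factorial] at this
    linarith
  rw [div_add_div _ _ hM.ne' (by positivity), le_div_iff₀ (by positivity)]
  have : 5 * M^2 ≤ t * (M + 1.45743) := by
    refine le_trans ?_ (mul_le_mul_of_nonneg_right e (by positivity))
    nlinarith [sq_nonneg (M-1), sq_nonneg (M-2), sq_nonneg (M^2-2*M), sq_nonneg (M^2-3), mul_pos hM hM, mul_nonneg hM.le (sq_nonneg (M-1.7)),sq_nonneg (M-1.7)]
  nlinarith [mul_le_mul_of_nonneg_right this hM.le]

/-- one step of the induction -/
theorem ff_prime_step {a p C l M0 : ℝ} (hp : 2 ≤ p) (hC : C ≤ exp l) (hl0 : 0 ≤ l) (hl : l < 0.45743)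
    (hM0 : 1 ≤ M0) (hM : 2.91486 + 0.45743 * l ≤ (0.45743 - l) * M0)
    (ha : exp M0 ≤ a) (hb : a + log p ≤ C * p) : ff a + 1 ≤ ff (a + log p) := by
  have hL : 0 < log p := Real.log_pos (by linarith)
  have ha1 : 1 < a := lt_of_lt_of_le (by linarith [Real.add_one_le_exp M0]) ha
  have := ff_step (a := a) (b := a + log p) (D := 1 / log p) ha1 (by linarith) ?_
  · have h2 : 1 / log p * (a + log p - a) = 1 := by field_simp; ring
    linarith
  intro t h1 h2
  have ht : M0 ≤ log t := (Real.le_log_iff_exp_le (by linarith)).2 (ha.trans h1)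
  have ht2 : log t ≤ l + log p := by
    have : t ≤ exp l * p := h2.trans (hb.trans (mul_le_mul_of_nonneg_right hC (by linarith)))
    calc log t ≤ log (exp l * p) := Real.log_le_log (by linarith) this
      _ = _ := by rw [Real.log_mul (Real.exp_pos _).ne' (by linarith), Real.log_exp]
  set M := log t
  rw [div_mul_eq_mul_div, one_mul, div_le_iff₀ hL]
  have e1 : 2.91486 + 0.45743 * l ≤ (0.45743 - l) * M := hM.trans (by
    apply mul_le_mul_of_nonneg_left ht; linarith)
  have e2 : 0 ≤ M ^ 2 + 0.45743 * M - 2.91486 := by nlinarith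
  have e3 := mul_le_mul_of_nonneg_left (show M - l ≤ log p by linarith) e2
  have e4 := mul_le_mul_of_nonneg_left e1 (show 0 ≤ M by linarith)
  nlinarith

def force {α : Type} (x : ℕ) (f : ℕ → α) : α := Nat.rec (f 0) (fun n _ => f (Nat.succ n)) x

theorem force_eq {α : Type} (x : ℕ) (f : ℕ → α) : force x f = f x := by
  cases x <;> rfl

/-- fast integer logarithm in base two (only used as an oracle) -/
def lg : ℕ → ℕ → ℕ
  | 0, _ => 0
  | d+1, n => force n fun n => force (Nat.pow 2 (Nat.pow 2 d)) fun P =>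
     bif Nat.ble P n then Nat.add (Nat.pow 2 d) (lg d (Nat.div n P)) else lg d n

def goodB (d q r k N : ℕ) : Bool :=
  force (Nat.pow N q) fun X => force (lg d X) fun b =>
  force (Nat.div (Nat.mul (Nat.mul b 6931471803) 65536) (Nat.mul q 10000000000)) fun A =>
  force (Nat.pow A r) fun Y => force (Nat.succ (lg d Y)) fun l =>
  force (Nat.mul (Nat.sub l (Nat.mul 16 r)) 6931471808) fun B =>
  force (Nat.mul 10000000000 r) fun R =>
  Nat.ble (Nat.pow 2 b) X && (Nat.ble Y (Nat.pow 2 l) && (Nat.ble 327680 A &&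
    (Nat.ble (Nat.succ (Nat.mul 16 r)) l &&
    Nat.ble (Nat.mul (Nat.mul (Nat.mul k B) B) 6553600000)
     (Nat.mul (Nat.mul A R) (Nat.add (Nat.mul B 100000) (Nat.mul 145743 R))))))

theorem good_aux {q r k N b A l B : ℕ} (hq : 0 < q) (hr : 0 < r) (hN : 0 < N)
    (h1 : 2 ^ b ≤ N ^ q) (hA : A * (q * 10000000000) ≤ b * 6931471803 * 65536)
    (h2 : A ^ r ≤ 2 ^ l) (h3 : 327680 ≤ A) (h4 : 16 * r + 1 ≤ l)
    (hB : B = (l - 16 * r) * 6931471808)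
    (h5 : k * B * B * 6553600000 ≤
      A * (10000000000 * r) * (B * 100000 + 145743 * (10000000000 * r))) :
    (k : ℝ) ≤ ff (log N) := by
  have hq' : (0:ℝ) < q := by exact_mod_cast hq
  have hr' : (0:ℝ) < r := by exact_mod_cast hr
  have hA' : (327680:ℝ) ≤ A := by exact_mod_cast h3
  have l1 := Real.log_two_gt_d9
  have l2 := Real.log_two_lt_d9
  have g1 : (b:ℝ) * log 2 ≤ q * log N := by
    rw [← Real.log_pow, ← Real.log_pow]
    exact Real.log_le_log (by positivity) (by exact_mod_cast h1)
  have gA : (A:ℝ) * (q * 10000000000) ≤ b * 6931471803 * 65536 := by exact_mod_cast hA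
  have g2 : (A:ℝ) / 65536 ≤ log N := by
    rw [div_le_iff₀ (by norm_num)]
    have : (b:ℝ) * 0.6931471803 ≤ q * log N :=
      le_trans (mul_le_mul_of_nonneg_left l1.le (by positivity)) g1
    have : (q:ℝ) * A ≤ q * (log N * 65536) := by linarith
    exact le_of_mul_le_mul_left this hq'
  refine le_trans ?_ (ff_mono (a := (A:ℝ)/65536) (by linarith) g2)
  have g3 : (r:ℝ) * log A ≤ l * log 2 := by
    rw [← Real.log_pow, ← Real.log_pow]
    exact Real.log_le_log (by positivity) (by exact_mod_cast h2)
  have g4 : log ((A:ℝ)/65536) = log A - 16 * log 2 := by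
    rw [Real.log_div (by positivity) (by norm_num)]
    have : (65536:ℝ) = 2 ^ 16 := by norm_num
    rw [this, Real.log_pow]; norm_num
  have gB : (B:ℝ) = (l - 16 * r) * 6931471808 := by
    rw [hB]; push_cast [Nat.cast_sub (show 16 * r ≤ l by omega)]; ring
  have gl : (16:ℝ) * r + 1 ≤ l := by exact_mod_cast h4
  have g5 : log ((A:ℝ)/65536) * (10000000000 * r) ≤ B := by
    rw [g4, gB]
    nlinarith [mul_le_mul_of_nonneg_left l2.le (show (0:ℝ) ≤ l - 16 * r by linarith)]
  have hM : 0 < log ((A:ℝ)/65536) := Real.log_pos (by linarith)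
  have hBpos : (0:ℝ) < B := by rw [gB]; apply mul_pos <;> linarith
  set R : ℝ := 10000000000 * r with hR
  have hRpos : 0 < R := by positivity
  have g6 : log ((A:ℝ)/65536) ≤ B / R := by rwa [le_div_iff₀ hRpos]
  have h5' : (k:ℝ) * B * B * 6553600000 ≤ A * R * (B * 100000 + 145743 * R) := by
    rw [hR]; exact_mod_cast h5
  unfold ff
  calc (k:ℝ) ≤ (A/65536) / (B/R) + 1.45743 * (A/65536) / (B/R)^2 := by
        have e : (A/65536:ℝ) / (B/R) + 1.45743 * (A/65536) / (B/R)^2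
          = (A * R * (B * 100000 + 145743 * R)) / (B * B * 6553600000) := by
          field_simp
          ring
        rw [e, le_div_iff₀ (by positivity)]
        linarith
    _ ≤ _ := by gcongr

theorem goodB_sound {d q r k N : ℕ} (hq : 0 < q) (hr : 0 < r) (hN : 0 < N)
    (h : goodB d q r k N = true) : (k : ℝ) ≤ ff (log N) := by
  simp only [goodB, force_eq, Bool.and_eq_true, Nat.ble_eq, Nat.mul_eq, Nat.pow_eq, Nat.add_eq,
    Nat.sub_eq, Nat.succ_eq_add_one] at h
  obtain ⟨h1, h2, h3, h4, h5⟩ := h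
  exact good_aux hq hr hN h1 (Nat.div_mul_le_self _ _) h2 h3 h4 rfl h5

def chkB (fin : ℕ → ℕ → Bool) (F : ℕ) : ℕ → ℕ → ℕ → ℕ → Bool
  | 0, _, k, N => fin k N
  | f+1, n, k, N =>
    force (Nat.succ n) fun n =>
    bif Nat.beq (Nat.gcd n F) 1 then
      force (Nat.mul N n) fun N => force (Nat.succ k) fun k =>
      (goodB 14 4 256 k N || (goodB 17 64 4096 k N || goodB 21 4096 65536 k N)) && chkB fin F f n k N
    else chkB fin F f n k N

theorem prime_crit {n D : ℕ} (hn : 1 < n) (h1 : D < n) (h2 : n < (D+1)^2) :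
    Nat.gcd n D.factorial = 1 ↔ n.Prime := by
  have := Nat.coprime_factorial_iff (m := n) (n := D) (by omega)
  rw [Nat.Coprime] at this
  rw [this]
  constructor
  · intro h
    by_contra hp
    have h3 := Nat.minFac_sq_le_self (by omega) hp
    have h4 : (D+1)^2 ≤ n.minFac^2 := Nat.pow_le_pow_left h 2
    omega
  · intro h
    rw [h.minFac_eq]; exact h1

theorem chkB_sound (fin : ℕ → ℕ → Bool) (F D : ℕ) (hF : F = D.factorial) :
    ∀ f n k N : ℕ, 1 ≤ n → D ≤ n → n + f < (D+1)^2 → chkB fin F f n k N = true →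
      (Nat.primesLE n).card = k → th n = log N → 0 < N →
      ((Nat.primesLE n).card : ℝ) ≤ ff (th n) →
      (∀ m, n ≤ m → m ≤ n + f → ((Nat.primesLE m).card : ℝ) ≤ ff (th m)) ∧
      ∃ k' N' : ℕ, (Nat.primesLE (n+f)).card = k' ∧ th (n+f) = log N' ∧ 0 < N' ∧ fin k' N' = true := by
  intro f
  induction f with
  | zero =>
    intro n k N h1 hD h2 hc hk hN hpos hg
    refine ⟨fun m _ _ => ?_, k, N, hk, hN, hpos, hc⟩
    have : m = n := by omega
    rw [this]; exact hg
  | succ f ih =>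
    intro n k N h1 hD h2 hc hk hN hpos hg
    simp only [chkB, force_eq, Nat.succ_eq_add_one, Nat.mul_eq] at hc
    have hcr := prime_crit (n := n+1) (D := D) (by omega) (by omega) (by omega)
    rw [← hF] at hcr
    have fin' : ∀ k N : ℕ, chkB fin F f (n+1) k N = true → (Nat.primesLE (n+1)).card = k →
        th (n+1) = log N → 0 < N → ((Nat.primesLE (n+1)).card : ℝ) ≤ ff (th (n+1)) →
        (∀ m, n ≤ m → m ≤ n + (f+1) → ((Nat.primesLE m).card : ℝ) ≤ ff (th m)) ∧
      ∃ k' N' : ℕ, (Nat.primesLE (n+(f+1))).card = k' ∧ th (n+(f+1)) = log N' ∧ 0 < N' ∧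
        fin k' N' = true := by
      intro k' N' a1 a2 a3 a4 a5
      have := ih (n+1) k' N' (by omega) (by omega) (by omega) a1 a2 a3 a4 a5
      rw [show n + 1 + f = n + (f+1) by ring] at this
      refine ⟨fun m hm1 hm2 => ?_, this.2⟩
      rcases Nat.eq_or_lt_of_le hm1 with h | h
      · rw [← h]; exact hg
      · exact this.1 m h hm2
    by_cases hp : (n+1).Prime
    · rw [hcr.2 hp] at hc
      have e : Nat.beq 1 1 = true := rfl
      rw [e] at hc
      simp only [cond_true, Bool.and_eq_true, Bool.or_eq_true] at hc
      have hlog : th (n+1) = log ((N * (n+1) : ℕ) : ℝ) := by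
        rw [th_succ_prime hp, hN, Nat.cast_mul, Real.log_mul (by positivity) (by positivity)]
      have hpos' : 0 < N * (n+1) := by positivity
      have hk' : (Nat.primesLE (n+1)).card = k + 1 := by rw [card_succ_prime hp, hk]
      refine fin' _ _ hc.2 hk' hlog hpos' ?_
      rw [hk', hlog]
      rcases hc.1 with h | h | h
      · exact goodB_sound (by norm_num) (by norm_num) hpos' h
      · exact goodB_sound (by norm_num) (by norm_num) hpos' h
      · exact goodB_sound (by norm_num) (by norm_num) hpos' h
    · have hb : Nat.beq (Nat.gcd (n+1) F) 1 = false := by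
        rw [Bool.eq_false_iff]
        intro h
        exact hp (hcr.1 (Nat.eq_of_beq_eq_true h))
      rw [hb, cond_false] at hc
      refine fin' _ _ hc (by rw [card_succ_not hp, hk]) (by rw [th_succ_not hp, hN]) hpos ?_
      rw [card_succ_not hp, th_succ_not hp]; exact hg

theorem chkB_one : chkB (fun k N => Nat.beq k 25 && Nat.beq N 2305567963945518424753102147331756070)
    3628800 87 13 6 30030 = true := by decide +kernel

theorem chkB_two : chkB (fun _ N => Nat.ble (Nat.pow 2 1934) N)
    815915283247897734345611269596115894272000000000 1400 100 25
    2305567963945518424753102147331756070 = true := by decide +kernel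

theorem primesLE_13 : Nat.primesLE 13 = {2, 3, 5, 7, 11, 13} := by decide

theorem base_range : (∀ m, 13 ≤ m → m ≤ 1500 → ((Nat.primesLE m).card : ℝ) ≤ ff (th m)) ∧
    1340 ≤ th 1500 := by
  have c13 : (Nat.primesLE 13).card = 6 := by rw [primesLE_13]; rfl
  have t13 : th 13 = log ((30030 : ℕ) : ℝ) := by
    rw [th_eq, primesLE_13, ← Real.log_prod]
    · congr 1; norm_num
    · intro p hp
      simp at hp
      rcases hp with h | h | h | h | h | h <;> rw [h] <;> norm_num
  have g13 : ((6:ℕ) : ℝ) ≤ ff (log ((30030 : ℕ) : ℝ)) :=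
    goodB_sound (d := 14) (q := 4) (r := 256) (by norm_num) (by norm_num) (by norm_num)
      (by decide +kernel)
  obtain ⟨r1, k1, N1, a1, a2, a3, a4⟩ := chkB_sound _ 3628800 10 (by decide) 87 13 6 30030
    (by norm_num) (by norm_num) (by norm_num) chkB_one c13 t13 (by norm_num)
    (by rw [c13, t13]; exact g13)
  simp only [Bool.and_eq_true] at a4
  have e1 := Nat.eq_of_beq_eq_true a4.1
  have e2 := Nat.eq_of_beq_eq_true a4.2
  subst e1
  subst e2
  obtain ⟨r2, k2, N2, b1, b2, b3, b4⟩ := chkB_sound _ _ 40 (by decide +kernel) 1400 100 _ _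
    (by norm_num) (by norm_num) (by norm_num) chkB_two a1 a2 a3 (r1 100 (by norm_num) (by norm_num))
  constructor
  · intro m h1 h2
    rcases le_total m 100 with h | h
    · exact r1 m h1 (by omega)
    · exact r2 m h (by omega)
  · have h6 : 2 ^ 1934 ≤ N2 := Nat.le_of_ble_eq_true b4
    have h7 : (1934:ℕ) * log 2 ≤ log N2 := by
      rw [← Real.log_pow]
      exact Real.log_le_log (by positivity) (by exact_mod_cast h6)
    have l1 := Real.log_two_gt_d9
    have b2' : th 1500 = log N2 := b2
    rw [b2']
    push_cast at h7
    linarith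

def blk (F : ℕ) : ℕ → ℕ → ℕ
  | 0, a => Nat.mul (bif Nat.beq (Nat.gcd (Nat.add a 1) F) 1 then Nat.add a 1 else 1)
      (bif Nat.beq (Nat.gcd (Nat.add a 5) F) 1 then Nat.add a 5 else 1)
  | d+1, a => Nat.mul (blk F d a) (blk F d (Nat.add a (Nat.mul 6 (Nat.pow 2 d))))

def chkU (F : ℕ) : ℕ → ℕ → ℕ → Bool
  | 0, _, _ => true
  | f+1, a, T =>
    force a fun a => force (Nat.pow (blk F 3 a) 16) fun X => force (Nat.succ (lg 12 X)) fun t =>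
    force (Nat.add T t) fun T' =>
    Nat.ble X (Nat.pow 2 t) &&
    ((Nat.ble (Nat.mul T' 693147180800) (Nat.mul 16800000000000 a) || Nat.ble a 1450) &&
      chkU F f (Nat.add a 48) T')

theorem th_one_step {F n : ℕ} (hF : (n+1).Prime → Nat.gcd (n+1) F = 1) :
    th (n+1) ≤ th n + log ((bif Nat.beq (Nat.gcd (n+1) F) 1 then n+1 else 1 : ℕ) : ℝ) := by
  by_cases hp : (n+1).Prime
  · rw [hF hp, th_succ_prime hp]
    exact le_rfl
  · rw [th_succ_not hp]
    exact le_add_of_nonneg_right (Real.log_natCast_nonneg _)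

theorem bif_pos {c : Bool} {n : ℕ} : 0 < (bif c then n+1 else 1) := by
  cases c <;> simp

theorem blk_sound {F : ℕ} (hF : ∀ p : ℕ, p.Prime → 246 < p → Nat.gcd p F = 1) :
    ∀ d a : ℕ, 6 ∣ a → 246 ≤ a → 0 < blk F d a ∧ th (a + 6 * 2^d) ≤ th a + log (blk F d a : ℝ) := by
  intro d
  induction d with
  | zero =>
    intro a h6 ha
    have e1 := th_one_step (F := F) (n := a) (fun hp => hF _ hp (by omega))
    have e5 := th_one_step (F := F) (n := a+4) (fun hp => hF _ hp (by omega))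
    have two : ∀ i, 2 ∣ i → 2 < i → ¬ i.Prime := fun i h1 h2 hp => by
      rcases (Nat.dvd_prime hp).1 h1 with h | h <;> omega
    have three : ∀ i, 3 ∣ i → 3 < i → ¬ i.Prime := fun i h1 h2 hp => by
      rcases (Nat.dvd_prime hp).1 h1 with h | h <;> omega
    have n2 : th (a+2) = th (a+1) := th_succ_not (two _ (by omega) (by omega))
    have n3 : th (a+3) = th (a+2) := th_succ_not (three _ (by omega) (by omega))
    have n4 : th (a+4) = th (a+3) := th_succ_not (two _ (by omega) (by omega))
    have n6 : th (a+6) = th (a+5) := th_succ_not (two _ (by omega) (by omega))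
    have p1 := bif_pos (c := Nat.beq (Nat.gcd (a+1) F) 1) (n := a)
    have p5 := bif_pos (c := Nat.beq (Nat.gcd (a+5) F) 1) (n := a+4)
    simp only [blk, Nat.mul_eq, Nat.add_eq]
    refine ⟨Nat.mul_pos p1 p5, ?_⟩
    rw [Nat.cast_mul, Real.log_mul (by exact_mod_cast p1.ne') (by exact_mod_cast p5.ne')]
    norm_num only at e5 ⊢
    simp only [add_assoc] at e5 ⊢
    norm_num only at e5 ⊢
    linarith
  | succ d ih =>
    intro a h6 ha
    obtain ⟨p1, q1⟩ := ih a h6 ha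
    obtain ⟨p2, q2⟩ := ih (a + 6 * 2^d) (by omega) (by omega)
    simp only [blk, Nat.mul_eq, Nat.add_eq, Nat.pow_eq]
    refine ⟨Nat.mul_pos p1 p2, ?_⟩
    rw [Nat.cast_mul, Real.log_mul (by exact_mod_cast p1.ne') (by exact_mod_cast p2.ne')]
    rw [show a + 6 * 2^(d+1) = a + 6 * 2^d + 6*2^d by ring]
    linarith

theorem chkU_sound {F : ℕ} (hF : ∀ p : ℕ, p.Prime → 246 < p → Nat.gcd p F = 1) :
    ∀ f a T : ℕ, 6 ∣ a → 246 ≤ a → chkU F f a T = true → 16 * th a ≤ T * log 2 →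
    ∀ x, 1500 ≤ x → a < x → x ≤ a + 48 * f → th x ≤ 1.05 * x := by
  intro f
  induction f with
  | zero => intro a T _ _ _ _ x _ _ _; omega
  | succ f ih =>
    intro a T h6 ha hc hT x hx h1 h2
    simp only [chkU, force_eq, Bool.and_eq_true, Bool.or_eq_true, Nat.ble_eq, Nat.mul_eq, Nat.pow_eq,
      Nat.add_eq, Nat.succ_eq_add_one] at hc
    obtain ⟨c1, c2, c3⟩ := hc
    generalize lg 12 (blk F 3 a ^ 16) + 1 = t at c1 c2 c3
    obtain ⟨p1, q1⟩ := blk_sound hF 3 a h6 ha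
    have q1' : th (a + 48) ≤ th a + log (blk F 3 a : ℝ) := q1
    have g : (16:ℕ) * log (blk F 3 a : ℝ) ≤ t * log 2 := by
      rw [← Real.log_pow, ← Real.log_pow]
      exact Real.log_le_log (by positivity) (by exact_mod_cast c1)
    have hT' : 16 * th (a+48) ≤ ((T + t : ℕ) : ℝ) * log 2 := by
      push_cast at g ⊢
      linarith
    rcases Nat.lt_or_ge (a+48) x with h | h
    · exact ih (a+48) (T+t) (by omega) (by omega) c3 hT' x hx h (by omega)
    · have c4 : (T + t) * 693147180800 ≤ 16800000000000 * a := by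
        rcases c2 with c | c
        · exact c
        · omega
      have c5 : ((T + t : ℕ) : ℝ) * 693147180800 ≤ 16800000000000 * a := by exact_mod_cast c4
      have l2 := Real.log_two_lt_d9
      have c6 := mul_le_mul_of_nonneg_left l2.le (Nat.cast_nonneg (α := ℝ) (T+t))
      have c7 := th_mono h
      have c8 : (a:ℝ) ≤ x := by exact_mod_cast h1.le
      linarith

def FF : ℕ := 256041159035492609053110100510385311995538591998443060216114576417920917800321526504084465112487730

theorem chkU_ok : chkU 256041159035492609053110100510385311995538591998443060216114576417920917800321526504084465112487730
    1287 246 5234 = true := by decide +kernel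

theorem FF_dvd : Nat.beq (Nat.mod (Nat.factorial 246) FF) 0 = true := by decide +kernel

theorem FF_small : ∀ p < 247, p < 2 ∨ p ∣ FF ∨ ∃ d < p, 2 ≤ d ∧ d ∣ p := by decide +kernel

theorem dvd_of_beq_mod {a b : ℕ} (h : Nat.beq (Nat.mod a b) 0 = true) : b ∣ a :=
  Nat.dvd_of_mod_eq_zero (Nat.eq_of_beq_eq_true h)

theorem pow_le_of_ble {a b c d : ℕ} (h : Nat.ble (Nat.pow a b) (Nat.pow c d) = true) :
    a ^ b ≤ c ^ d := Nat.le_of_ble_eq_true h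

theorem th_mid {x : ℕ} (h1 : 1500 ≤ x) (h2 : x ≤ 62000) : th x ≤ 1.05 * x := by
  have hF : ∀ p : ℕ, p.Prime → 246 < p → Nat.gcd p FF = 1 := by
    intro p hp h
    have hd : FF ∣ Nat.factorial 246 := dvd_of_beq_mod FF_dvd
    have h3 : Nat.Coprime p (Nat.factorial 246) := by
      rw [Nat.coprime_factorial_iff hp.one_lt.ne', hp.minFac_eq]; exact h
    exact Nat.Coprime.coprime_dvd_right hd h3
  have h0 : th 246 ≤ log (FF : ℝ) := by
    have hd : ∏ p ∈ Nat.primesLE 246, p ∣ FF := by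
      refine Finset.prod_primes_dvd _ (fun p hp => (Nat.prime_of_mem_primesLE hp).prime) ?_
      intro p hp
      have hp1 := Nat.prime_of_mem_primesLE hp
      have hp2 := Nat.le_of_mem_primesLE hp
      rcases FF_small p (by omega) with h | h | ⟨d, hd1, hd2, hd3⟩
      · have := hp1.two_le; omega
      · exact h
      · rcases (Nat.dvd_prime hp1).1 hd3 with h | h <;> omega
    rw [th_eq, ← Real.log_prod (fun p hp => by exact_mod_cast (Nat.prime_of_mem_primesLE hp).ne_zero)]
    have hle : ((∏ p ∈ Nat.primesLE 246, p : ℕ) : ℝ) ≤ (FF : ℝ) :=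
      Nat.cast_le.2 (Nat.le_of_dvd (by unfold FF; norm_num) hd)
    push_cast at hle
    exact Real.log_le_log (Finset.prod_pos fun p hp => by
      exact_mod_cast (Nat.prime_of_mem_primesLE hp).pos) hle
  have h5 : (16:ℕ) * log (FF:ℝ) ≤ (5234:ℕ) * log 2 := by
    rw [← Real.log_pow, ← Real.log_pow]
    have h6 : Nat.ble (Nat.pow FF 16) (Nat.pow 2 5234) = true := by decide +kernel
    have h7 := pow_le_of_ble h6
    refine Real.log_le_log (pow_pos (by unfold FF; norm_num) 16) ?_
    have h8 : ((FF ^ 16 : ℕ) : ℝ) ≤ ((2 ^ 5234 : ℕ) : ℝ) := Nat.cast_le.2 h7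
    rw [Nat.cast_pow, Nat.cast_pow, Nat.cast_ofNat] at h8
    exact h8
  refine chkU_sound hF 1287 246 5234 (by norm_num) le_rfl chkU_ok ?_ x h1 (by omega) (by omega)
  push_cast at h5 ⊢
  linarith

theorem log432 : log 432 ≤ 6.07 := by
  rw [Real.log_le_iff_le_exp (by norm_num)]
  have h : (432:ℝ)^29 ≤ exp 6.07 ^ 29 := by
    rw [← Real.exp_nat_mul]
    have h1 := Real.exp_one_gt_d9
    calc (432:ℝ)^29 ≤ 2.7182 ^ 176 := by norm_num
      _ ≤ exp 1 ^ 176 := by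
        apply pow_le_pow_left₀ (by norm_num)
        linarith
      _ = exp ((176:ℕ) * 1) := by rw [Real.exp_nat_mul]
      _ ≤ _ := by
        apply Real.exp_le_exp.mpr
        norm_num
  exact le_of_pow_le_pow_left₀ (by norm_num) (Real.exp_pos _).le h

theorem th_ceil (x : ℕ) : th x ≤ th ((x+5)/6) + ((x:ℝ)+5)/6 * 6.07 := by
  have h1 := th_six ((x+5)/6)
  have h2 := th_mono (show x ≤ 6 * ((x+5)/6) by omega)
  have h3 : (6:ℝ) * (((x+5)/6 : ℕ) : ℝ) ≤ x + 5 := by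
    exact_mod_cast (show 6 * ((x+5)/6) ≤ x + 5 by omega)
  have h4 : (((x+5)/6 : ℕ) : ℝ) * log 432 ≤ ((x:ℝ)+5)/6 * 6.07 := by
    apply mul_le_mul _ log432 (Real.log_nonneg (by norm_num)) (by positivity)
    linarith
  linarith

theorem th_two {x : ℕ} (h1 : 62000 < x) (h2 : x ≤ 371000) : th x ≤ 1.187 * x := by
  have h := th_ceil x
  have h' := th_mid (x := (x+5)/6) (by omega) (by omega)
  have h3 : (6:ℝ) * (((x+5)/6 : ℕ) : ℝ) ≤ x + 5 := by
    exact_mod_cast (show 6 * ((x+5)/6) ≤ x + 5 by omega)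
  have h4 : (62000:ℝ) < x := by exact_mod_cast h1
  linarith

theorem th_all (x : ℕ) : 1500 ≤ x → th x ≤ 1.22 * x := by
  induction x using Nat.strong_induction_on with
  | _ x ih =>
    intro h1
    rcases Nat.lt_or_ge 62000 x with h2 | h2
    · have h := th_ceil x
      have h' := ih ((x+5)/6) (by omega) (by omega)
      have h3 : (6:ℝ) * (((x+5)/6 : ℕ) : ℝ) ≤ x + 5 := by
        exact_mod_cast (show 6 * ((x+5)/6) ≤ x + 5 by omega)
      have h4 : (62000:ℝ) < x := by exact_mod_cast h2
      linarith
    · have h := th_mid h1 h2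
      have : (0:ℝ) ≤ x := Nat.cast_nonneg x
      linarith

theorem log_le_two_pow {y : ℝ} {e : ℕ} (hy : 0 < y) (h : y ≤ 2 ^ e) : log y ≤ e * 0.6931471808 := by
  have h1 := Real.log_le_log hy h
  rw [Real.log_pow] at h1
  exact h1.trans (mul_le_mul_of_nonneg_left Real.log_two_lt_d9.le (Nat.cast_nonneg e))

theorem th_lower {n e s : ℕ} (hn : 0 < n) (h : (n:ℝ) + 1 ≤ 2 ^ e) (hs : (n:ℝ) ≤ (s:ℝ)^2) :
    (n:ℝ) * 0.6931471803 - e * 0.6931471808 - 2 * s * (e * 0.6931471808) ≤ th n := by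
  have h0 : (0:ℝ) < n := by exact_mod_cast hn
  have h1 := Chebyshev.theta_ge n
  have h2 := log_le_two_pow (y := (n:ℝ)+1) (by positivity) h
  have h3 := log_le_two_pow (y := (n:ℝ)) h0 (by linarith)
  have h4 : √(n:ℝ) ≤ s := by
    rw [Real.sqrt_le_left (by positivity)]; exact hs
  have h5 : 2 * √(n:ℝ) * log n ≤ 2 * s * (e * 0.6931471808) := by
    apply mul_le_mul _ h3 (Real.log_natCast_nonneg n) (by positivity)
    linarith
  have h6 := mul_le_mul_of_nonneg_left Real.log_two_gt_d9.le h0.le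
  unfold th
  linarith

theorem th_62000 : 37000 ≤ th 62000 := by
  have := th_lower (n := 62000) (e := 16) (s := 249) (by norm_num) (by norm_num) (by norm_num)
  norm_num at this
  linarith

theorem th_371000 : 240000 ≤ th 371000 := by
  have := th_lower (n := 371000) (e := 19) (s := 610) (by norm_num) (by norm_num) (by norm_num)
  norm_num at this
  linarith

theorem exp_le_of_pow {M y : ℝ} (hy : 0 ≤ y) (a b : ℕ) (hb : b ≠ 0) (hM : (b:ℝ) * M = a)
    (h : (2.7182818286:ℝ) ^ a ≤ y ^ b) : exp M ≤ y := by
  refine le_of_pow_le_pow_left₀ hb hy ?_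
  rw [← Real.exp_nat_mul, hM, ← mul_one (a:ℝ), Real.exp_nat_mul]
  exact (pow_le_pow_left₀ (Real.exp_pos 1).le Real.exp_one_lt_d9.le a).trans h

theorem main_range (x : ℕ) (hx : 1500 ≤ x) : ((Nat.primesLE x).card : ℝ) ≤ ff (th x) := by
  induction x, hx using Nat.le_induction with
  | base => exact base_range.1 1500 (by norm_num) le_rfl
  | succ x hx ih =>
    by_cases hp : (x+1).Prime
    · rw [card_succ_prime hp, th_succ_prime hp]
      have hlog := th_succ_prime hp
      have h2 : (2:ℝ) ≤ ((x+1:ℕ):ℝ) := by exact_mod_cast hp.two_le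
      have key : ff (th x) + 1 ≤ ff (th x + log ((x+1:ℕ):ℝ)) := by
        rcases Nat.lt_or_ge 62000 (x+1) with h | h
        · rcases Nat.lt_or_ge 371000 (x+1) with h' | h'
          · refine ff_prime_step (C := 1.22) (l := 0.2) (M0 := 12) h2 ?_ (by norm_num) (by norm_num)
              (by norm_num) (by norm_num) ?_ ?_
            · have := Real.quadratic_le_exp_of_nonneg (x := 0.2) (by norm_num)
              norm_num at this ⊢
              linarith
            · have e := exp_le_of_pow (M := 12) (y := 240000) (by norm_num) 12 1 (by norm_num)
                (by norm_num) (by norm_num)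
              exact e.trans (th_371000.trans (th_mono (by omega)))
            · rw [← hlog]; exact th_all _ (by omega)
          · refine ff_prime_step (C := 1.187) (l := 0.172) (M0 := 10.5) h2 ?_ (by norm_num)
              (by norm_num) (by norm_num) (by norm_num) ?_ ?_
            · have := Real.sum_le_exp_of_nonneg (x := 0.172) (by norm_num) 4
              simp only [Finset.sum_range_succ, Nat.factorial] at this
              norm_num at this ⊢
              linarith
            · have e := exp_le_of_pow (M := 10.5) (y := 37000) (by norm_num) 21 2 (by norm_num)
                (by norm_num) (by norm_num)
              exact e.trans (th_62000.trans (th_mono (by omega)))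
            · rw [← hlog]; exact th_two h h'
        · refine ff_prime_step (C := 1.05) (l := 0.049) (M0 := 7.2) h2 ?_ (by norm_num)
              (by norm_num) (by norm_num) (by norm_num) ?_ ?_
          · have := Real.quadratic_le_exp_of_nonneg (x := 0.049) (by norm_num)
            norm_num at this ⊢
            linarith
          · have e := exp_le_of_pow (M := 7.2) (y := 1340) (by norm_num) 36 5 (by norm_num)
                (by norm_num) (by norm_num)
            exact e.trans (base_range.2.trans (th_mono (by omega)))
          · rw [← hlog]; exact th_mid (by omega) h
      push_cast at key ⊢
      linarith
    · rw [card_succ_not hp, th_succ_not hp]; exact ih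

theorem th_13 : 5 ≤ th 13 := by
  have t13 : th 13 = log 30030 := by
    rw [th_eq, primesLE_13, ← Real.log_prod]
    · congr 1; norm_num
    · intro p hp
      simp at hp
      rcases hp with h | h | h | h | h | h <;> rw [h] <;> norm_num
  rw [t13, Real.le_log_iff_exp_le (by norm_num)]
  exact exp_le_of_pow (by norm_num) 5 1 (by norm_num) (by norm_num) (by norm_num)

theorem card_12 : (Nat.primesLE 12).card = 5 := by decide

/-- Robin: for `n ≥ 3`, `ω(n) ≤ log n / log log n + 1.45743·log n/(log log n)²`. -/
theorem robin_omega_bound (n : ℕ) (hn : 3 ≤ n) :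
    (n.primeFactors.card : ℝ) ≤
      Real.log n / Real.log (Real.log n) +
        1.45743 * Real.log n / (Real.log (Real.log n)) ^ 2 := by
  change (n.primeFactors.card : ℝ) ≤ ff (log n)
  have hn' : (3:ℝ) ≤ n := by exact_mod_cast hn
  rcases Nat.lt_or_ge 5 n.primeFactors.card with hk | hk
  · obtain ⟨x, hx⟩ := exists_count n.primeFactors.card (by omega)
    have hx13 : 13 ≤ x := by
      by_contra hlt
      have := Finset.card_le_card (Nat.primesLE_mono (show x ≤ 12 by omega))
      rw [card_12] at this
      omega
    have h1 := omega_aux (S := n.primeFactors) (fun p hp => Nat.prime_of_mem_primeFactors hp) x hx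
    have h2 : ∑ p ∈ n.primeFactors, log (p:ℝ) ≤ log n := by
      rw [← Real.log_prod (fun p hp => by
        exact_mod_cast (Nat.prime_of_mem_primeFactors hp).ne_zero)]
      have hle : ((∏ p ∈ n.primeFactors, p : ℕ) : ℝ) ≤ (n : ℝ) :=
        Nat.cast_le.2 (Nat.le_of_dvd (by omega) (Nat.prod_primeFactors_dvd n))
      push_cast at hle
      exact Real.log_le_log (Finset.prod_pos fun p hp => by
        exact_mod_cast (Nat.prime_of_mem_primeFactors hp).pos) hle
    have h3 : ((Nat.primesLE x).card : ℝ) ≤ ff (th x) := by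
      rcases le_total x 1500 with h | h
      · exact base_range.1 x hx13 h
      · exact main_range x h
    rw [← hx]
    exact h3.trans (ff_mono (th_13.trans (th_mono hx13)) (h1.trans h2))
  · have h5 : 5 ≤ ff (log n) := by
      apply ff_five
      rw [Real.lt_log_iff_exp_lt (by linarith)]
      linarith [Real.exp_one_lt_d9]
    have : (n.primeFactors.card : ℝ) ≤ 5 := by exact_mod_cast hk
    linarith
end

section
/- Let D ≡ 0 or 1 (mod 4) be a non-square integer (discriminant), d = |D|, and let M ≥ 2 be a positive integer with gcd(D, M) = 1. Then there exists a prime q with 0 < q < 20664·d^(2/3)·M^(1/6) such that the Kronecker symbol (D/q) = −1 and gcd(q, M) = 1. -/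
/-- The Kronecker symbol `(a/q)` at a prime `q`. -/
def kroneckerPrime (a : ℤ) (q : ℕ) : ℤ :=
  if q = 2 then (if a % 2 = 0 then 0 else if a % 8 = 1 ∨ a % 8 = 7 then 1 else -1)
  else jacobiSym a q

section Aux

open Finset ZMod


lemma aux_parseval {m : ℕ} [NeZero m] (f : ZMod m → ℂ) :
    ∑ l, ‖dft f l‖ ^ 2 = m * ∑ j, ‖f j‖ ^ 2 := by
  have key : ∑ l, (starRingEnd ℂ) (dft f l) * dft f l
      = m * ∑ j, (starRingEnd ℂ) (f j) * f j := by
    have h1 : ∀ l, (starRingEnd ℂ) (dft f l) * dft f l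
        = ∑ j, (starRingEnd ℂ) (f j) * (stdAddChar (j * l) * dft f l) := by
      intro l
      conv_lhs => rw [dft_apply f l]
      rw [map_sum, Finset.sum_mul]
      rw [← dft_apply f l]
      refine Finset.sum_congr rfl fun j _ => ?_
      rw [smul_eq_mul, map_mul, ← AddChar.map_neg_eq_conj, neg_neg]
      ring
    simp_rw [h1]
    rw [Finset.sum_comm, Finset.mul_sum]
    refine Finset.sum_congr rfl fun j _ => ?_
    rw [← Finset.mul_sum]
    have h2 := congrFun (dft_dft f) (-j)
    rw [dft_apply] at h2
    simp only [neg_neg, smul_eq_mul, mul_neg] at h2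
    have h3 : ∑ l, stdAddChar (j * l) * dft f l = m * f j := by
      rw [← h2]
      refine Finset.sum_congr rfl fun l _ => ?_
      rw [mul_comm j l]
    rw [h3]; ring
  have e : ∀ z : ℂ, (starRingEnd ℂ) z * z = ((‖z‖ ^ 2 : ℝ) : ℂ) := by
    intro z
    rw [Complex.conj_mul']; push_cast; rfl
  simp_rw [e] at key
  exact_mod_cast key

lemma aux_bilinear {m : ℕ} [NeZero m] (g : ZMod m → ℂ) (K : ℝ) (hK : ∀ l, ‖dft g l‖ ≤ K)
    (A : Finset (ZMod m)) :
    ‖∑ a ∈ A, ∑ b ∈ A, g (a + b)‖ ≤ K * #A := by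
  have hm : (0 : ℝ) < m := by exact_mod_cast Nat.pos_of_ne_zero (NeZero.ne m)
  let f : ZMod m → ℂ := fun x => if x ∈ A then 1 else 0
  have hf : ∀ l, dft f l = ∑ a ∈ A, stdAddChar (-(a * l)) := by
    intro l
    rw [dft_apply]
    simp [f]
  have hinv : ∀ n, (m : ℂ) * g n = ∑ l, stdAddChar (l * n) * dft g l := by
    intro n
    have h2 := congrFun (dft_dft g) (-n)
    rw [dft_apply] at h2
    simp only [neg_neg, smul_eq_mul, mul_neg] at h2
    exact h2.symm
  have h1 : (m : ℂ) * ∑ a ∈ A, ∑ b ∈ A, g (a + b) = ∑ l, dft g l * (dft f (-l)) ^ 2 := by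
    simp_rw [Finset.mul_sum, hinv, hf]
    simp_rw [Finset.sum_comm (s := A) (t := (Finset.univ : Finset (ZMod m)))]
    refine Finset.sum_congr rfl fun l _ => ?_
    rw [sq, Finset.sum_mul_sum, Finset.mul_sum]
    refine Finset.sum_congr rfl fun a _ => ?_
    rw [Finset.mul_sum]
    refine Finset.sum_congr rfl fun b _ => ?_
    rw [← AddChar.map_add_eq_mul, mul_comm]
    congr 2
    ring
  have h2 : (m : ℝ) * ‖∑ a ∈ A, ∑ b ∈ A, g (a + b)‖ ≤ m * (K * #A) := by
    have : (m : ℝ) * ‖∑ a ∈ A, ∑ b ∈ A, g (a + b)‖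
        = ‖(m : ℂ) * ∑ a ∈ A, ∑ b ∈ A, g (a + b)‖ := by simp
    rw [this, h1]
    calc _ ≤ ∑ l, ‖dft g l * (dft f (-l)) ^ 2‖ := norm_sum_le _ _
      _ ≤ ∑ l, K * ‖dft f (-l)‖ ^ 2 := by
          refine Finset.sum_le_sum fun l _ => ?_
          rw [norm_mul, norm_pow]
          exact mul_le_mul_of_nonneg_right (hK l) (by positivity)
      _ = K * ∑ l, ‖dft f l‖ ^ 2 := by
          rw [← Finset.mul_sum]
          congr 1
          exact Fintype.sum_equiv (Equiv.neg _) _ _ (fun x => by simp)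
      _ = m * (K * #A) := by
          rw [aux_parseval]
          have : ∑ j, ‖f j‖ ^ 2 = (#A : ℝ) := by
            have : ∀ j, ‖f j‖ ^ 2 = if j ∈ A then (1 : ℝ) else 0 := by
              intro j; simp only [f]; split_ifs <;> simp
            simp [this]
          rw [this]; ring
  exact le_of_mul_le_mul_left h2 hm

lemma aux_sum_univ {m : ℕ} [NeZero m] (f : ZMod m → ℂ) :
    ∑ x, f x = ∑ n ∈ range m, f (n : ZMod m) := by
  symm
  refine Finset.sum_bij' (fun n _ => (n : ZMod m)) (fun x _ => x.val) ?_ ?_ ?_ ?_ ?_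
  · simp
  · intro x _; simpa using ZMod.val_lt x
  · intro n hn; exact ZMod.val_cast_of_lt (by simpa using hn)
  · intro x _; simp
  · intros; rfl

lemma aux_periodic {m : ℕ} [NeZero m] (f : ZMod m → ℂ) (h0 : ∑ x, f x = 0) (N : ℕ) :
    ∑ n ∈ range N, f (n : ZMod m) = ∑ n ∈ range (N % m), f (n : ZMod m) := by
  have h : ∀ q s : ℕ, ∑ n ∈ range (m * q + s), f (n : ZMod m) = ∑ n ∈ range s, f (n : ZMod m) := by
    intro q
    induction q with
    | zero => intro s; simp
    | succ q ih =>
      intro s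
      rw [show m * (q + 1) + s = m + (m * q + s) by ring, Finset.sum_range_add, ← aux_sum_univ, h0,
        zero_add, ← ih s]
      refine Finset.sum_congr rfl fun n _ => ?_
      simp
  conv_lhs => rw [← Nat.div_add_mod N m]
  exact h _ _

lemma aux_double {m : ℕ} [NeZero m] (g : ZMod m → ℂ) (K : ℝ) (hK : ∀ l, ‖dft g l‖ ≤ K)
    (h0 : ∑ x, g x = 0) (N : ℕ) :
    ‖∑ a ∈ range N, ∑ b ∈ range N, g ((a + b : ℕ) : ZMod m)‖ ≤ K * N := by
  have hK0 : 0 ≤ K := (norm_nonneg _).trans (hK 0)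
  have hs : ∀ c : ZMod m, ∑ x, g (c + x) = 0 := by
    intro c
    rw [← h0]
    exact Fintype.sum_equiv (Equiv.addLeft c) _ _ (fun x => by simp)
  have h1 : ∑ a ∈ range N, ∑ b ∈ range N, g ((a + b : ℕ) : ZMod m)
      = ∑ a ∈ range (N % m), ∑ b ∈ range (N % m), g ((a : ZMod m) + (b : ZMod m)) := by
    push_cast
    have := fun a : ℕ => aux_periodic (fun x => g ((a : ZMod m) + x)) (hs a) N
    simp_rw [this]
    refine aux_periodic (fun y => ∑ b ∈ range (N % m), g (y + (b : ZMod m))) ?_ N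
    rw [Finset.sum_comm]
    refine Finset.sum_eq_zero fun b _ => ?_
    rw [← hs b]
    simp_rw [add_comm]
  have hlt : N % m < m := Nat.mod_lt _ (Nat.pos_of_ne_zero (NeZero.ne m))
  have hinj : Set.InjOn (fun n : ℕ => (n : ZMod m)) (range (N % m) : Set ℕ) := by
    intro a ha b hb hab
    have ha' : a < m := by have := Finset.mem_range.1 (Finset.mem_coe.1 ha); omega
    have hb' : b < m := by have := Finset.mem_range.1 (Finset.mem_coe.1 hb); omega
    have := congrArg ZMod.val hab
    simpa [ZMod.val_cast_of_lt ha', ZMod.val_cast_of_lt hb'] using this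
  have h2 := aux_bilinear g K hK ((range (N % m)).image (fun n : ℕ => (n : ZMod m)))
  rw [Finset.card_image_of_injOn hinj, Finset.sum_image hinj] at h2
  simp_rw [Finset.sum_image hinj] at h2
  rw [h1]
  refine h2.trans ?_
  rw [card_range]
  exact mul_le_mul_of_nonneg_left (by exact_mod_cast Nat.mod_le _ _) hK0

lemma aux_gauss {k : ℕ} [NeZero k] (χ : DirichletCharacter ℂ k) (hχ : χ.IsPrimitive)
    (l : ZMod k) : ‖dft χ l‖ ≤ √k := by
  have hle : ∀ x, ‖χ⁻¹ x‖ = ‖χ x‖ := by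
    intro x
    rw [← MulChar.star_eq_inv]; simp
  have hft : ∀ l, dft χ l = χ⁻¹ (-l) * gaussSum χ stdAddChar :=
    fun l => hχ.fourierTransform_eq_inv_mul_gaussSum l
  have hp := aux_parseval (χ : ZMod k → ℂ)
  simp_rw [hft, norm_mul, mul_pow, hle] at hp
  rw [← Finset.sum_mul, Fintype.sum_equiv (Equiv.neg _) (fun x => ‖χ (-x)‖ ^ 2)
    (fun x => ‖χ x‖ ^ 2) (fun x => by simp)] at hp
  have hpos : 0 < ∑ x, ‖χ x‖ ^ 2 :=
    Finset.sum_pos' (fun _ _ => by positivity) ⟨1, Finset.mem_univ _, by simp⟩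
  have hg : ‖gaussSum χ stdAddChar‖ ^ 2 = k := by
    have : (∑ x, ‖χ x‖ ^ 2) * ‖gaussSum χ stdAddChar‖ ^ 2 = (∑ x, ‖χ x‖ ^ 2) * k := by
      rw [hp]; ring
    exact mul_left_cancel₀ hpos.ne' this
  have hg' : ‖gaussSum χ stdAddChar‖ = √k := by
    rw [← hg, Real.sqrt_sq (norm_nonneg _)]
  rw [hft, norm_mul, hg']
  have : ‖χ⁻¹ (-l)‖ ≤ 1 := DirichletCharacter.norm_le_one _ _
  nlinarith [Real.sqrt_nonneg (k : ℝ)]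


lemma aux_mult_sum {e k : ℕ} (he : e ≠ 0) (F : ℕ → ℂ) :
    ∑ n ∈ range (e * k), (if e ∣ n then F n else 0) = ∑ j ∈ range k, F (e * j) := by
  rw [← Finset.sum_filter]
  symm
  refine Finset.sum_bij' (fun j _ => e * j) (fun n _ => n / e) ?_ ?_ ?_ ?_ ?_
  · intro j hj
    simp only [mem_filter, mem_range, dvd_mul_right, and_true] at hj ⊢
    exact Nat.mul_lt_mul_of_pos_left hj (Nat.pos_of_ne_zero he)
  · intro n hn
    simp only [mem_filter, mem_range] at hn ⊢
    exact Nat.div_lt_of_lt_mul hn.1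
  · intro j _
    exact Nat.mul_div_cancel_left j (Nat.pos_of_ne_zero he)
  · intro n hn
    simp only [mem_filter, mem_range] at hn
    exact Nat.mul_div_cancel' hn.2
  · intros; rfl

lemma aux_e {k : ℕ} [NeZero k] (χ : DirichletCharacter ℂ k) (hχ : χ.IsPrimitive) (h1 : χ ≠ 1)
    (e : ℕ) (he : e ≠ 0) (N : ℕ) :
    ‖∑ a ∈ range N, ∑ b ∈ range N, (if e ∣ a + b then χ ((a + b : ℕ) : ZMod k) else 0)‖
      ≤ √k * N := by
  have : NeZero (e * k) := ⟨mul_ne_zero he (NeZero.ne k)⟩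
  let g : ZMod (e * k) → ℂ := fun x => if e ∣ x.val then χ ((x.val : ℕ) : ZMod k) else 0
  have hg : ∀ n : ℕ, g (n : ZMod (e * k)) = if e ∣ n then χ (n : ZMod k) else 0 := by
    intro n
    simp only [g, ZMod.val_natCast]
    have h1 : (e ∣ n % (e * k)) ↔ e ∣ n := Nat.dvd_mod_iff (dvd_mul_right e k)
    have h2 : ((n % (e * k) : ℕ) : ZMod k) = (n : ZMod k) := by
      rw [ZMod.natCast_eq_natCast_iff]
      exact (Nat.mod_modEq n (e * k)).of_mul_left e
    rw [h2]; simp only [h1]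
  have hle : ‖χ (e : ZMod k)‖ ≤ 1 := DirichletCharacter.norm_le_one _ _
  have h0 : ∑ x, g x = 0 := by
    rw [aux_sum_univ]
    simp_rw [hg]
    rw [aux_mult_sum he (fun n => χ (n : ZMod k))]
    simp only [Nat.cast_mul, map_mul]
    rw [← Finset.mul_sum, ← aux_sum_univ (fun x => χ x), MulChar.sum_eq_zero_of_ne_one h1, mul_zero]
  have hK : ∀ l, ‖dft g l‖ ≤ √k := by
    intro l
    rw [dft_apply, aux_sum_univ]
    have : ∀ n : ℕ, stdAddChar (-((n : ZMod (e * k)) * l)) • g (n : ZMod (e * k))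
        = if e ∣ n then stdAddChar (-((n : ZMod (e * k)) * l)) * χ (n : ZMod k) else 0 := by
      intro n
      rw [hg]
      split_ifs <;> simp
    simp_rw [this]
    rw [aux_mult_sum he
      (fun n => stdAddChar (-((n : ZMod (e * k)) * l)) * χ (n : ZMod k))]
    have h3 : ∀ j : ℕ, stdAddChar (-(((e * j : ℕ) : ZMod (e * k)) * l)) * χ ((e * j : ℕ) : ZMod k)
        = χ (e : ZMod k) * (stdAddChar (-((j : ZMod k) * (l.val : ZMod k))) • χ (j : ZMod k)) := by
      intro j
      have h4 : (-(((e * j : ℕ) : ZMod (e * k)) * l)) = ((-(e * j * l.val) : ℤ) : ZMod (e * k)) := by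
        push_cast
        simp
      have h5 : (-((j : ZMod k) * (l.val : ZMod k))) = ((-(j * l.val) : ℤ) : ZMod k) := by
        push_cast; rfl
      have he' : (e : ℂ) ≠ 0 := by exact_mod_cast he
      have hk' : (k : ℂ) ≠ 0 := by exact_mod_cast NeZero.ne k
      have h6 : stdAddChar (-(((e * j : ℕ) : ZMod (e * k)) * l))
          = stdAddChar (-((j : ZMod k) * (l.val : ZMod k))) := by
        rw [h4, h5, ZMod.stdAddChar_coe, ZMod.stdAddChar_coe]
        congr 1
        push_cast
        field_simp
      rw [h6]
      push_cast
      rw [map_mul, smul_eq_mul]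
      ring
    simp_rw [h3]
    rw [← Finset.mul_sum, norm_mul,
      ← aux_sum_univ (fun x => stdAddChar (-(x * (l.val : ZMod k))) • χ x), ← dft_apply]
    have := aux_gauss χ hχ (l.val : ZMod k)
    have h7 := norm_nonneg (dft χ (l.val : ZMod k))
    calc _ ≤ 1 * ‖dft χ (l.val : ZMod k)‖ := mul_le_mul_of_nonneg_right hle h7
      _ ≤ _ := by rw [one_mul]; exact this
  have := aux_double g (√k) hK h0 N
  simp_rw [hg] at this
  exact this

lemma aux_count0 (e : ℕ) (he : e ≠ 0) (M : ℕ) :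
    (M : ℝ) / e ≤ ∑ n ∈ range M, (if e ∣ n then (1 : ℝ) else 0) ∧
    ∑ n ∈ range M, (if e ∣ n then (1 : ℝ) else 0) ≤ M / e + 1 := by
  have he' : (0 : ℝ) < e := by exact_mod_cast Nat.pos_of_ne_zero he
  cases M with
  | zero => simp
  | succ M =>
    rw [Finset.sum_range_succ']
    have h : ∑ n ∈ range M, (if e ∣ n + 1 then (1 : ℝ) else 0) = ((M / e : ℕ) : ℝ) := by
      rw [Finset.sum_boole, Nat.card_multiples]
    rw [h]
    have h1 : (M : ℝ) + 1 ≤ e * ((M / e : ℕ) : ℝ) + e := by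
      have := Nat.div_add_mod M e
      have h2 := Nat.mod_lt M (Nat.pos_of_ne_zero he)
      exact_mod_cast (by omega : M + 1 ≤ e * (M / e) + e)
    have h2 : ((M / e : ℕ) : ℝ) ≤ M / e := Nat.cast_div_le
    simp only [dvd_zero, if_true]
    push_cast
    constructor
    · rw [div_le_iff₀ he']; linarith
    · have : (M : ℝ) / e ≤ (M + 1) / e := by gcongr; linarith
      linarith

lemma aux_count (e : ℕ) (he : e ≠ 0) (a N : ℕ) :
    |∑ b ∈ range N, (if e ∣ a + b then (1 : ℝ) else 0) - N / e| ≤ 1 := by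
  have h1 := aux_count0 e he (a + N)
  have h2 := aux_count0 e he a
  rw [Finset.sum_range_add] at h1
  push_cast at h1
  rw [add_div] at h1
  rw [abs_le]
  constructor <;> linarith [h1.1, h1.2, h2.1, h2.2]

lemma aux_incl (S : Finset ℕ) (hS : ∀ p ∈ S, p.Prime) (n : ℕ) :
    (if ∀ p ∈ S, ¬ p ∣ n then (1 : ℝ) else 0)
      = ∑ U ∈ S.powerset, (-1) ^ #U * (if ∏ p ∈ U, p ∣ n then (1 : ℝ) else 0) := by
  have h1 : (if ∀ p ∈ S, ¬ p ∣ n then (1 : ℝ) else 0)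
      = ∏ p ∈ S, (1 + (-1) * (if p ∣ n then (1 : ℝ) else 0)) := by
    split_ifs with h
    · symm
      refine Finset.prod_eq_one fun p hp => ?_
      simp [h p hp]
    · push Not at h
      obtain ⟨p, hp, hd⟩ := h
      symm
      refine Finset.prod_eq_zero hp ?_
      simp [hd]
  rw [h1, Finset.prod_one_add]
  refine Finset.sum_congr rfl fun U hU => ?_
  rw [Finset.mem_powerset] at hU
  rw [Finset.prod_mul_distrib, Finset.prod_const]
  congr 1
  have hiff : (∏ p ∈ U, p ∣ n) ↔ ∀ p ∈ U, p ∣ n := by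
    constructor
    · intro h p hp
      exact (Finset.dvd_prod_of_mem _ hp).trans h
    · intro h
      refine Finset.prod_primes_dvd n (fun p hp => (hS p (hU hp)).prime) h
  rw [Finset.prod_ite_zero]
  simp [hiff]

lemma aux_sieve {k : ℕ} [NeZero k] (χ : DirichletCharacter ℂ k) (hχ : χ.IsPrimitive) (h1 : χ ≠ 1)
    (S : Finset ℕ) (hS : ∀ p ∈ S, p.Prime) (N : ℕ) (hN : 0 < N)
    (hyp : ∀ n < 2 * N, (∀ p ∈ S, ¬ p ∣ n) → χ (n : ZMod k) = 1) :
    N * ∏ p ∈ S, (1 - 1 / (p : ℝ)) ≤ 2 ^ #S * (√k + 1) := by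
  have hN' : (0 : ℝ) < N := by exact_mod_cast hN
  have hU0 : ∀ U ∈ S.powerset, ∏ p ∈ U, p ≠ 0 := by
    intro U hU
    rw [Finset.mem_powerset] at hU
    exact Finset.prod_ne_zero_iff.2 fun p hp => (hS p (hU hp)).ne_zero
  set T : ℝ := ∑ a ∈ range N, ∑ b ∈ range N, (if ∀ p ∈ S, ¬ p ∣ a + b then (1 : ℝ) else 0) with hT
  -- upper bound
  have hup : T ≤ 2 ^ #S * (√k * N) := by
    have hTc : (T : ℂ) = ∑ U ∈ S.powerset, (-1) ^ #U *
        ∑ a ∈ range N, ∑ b ∈ range N,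
          (if ∏ p ∈ U, p ∣ a + b then χ ((a + b : ℕ) : ZMod k) else 0) := by
      simp_rw [Finset.mul_sum]
      rw [Finset.sum_comm, hT]
      push_cast
      refine Finset.sum_congr rfl fun a ha => ?_
      rw [Finset.sum_comm]
      refine Finset.sum_congr rfl fun b hb => ?_
      have hab : a + b < 2 * N := by
        have := Finset.mem_range.1 ha
        have := Finset.mem_range.1 hb
        omega
      have h2 : (((if ∀ p ∈ S, ¬ p ∣ a + b then (1 : ℝ) else 0) : ℝ) : ℂ)
          = (((if ∀ p ∈ S, ¬ p ∣ a + b then (1 : ℝ) else 0) : ℝ) : ℂ)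
            * χ ((a + b : ℕ) : ZMod k) := by
        split_ifs with h
        · rw [hyp _ hab h]; simp
        · simp
      have h3 := aux_incl S hS (a + b)
      push_cast at h2 ⊢
      rw [h2, h3]
      push_cast
      rw [Finset.sum_mul]
      refine Finset.sum_congr rfl fun U _ => ?_
      split_ifs <;> simp
    have : T ≤ ‖(T : ℂ)‖ := by
      rw [Complex.norm_real]; exact le_abs_self _
    refine this.trans ?_
    rw [hTc]
    refine (norm_sum_le _ _).trans ?_
    have : ∀ U ∈ S.powerset, ‖(-1 : ℂ) ^ #U * ∑ a ∈ range N, ∑ b ∈ range N,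
          (if ∏ p ∈ U, p ∣ a + b then χ ((a + b : ℕ) : ZMod k) else 0)‖ ≤ √k * N := by
      intro U hU
      rw [norm_mul]
      simp only [norm_pow, norm_neg, norm_one, one_pow, one_mul]
      exact aux_e χ hχ h1 _ (hU0 U hU) N
    refine (Finset.sum_le_sum this).trans ?_
    rw [Finset.sum_const, Finset.card_powerset, nsmul_eq_mul]
    push_cast
    exact le_refl _
  -- lower bound
  have hlow : N * (N * ∏ p ∈ S, (1 - 1 / (p : ℝ)) - 2 ^ #S) ≤ T := by
    have hrow : ∀ a ∈ range N, (N * ∏ p ∈ S, (1 - 1 / (p : ℝ)) - 2 ^ #S)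
        ≤ ∑ b ∈ range N, (if ∀ p ∈ S, ¬ p ∣ a + b then (1 : ℝ) else 0) := by
      intro a _
      simp_rw [aux_incl S hS]
      rw [Finset.sum_comm]
      have hprod : N * ∏ p ∈ S, (1 - 1 / (p : ℝ))
          = ∑ U ∈ S.powerset, (-1) ^ #U * ((N : ℝ) / ((∏ p ∈ U, p : ℕ) : ℝ)) := by
        have : ∀ p ∈ S, (1 - 1 / (p : ℝ)) = 1 + (-1) * (1 / (p : ℝ)) := by intros; ring
        rw [Finset.prod_congr rfl this, Finset.prod_one_add, Finset.mul_sum]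
        refine Finset.sum_congr rfl fun U _ => ?_
        rw [Finset.prod_mul_distrib, Finset.prod_const, Finset.prod_div_distrib]
        push_cast
        simp
        ring
      have h2 : (2 : ℝ) ^ #S = ∑ U ∈ S.powerset, (1 : ℝ) := by
        rw [Finset.sum_const, Finset.card_powerset]; simp
      rw [hprod, h2, ← Finset.sum_sub_distrib]
      refine Finset.sum_le_sum fun U hU => ?_
      rw [← Finset.mul_sum]
      have hc := abs_le.1 (aux_count (∏ p ∈ U, p) (hU0 U hU) a N)
      rcases neg_one_pow_eq_or ℝ #U with h | h <;> rw [h] <;> linarith [hc.1, hc.2]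
    have := Finset.sum_le_sum hrow
    rw [Finset.sum_const, card_range, nsmul_eq_mul] at this
    exact this
  have h3 := hlow.trans hup
  have h4 : N * (N * ∏ p ∈ S, (1 - 1 / (p : ℝ))) ≤ N * (2 ^ #S * (√k + 1)) := by linarith
  exact le_of_mul_le_mul_left h4 hN'


lemma aux_char (D : ℤ) (hD : D ≠ 0) : ∃ χ : DirichletCharacter ℂ (4 * D.natAbs),
    ∀ n : ℕ, n.Coprime (4 * D.natAbs) → χ (n : ZMod (4 * D.natAbs)) = (jacobiSym D n : ℂ) := by
  have hd : D.natAbs ≠ 0 := Int.natAbs_ne_zero.2 hD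
  have hne : NeZero (4 * D.natAbs) := ⟨by positivity⟩
  have hodd : ∀ n : ℕ, n.Coprime (4 * D.natAbs) → Odd n := by
    intro n hn
    rw [← Nat.coprime_two_right]
    exact Nat.Coprime.coprime_dvd_right ⟨2 * D.natAbs, by ring⟩ hn
  have h4 : 1 < 4 * D.natAbs := by omega
  classical
  refine ⟨{ toFun := fun x => if IsUnit x then (jacobiSym D x.val : ℂ) else 0
            map_one' := ?_
            map_mul' := ?_
            map_nonunit' := ?_ }, ?_⟩
  · have : Fact (1 < 4 * D.natAbs) := ⟨h4⟩
    simp [ZMod.val_one]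
  · intro x y
    by_cases hx : IsUnit x
    · by_cases hy : IsUnit y
      · have hxy := hx.mul hy
        simp only [hx, hy, hxy, if_true]
        have hx' : x.val.Coprime (4 * D.natAbs) := by
          rw [← ZMod.isUnit_iff_coprime]; simpa using hx
        have hy' : y.val.Coprime (4 * D.natAbs) := by
          rw [← ZMod.isUnit_iff_coprime]; simpa using hy
        have ox := hodd _ hx'
        have oy := hodd _ hy'
        rw [ZMod.val_mul, ← jacobiSym.mod_right D (ox.mul oy),
          jacobiSym.mul_right' D ox.pos.ne' oy.pos.ne']
        push_cast; rfl
      · have : ¬ IsUnit (x * y) := fun h => hy (isUnit_of_mul_isUnit_right h)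
        simp [hy, this]
    · have : ¬ IsUnit (x * y) := fun h => hx (isUnit_of_mul_isUnit_left h)
      simp [hx, this]
  · intro x hx
    simp [hx]
  · intro n hn
    have hu : IsUnit (n : ZMod (4 * D.natAbs)) := (ZMod.isUnit_iff_coprime _ _).2 hn
    change (if IsUnit (n : ZMod (4 * D.natAbs)) then
      (jacobiSym D (n : ZMod (4 * D.natAbs)).val : ℂ) else 0) = _
    rw [if_pos hu, ZMod.val_natCast, ← jacobiSym.mod_right D (hodd _ hn)]

lemma aux_nontriv (D : ℤ) (hD : D ≠ 0) (hsq : ¬ IsSquare D) :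
    ∃ n : ℕ, n.Coprime (4 * D.natAbs) ∧ jacobiSym D n = -1 := by
  have hd : D.natAbs ≠ 0 := Int.natAbs_ne_zero.2 hD
  obtain ⟨a, b, hab, hsf⟩ := Nat.sq_mul_squarefree D.natAbs
  have hb0 : b ≠ 0 := by rintro rfl; simp at hab; omega
  have ha0 : a ≠ 0 := by rintro rfl; simp at hab; omega
  obtain ⟨s, hs, hDs⟩ : ∃ s : ℤ, s.natAbs = a ∧ D = s * (b : ℤ) ^ 2 := by
    rcases Int.natAbs_eq D with h | h
    · exact ⟨a, by simp, by rw [h, ← hab]; push_cast; ring⟩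
    · exact ⟨-a, by simp, by rw [h, ← hab]; push_cast; ring⟩
  have hs1 : s ≠ 1 := by
    rintro rfl
    exact hsq ⟨b, by rw [hDs]; ring⟩
  have hred : ∀ n : ℕ, n.Coprime (4 * D.natAbs) → jacobiSym D n = jacobiSym s n := by
    intro n hn
    have hbn : (b : ℤ).gcd n = 1 := by
      rw [Int.gcd_natCast_natCast]
      refine (Nat.Coprime.coprime_dvd_right ?_ hn).symm
      rw [← hab]
      exact ⟨4 * b * a, by ring⟩
    rw [hDs, jacobiSym.mul_left, jacobiSym.sq_one' hbn, mul_one]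
  by_cases hp : ∃ p : ℕ, p.Prime ∧ p ≠ 2 ∧ p ∣ a
  · obtain ⟨p, hp, hp2, hpa⟩ := hp
    have hpF : Fact p.Prime := ⟨hp⟩
    have hpodd : Odd p := hp.odd_of_ne_two hp2
    obtain ⟨a', rfl⟩ := hpa
    have hpa' : p.Coprime a' := (Nat.squarefree_mul_iff.1 hsf).1
    obtain ⟨s', hs'⟩ : (p : ℤ) ∣ s := by
      rw [Int.natCast_dvd, hs]; exact dvd_mul_right _ _
    have hsa : s'.natAbs = a' := by
      have : p * s'.natAbs = p * a' := by
        rw [← hs, hs', Int.natAbs_mul]; simp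
      exact Nat.eq_of_mul_eq_mul_left hp.pos this
    set w := ordCompl[p] D.natAbs with hw
    have hpw : p.Coprime w := Nat.coprime_ordCompl hp hd
    have hw0 : w ≠ 0 := (Nat.ordCompl_pos p hd).ne'
    have haw : a' ∣ w := by
      have h1 : a' ∣ ordProj[p] D.natAbs * w := by
        rw [hw, Nat.ordProj_mul_ordCompl_eq_self, ← hab]
        exact ⟨b ^ 2 * p, by ring⟩
      exact Nat.Coprime.dvd_of_dvd_mul_left (Nat.Coprime.pow_right _ hpa'.symm) h1
    obtain ⟨r, hr⟩ : ∃ r : ZMod p, ¬ IsSquare r :=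
      FiniteField.exists_nonsquare (by rw [ZMod.ringChar_zmod_n]; exact hp2)
    have h8p : (4 * w).Coprime p := by
      refine Nat.Coprime.mul_left ?_ hpw.symm
      have : Nat.Coprime 2 p := (Nat.coprime_primes Nat.prime_two hp).2 (Ne.symm hp2)
      exact Nat.Coprime.pow_left 2 this
    obtain ⟨n, hn1, hn2⟩ := Nat.chineseRemainder h8p 1 r.val
    have hnw : n.Coprime (4 * w) := by
      have := hn1.gcd_eq
      rw [Nat.gcd_one_left] at this
      exact this
    have hnp : ((n : ℤ) : ZMod p) = r := by
      have := (ZMod.natCast_eq_natCast_iff _ _ _).2 hn2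
      simpa using this
    have hnp' : jacobiSym n p = -1 := by
      refine ZMod.nonsquare_iff_jacobiSym_eq_neg_one.2 ?_
      rw [hnp]
      exact hr
    have hncp : n.Coprime p := by
      by_contra h
      have : jacobiSym n p = 0 := by
        rw [jacobiSym.eq_zero_iff_not_coprime, Int.gcd_natCast_natCast]; exact h
      omega
    have hcop : n.Coprime (4 * D.natAbs) := by
      rw [← Nat.ordProj_mul_ordCompl_eq_self D.natAbs p, ← hw]
      refine Nat.Coprime.mul_right (Nat.Coprime.coprime_dvd_right (dvd_mul_right _ _) hnw) ?_
      exact Nat.Coprime.mul_right (Nat.Coprime.pow_right _ hncp)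
        (Nat.Coprime.coprime_dvd_right (dvd_mul_left _ _) hnw)
    have hn4 : n % 4 = 1 := by
      have := hn1.of_dvd (dvd_mul_right 4 w)
      exact this
    have hnodd : Odd n := by rw [Nat.odd_iff]; omega
    refine ⟨n, hcop, ?_⟩
    rw [hred n hcop, hs', jacobiSym.mul_left, jacobiSym.quadratic_reciprocity_one_mod_four' hpodd hn4,
      hnp', jacobiSym.mod_right s' hnodd, hsa]
    have h5 : n % (4 * a') = 1 % (4 * a') := hn1.of_dvd (Nat.mul_dvd_mul_left 4 haw)
    have haz : a' ≠ 0 := by rintro rfl; simp at ha0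
    rw [h5, Nat.mod_eq_of_lt (by omega), jacobiSym.one_right]
    norm_num
  · push Not at hp
    have ha12 : a = 1 ∨ a = 2 := by
      have h2 : a = 2 ^ a.primeFactorsList.length :=
        Nat.eq_prime_pow_of_unique_prime_dvd ha0 (fun {q} hq hqa => by
          by_contra h
          exact hp q hq h hqa)
      rcases Nat.eq_zero_or_pos a.primeFactorsList.length with h | h
      · left; rw [h2, h]; rfl
      · right
        by_contra h3
        have : 2 ≤ a.primeFactorsList.length := by
          by_contra h4
          have : a.primeFactorsList.length = 1 := by omega
          rw [this] at h2; exact h3 h2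
        have h4 : 2 * 2 ∣ a := by
          rw [h2]; exact pow_dvd_pow 2 this
        have := hsf 2 h4
        simp at this
    set w := ordCompl[2] D.natAbs with hw
    have hpw : Nat.Coprime 2 w := Nat.coprime_ordCompl Nat.prime_two hd
    have h8 : Nat.Coprime 8 w := Nat.Coprime.pow_left 3 hpw
    have main : ∀ c : ℕ, c % 2 = 1 → ∃ n : ℕ, n.Coprime (4 * D.natAbs) ∧ n % 8 = c % 8 := by
      intro c hc
      obtain ⟨n, hn1, hn2⟩ := Nat.chineseRemainder h8 c 1
      have hn1' : n % 8 = c % 8 := hn1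
      have hnw : n.Coprime w := by
        have := hn2.gcd_eq
        rw [Nat.gcd_one_left] at this
        exact this
      have hn2 : n.Coprime 2 := by
        rw [Nat.coprime_two_right, Nat.odd_iff]; omega
      refine ⟨n, ?_, hn1'⟩
      rw [← Nat.ordProj_mul_ordCompl_eq_self D.natAbs 2, ← hw]
      exact Nat.Coprime.mul_right (Nat.Coprime.pow_right 2 hn2)
        (Nat.Coprime.mul_right (Nat.Coprime.pow_right _ hn2) hnw)
    have hcast : ∀ n c : ℕ, n % 8 = c % 8 → (n : ZMod 8) = (c : ZMod 8) := by
      intro n c h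
      exact (ZMod.natCast_eq_natCast_iff _ _ _).2 h
    rcases ha12 with h | h
    · have hs' : s = -1 := by omega
      obtain ⟨n, hn, hn8⟩ := main 3 (by norm_num)
      refine ⟨n, hn, ?_⟩
      rw [hred n hn, hs', jacobiSym.at_neg_one (by rw [Nat.odd_iff]; omega)]
      have : (n : ZMod 4) = (3 : ℕ) := (ZMod.natCast_eq_natCast_iff _ _ _).2
        (by change n % 4 = 3 % 4; omega)
      rw [this]; decide
    · obtain ⟨n, hn, hn8⟩ := main 5 (by norm_num)
      refine ⟨n, hn, ?_⟩
      rw [hred n hn]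
      have ho : Odd n := by rw [Nat.odd_iff]; omega
      rcases (by omega : s = 2 ∨ s = -2) with h | h
      · rw [h, jacobiSym.at_two ho, hcast n 5 hn8]; decide
      · rw [h, jacobiSym.at_neg_two ho, hcast n 5 hn8]; decide

lemma aux_small (n : ℕ) (hn : 71 ≤ n) : (64 * (n : ℝ) ^ 5 / ((n : ℝ) - 1) ^ 6) ≤ 1 := by
  obtain ⟨m, rfl⟩ := Nat.exists_eq_add_of_le hn
  have hm : (0 : ℝ) ≤ m := Nat.cast_nonneg m
  push_cast
  rw [div_le_one (by apply pow_pos; linarith)]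
  have : 0 ≤ (71 + (m : ℝ) - 1) ^ 6 - 64 * (71 + (m : ℝ)) ^ 5 := by
    ring_nf
    positivity
  linarith

lemma aux_prod (S : Finset ℕ) (hS : ∀ p ∈ S, p.Prime) :
    ∏ p ∈ S, (64 * (p : ℝ) ^ 5 / ((p : ℝ) - 1) ^ 6) ≤ 1000 ^ 6 := by
  have hnn : ∀ n : ℕ, 0 ≤ (64 * (n : ℝ) ^ 5 / ((n : ℝ) - 1) ^ 6) := by
    intro n
    have : 0 ≤ ((n : ℝ) - 1) ^ 6 := Even.pow_nonneg (by decide) _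
    positivity
  set g : ℕ → ℝ := fun n => max 1 (64 * (n : ℝ) ^ 5 / ((n : ℝ) - 1) ^ 6) with hg
  have h1 : ∏ p ∈ S, (64 * (p : ℝ) ^ 5 / ((p : ℝ) - 1) ^ 6) ≤ ∏ p ∈ S, g p :=
    Finset.prod_le_prod (fun p _ => hnn p) (fun p _ => le_max_right _ _)
  have h2 : ∏ p ∈ S, g p = ∏ p ∈ S.filter (· < 71), g p := by
    symm
    refine Finset.prod_subset (Finset.filter_subset _ _) ?_
    intro p hp hp'
    have : 71 ≤ p := by
      by_contra h
      exact hp' (Finset.mem_filter.2 ⟨hp, by omega⟩)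
    exact max_eq_left (aux_small p this)
  have h3 : ∏ p ∈ S.filter (· < 71), g p ≤ ∏ p ∈ (range 71).filter Nat.Prime, g p := by
    refine Finset.prod_le_prod_of_subset_of_one_le ?_ (fun p _ => zero_le_one.trans (le_max_left _ _))
      (fun p _ _ => le_max_left _ _)
    intro p hp
    rw [Finset.mem_filter] at hp ⊢
    exact ⟨Finset.mem_range.2 hp.2, hS p hp.1⟩
  have hfil : (range 71).filter Nat.Prime
      = {2,3,5,7,11,13,17,19,23,29,31,37,41,43,47,53,59,61,67} := by
    ext p
    simp only [mem_filter, mem_range, mem_insert, mem_singleton]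
    constructor
    · rintro ⟨h1, h2⟩
      interval_cases p <;> first | omega | (exfalso; revert h2; norm_num)
    · intro h
      rcases h with h | h | h | h | h | h | h | h | h | h | h | h | h | h | h | h | h | h | h <;>
        subst h <;> norm_num
  have h4 : ∏ p ∈ (range 71).filter Nat.Prime, g p ≤ 1000 ^ 6 := by
    rw [hfil]
    simp only [hg]
    norm_num
  linarith

lemma aux_final (D : ℤ) (hD : D ≠ 0) (hsq : ¬ IsSquare D) (M : ℕ) (hM : 2 ≤ M)
    (B : ℝ) (hB : B = 20664 * (D.natAbs : ℝ) ^ ((2 : ℝ) / 3) * (M : ℝ) ^ ((1 : ℝ) / 6))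
    (hcon : ∀ q : ℕ, q.Prime → (q : ℝ) < B → q ≠ 2 → jacobiSym D q = -1 → ¬ Nat.Coprime q M) :
    False := by
  have hd : D.natAbs ≠ 0 := Int.natAbs_ne_zero.2 hD
  have hne : NeZero (4 * D.natAbs) := ⟨by positivity⟩
  obtain ⟨χ₀, hχ₀⟩ := aux_char D hD
  obtain ⟨n₀, hn₀, hJ⟩ := aux_nontriv D hD hsq
  have hχ₀1 : χ₀ ≠ 1 := by
    intro h
    have h1 := hχ₀ n₀ hn₀
    rw [h, hJ, MulChar.one_apply ((ZMod.isUnit_iff_coprime _ _).2 hn₀)] at h1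
    norm_num at h1
  set k := χ₀.conductor with hk
  have hk0 : NeZero k := ⟨χ₀.conductor_ne_zero⟩
  have hkd : k ∣ 4 * D.natAbs := χ₀.conductor_dvd_level
  set χ : DirichletCharacter ℂ k := χ₀.primitiveCharacter with hχdef
  have hχ : χ.IsPrimitive := χ₀.primitiveCharacter_isPrimitive
  have hχ1 : χ ≠ 1 := by
    intro h
    apply hχ₀1
    rw [← χ₀.changeLevel_primitiveCharacter, ← hχdef, h]
    exact map_one _
  have hval : ∀ n : ℕ, n.Coprime (4 * D.natAbs) → χ (n : ZMod k) = (jacobiSym D n : ℂ) := by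
    intro n hn
    rw [← hχ₀ n hn]
    have := χ₀.primitiveCharacter_apply_of_isCoprime (a := n) (Nat.isCoprime_iff_coprime.2 hn)
    simpa using this
  set S := (2 * D.natAbs * M).primeFactors with hSdef
  have hS : ∀ p ∈ S, p.Prime := fun p hp => Nat.prime_of_mem_primeFactors hp
  have h0 : 2 * D.natAbs * M ≠ 0 := by positivity
  set P : ℝ := ∏ p ∈ S, (2 * (p : ℝ) / ((p : ℝ) - 1)) with hP
  have hp1 : ∀ p ∈ S, (0 : ℝ) < (p : ℝ) - 1 := by
    intro p hp
    have : (2 : ℝ) ≤ p := by exact_mod_cast (hS p hp).two_le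
    linarith
  have hP0 : 0 < P := by
    refine Finset.prod_pos fun p hp => ?_
    have := hp1 p hp
    have : (0 : ℝ) < p := by linarith
    positivity
  set N := ⌊P * (√k + 1)⌋₊ + 1 with hN
  have hN1 : P * (√k + 1) < N := by
    rw [hN]; push_cast; exact Nat.lt_floor_add_one _
  have hN2 : (N : ℝ) ≤ P * (√k + 1) + 1 := by
    rw [hN]; push_cast
    have := Nat.floor_le (a := P * (√k + 1)) (by positivity)
    linarith
  -- size bound
  have hdR : (1 : ℝ) ≤ D.natAbs := by exact_mod_cast Nat.one_le_iff_ne_zero.2 hd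
  have hMR : (1 : ℝ) ≤ M := by exact_mod_cast (by omega : 1 ≤ M)
  set d : ℝ := (D.natAbs : ℝ) with hdd
  set Y : ℝ := (d * M) ^ ((1 : ℝ) / 6) with hY
  have hdM : 1 ≤ d * M := one_le_mul_of_one_le_of_one_le hdR hMR
  have hY1 : 1 ≤ Y := Real.one_le_rpow hdM (by norm_num)
  have hsd1 : 1 ≤ √d := Real.one_le_sqrt.2 hdR
  have hBY : B = 20664 * (√d * Y) := by
    rw [hB, hY, Real.mul_rpow (by linarith) (by linarith), Real.sqrt_eq_rpow, mul_assoc,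
      ← mul_assoc (d ^ ((1 : ℝ) / 2)), ← Real.rpow_add (by linarith)]
    norm_num
  have hP6 : P ^ 6 ≤ (2000 * Y) ^ 6 := by
    have h1 : P ^ 6 = (∏ p ∈ S, (64 * (p : ℝ) ^ 5 / ((p : ℝ) - 1) ^ 6)) * ∏ p ∈ S, (p : ℝ) := by
      rw [hP, ← Finset.prod_pow, ← Finset.prod_mul_distrib]
      refine Finset.prod_congr rfl fun p hp => ?_
      rw [div_pow]; ring
    have h2 : ∏ p ∈ S, (p : ℝ) ≤ 2 * d * M := by
      have := Nat.le_of_dvd (Nat.pos_of_ne_zero h0) (Nat.prod_primeFactors_dvd (2 * D.natAbs * M))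
      have h' : ((∏ p ∈ S, p : ℕ) : ℝ) ≤ ((2 * D.natAbs * M : ℕ) : ℝ) := Nat.cast_le.2 this
      push_cast at h'
      rw [hdd]
      exact_mod_cast h'
    have h3 : Y ^ 6 = d * M := by
      rw [hY, ← Real.rpow_natCast, ← Real.rpow_mul (by linarith)]
      norm_num
    rw [h1, mul_pow, h3]
    calc _ ≤ (1000 : ℝ) ^ 6 * (2 * d * M) :=
          mul_le_mul (aux_prod S hS) h2 (Finset.prod_nonneg fun _ _ => Nat.cast_nonneg _)
            (by norm_num)
      _ ≤ _ := by nlinarith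
  have hPY : P ≤ 2000 * Y := le_of_pow_le_pow_left₀ (by norm_num) (by linarith) hP6
  have hsk : √k ≤ 2 * √d := by
    have h1 : (k : ℝ) ≤ 4 * d := by
      have := Nat.le_of_dvd (by positivity) hkd
      rw [hdd]; exact_mod_cast this
    calc √k ≤ √(2 ^ 2 * d) := Real.sqrt_le_sqrt (by linarith)
      _ = 2 * √d := by rw [Real.sqrt_mul (by norm_num), Real.sqrt_sq (by norm_num)]
  have hNB : 2 * (N : ℝ) ≤ B := by
    have h1 : P * (√k + 1) ≤ (2000 * Y) * (3 * √d) :=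
      mul_le_mul hPY (by linarith) (by positivity) (by linarith)
    have h2 : 1 ≤ √d * Y := one_le_mul_of_one_le_of_one_le hsd1 hY1
    rw [hBY]
    nlinarith
  -- all small good integers have character value one
  have hprime : ∀ q : ℕ, q.Prime → q < 2 * N → q ∉ S → χ (q : ZMod k) = 1 := by
    intro q hq hqN hqS
    have hqB : (q : ℝ) < B := by
      refine lt_of_lt_of_le ?_ hNB
      exact_mod_cast hqN
    have hnd : ¬ q ∣ 2 * D.natAbs * M := fun h => hqS (Nat.mem_primeFactors.2 ⟨hq, h, h0⟩)
    have hc : q.Coprime (2 * D.natAbs * M) := (Nat.Prime.coprime_iff_not_dvd hq).2 hnd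
    have hc2 : q.Coprime 2 := Nat.Coprime.coprime_dvd_right ⟨D.natAbs * M, by ring⟩ hc
    have hcD : q.Coprime D.natAbs := Nat.Coprime.coprime_dvd_right ⟨2 * M, by ring⟩ hc
    have hcM : q.Coprime M := Nat.Coprime.coprime_dvd_right ⟨2 * D.natAbs, by ring⟩ hc
    have hq2 : q ≠ 2 := by rintro rfl; norm_num at hc2
    have hgcd : D.gcd q = 1 := by
      rw [Int.gcd_eq_natAbs]; simpa using hcD.symm
    rw [hval q (Nat.Coprime.mul_right (Nat.Coprime.pow_right 2 hc2) hcD)]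
    rcases jacobiSym.eq_one_or_neg_one hgcd with h | h
    · rw [h]; norm_num
    · exact absurd hcM (hcon q hq hqB hq2 h)
  have h2S : 2 ∈ S := Nat.mem_primeFactors.2 ⟨Nat.prime_two, ⟨D.natAbs * M, by ring⟩, h0⟩
  have hall : ∀ n : ℕ, n < 2 * N → (∀ p ∈ S, ¬ p ∣ n) → χ (n : ZMod k) = 1 := by
    intro n
    induction n using Nat.recOnMul with
    | zero => intro _ h; exact absurd (dvd_zero 2) (h 2 h2S)
    | one => intro _ _; simp
    | prime p hp =>
      intro hlt h
      exact hprime p hp hlt (fun hpS => h p hpS dvd_rfl)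
    | mul a b iha ihb =>
      intro hlt h
      have hab : a * b ≠ 0 := by
        intro h'
        exact h 2 h2S (by rw [h']; exact dvd_zero 2)
      have ha : a ≤ a * b := Nat.le_mul_of_pos_right a (Nat.pos_of_ne_zero (right_ne_zero_of_mul hab))
      have hb : b ≤ a * b := Nat.le_mul_of_pos_left b (Nat.pos_of_ne_zero (left_ne_zero_of_mul hab))
      push_cast
      rw [map_mul, iha (by omega) (fun p hp hd => h p hp (hd.mul_right b)),
        ihb (by omega) (fun p hp hd => h p hp (hd.mul_left a)), mul_one]
  have hsieve := aux_sieve χ hχ hχ1 S hS N (by omega) hall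
  have hprod : P * ∏ p ∈ S, (1 - 1 / (p : ℝ)) = 2 ^ #S := by
    rw [hP, ← Finset.prod_mul_distrib, ← Finset.prod_const]
    refine Finset.prod_congr rfl fun p hp => ?_
    have h1 := hp1 p hp
    have h2 : (p : ℝ) ≠ 0 := by linarith
    have h3 := h1.ne'
    field_simp
  have hpos : 0 < ∏ p ∈ S, (1 - 1 / (p : ℝ)) := by
    refine Finset.prod_pos fun p hp => ?_
    have h1 := hp1 p hp
    rw [sub_pos, div_lt_one (by linarith)]
    linarith
  have := mul_lt_mul_of_pos_right hN1 hpos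
  have h5 : P * (√k + 1) * ∏ p ∈ S, (1 - 1 / (p : ℝ)) = 2 ^ #S * (√k + 1) := by
    rw [← hprod]; ring
  linarith

end Aux

/-- For a non-square discriminant `D` and `M ≥ 2` coprime to `D`, there is a prime
`q < 20664·|D|^(2/3)·M^(1/6)` with `(D/q) = −1` and `gcd(q, M) = 1`. -/
theorem exists_inert_prime_bounded (D : ℤ) (hD4 : D % 4 = 0 ∨ D % 4 = 1)
    (hsq : ¬ IsSquare D) (M : ℕ) (hM : 2 ≤ M) (hcop : Int.gcd D M = 1) :
    ∃ q : ℕ, q.Prime ∧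
      (q : ℝ) < 20664 * (D.natAbs : ℝ) ^ ((2 : ℝ) / 3) * (M : ℝ) ^ ((1 : ℝ) / 6) ∧
      kroneckerPrime D q = -1 ∧ Nat.Coprime q M := by
  by_contra hcon
  push Not at hcon
  have hD : D ≠ 0 := by
    rintro rfl
    exact hsq ⟨0, by simp⟩
  refine aux_final D hD hsq M hM _ rfl ?_
  intro q hq hlt hq2 hJ
  refine hcon q hq hlt ?_
  unfold kroneckerPrime
  rw [if_neg hq2, hJ]
end
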